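/- Let P_k = 𝓛_k + V_k (k = 1,2) be two Schrödinger operators on ℝ^d as in the context, with λ_k* their generalized principal eigenvalues, and set Ṽ(x) := max{V₁(x), V₂(x)}. Suppose there exist a positive C² function Φ̃ and a compact set K ⊂ ℝ^d such that a₁ = a₂ and b₁ = b₂ on K^c and 𝓛₂Φ̃ + ṼΦ̃ ≤ λ₁*Φ̃ on K^c. Assume further: P₁ − λ₁* is critical in ℝ^d with ground state Ψ₁*; λ₂* ≤ λ₁*; and there exist a C² function Ψ (possibly sign-changing) with Ψ⁺ not identically zero and C > 0 such that 𝓛₂Ψ + V₂Ψ ≥ λ₁*Ψ on ℝ^d and Ψ⁺(x) ≤ C Ψ₁*(x) for all x ∈ ℝ^d. Then P₂ − λ₂* is critical in ℝ^d, λ₁* = λ₂*, and Ψ is a ground state of P₂ − λ₂* (in particular Ψ > 0). -/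

import Mathlib

open Metric Set Filter

noncomputable section

/-- `ℝ^d` as a Euclidean space. -/
abbrev Euc (d : ℕ) := EuclideanSpace ℝ (Fin d)

/-- First partial derivative `∂u/∂xᵢ`. -/
def pd {d : ℕ} (u : Euc d → ℝ) (i : Fin d) (x : Euc d) : ℝ :=
  fderiv ℝ u x (EuclideanSpace.single i 1)

/-- Second partial derivative `∂²u/∂xᵢ∂xⱼ`. -/
def pd2 {d : ℕ} (u : Euc d → ℝ) (i j : Fin d) (x : Euc d) : ℝ :=
  fderiv ℝ (fun y => pd u j y) x (EuclideanSpace.single i 1)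

/-- The second-order operator `𝓛u = Σ aᶦʲ ∂ᵢⱼu + Σ bᶦ ∂ᵢu`. -/
def Lop {d : ℕ} (a : Euc d → Matrix (Fin d) (Fin d) ℝ) (b : Euc d → Euc d)
    (u : Euc d → ℝ) (x : Euc d) : ℝ :=
  (∑ i, ∑ j, a x i j * pd2 u i j x) + ∑ i, b x i * pd u i x

/-- Frobenius norm of a matrix. -/
def frob {d : ℕ} (m : Matrix (Fin d) (Fin d) ℝ) : ℝ :=
  Real.sqrt (∑ i, ∑ j, (m i j) ^ 2)

/-- The quadratic form `⟨ξ, m ξ⟩`. -/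
def quadForm {d : ℕ} (m : Matrix (Fin d) (Fin d) ℝ) (ξ : Euc d) : ℝ :=
  ∑ i, ∑ j, m i j * ξ i * ξ j

/-- Local Hölder continuity on a set. -/
def LocallyHolderOn {E F : Type*} [PseudoMetricSpace E] [PseudoMetricSpace F]
    (f : E → F) (s : Set E) : Prop :=
  ∀ x ∈ s, ∃ (C r : NNReal), 0 < r ∧ r ≤ 1 ∧ ∃ ε > 0, HolderOnWith C r f (Metric.ball x ε ∩ s)

/-- Local Hölder continuity. -/
def LocallyHolder {E F : Type*} [PseudoMetricSpace E] [PseudoMetricSpace F] (f : E → F) : Prop :=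
  LocallyHolderOn f Set.univ

/-- The set of `λ ∈ ℝ` admitting a positive C² supersolution of `𝓛φ + Vφ ≤ λφ` on `D`. -/
def supersolutions {d : ℕ} (a : Euc d → Matrix (Fin d) (Fin d) ℝ) (b : Euc d → Euc d)
    (V : Euc d → ℝ) (D : Set (Euc d)) : Set ℝ :=
  {lam | ∃ φ : Euc d → ℝ, (∀ x ∈ D, 0 < φ x) ∧ ContDiffOn ℝ 2 φ D ∧
    ∀ x ∈ D, Lop a b φ x + V x * φ x ≤ lam * φ x}

/-- The generalized principal eigenvalue `λ*(𝓛,V)` on `D`. -/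
def lamStar {d : ℕ} (a : Euc d → Matrix (Fin d) (Fin d) ℝ) (b : Euc d → Euc d)
    (V : Euc d → ℝ) (D : Set (Euc d)) : ℝ :=
  sInf (supersolutions a b V D)

/-- `λ*(𝓛,V)` is finite: the defining set is nonempty and bounded below. -/
def lamStarFinite {d : ℕ} (a : Euc d → Matrix (Fin d) (Fin d) ℝ) (b : Euc d → Euc d)
    (V : Euc d → ℝ) (D : Set (Euc d)) : Prop :=
  (supersolutions a b V D).Nonempty ∧ BddBelow (supersolutions a b V D)

/-- A ground state of `𝓛 + W` in the open connected set `D`: a positive C² solution of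
minimal growth at infinity. -/
def IsGroundState {d : ℕ} (a : Euc d → Matrix (Fin d) (Fin d) ℝ) (b : Euc d → Euc d)
    (W : Euc d → ℝ) (u : Euc d → ℝ) (D : Set (Euc d)) : Prop :=
  (∀ x ∈ D, 0 < u x) ∧ ContDiffOn ℝ 2 u D ∧ (∀ x ∈ D, Lop a b u x + W x * u x = 0) ∧
  ∀ K : Set (Euc d), IsCompact K → K ⊆ D →
    ∀ v : Euc d → ℝ, ContDiffOn ℝ 2 v (D \ K) → (∀ x ∈ D \ K, 0 < v x) →
      (∀ x ∈ D \ K, Lop a b v x + W x * v x ≤ 0) →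
      ∃ K' : Set (Euc d), IsCompact K' ∧ K ⊆ K' ∧ K' ⊆ D ∧
        ∃ κ > 0, ∀ x ∈ D \ K', κ * u x ≤ v x

/-- Membership in `C₀⁺(ℝ^d)`: continuous, nonnegative, not identically zero, vanishing
at infinity. -/
def C0plus {d : ℕ} (h : Euc d → ℝ) : Prop :=
  Continuous h ∧ (∀ x, 0 ≤ h x) ∧ (∃ x, h x ≠ 0) ∧ Tendsto h (cocompact (Euc d)) (nhds 0)

/-- `λ*` is strictly monotone at `V` on the right. -/
def StrictMonoRight {d : ℕ} (a : Euc d → Matrix (Fin d) (Fin d) ℝ) (b : Euc d → Euc d)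
    (V : Euc d → ℝ) : Prop :=
  ∀ h : Euc d → ℝ, C0plus h →
    lamStar a b V Set.univ < lamStar a b (fun x => V x + h x) Set.univ

/-- `λ*` is strictly monotone at `V` (on both sides). -/
def StrictMonoAt {d : ℕ} (a : Euc d → Matrix (Fin d) (Fin d) ℝ) (b : Euc d → Euc d)
    (V : Euc d → ℝ) : Prop :=
  ∀ h : Euc d → ℝ, C0plus h →
    lamStar a b (fun x => V x - h x) Set.univ < lamStar a b V Set.univ ∧
    lamStar a b V Set.univ < lamStar a b (fun x => V x + h x) Set.univ

/-- Standing assumptions (A1)–(A3) with `b` Borel measurable and locally bounded. -/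
structure StandingB {d : ℕ} (a : Euc d → Matrix (Fin d) (Fin d) ℝ) (b : Euc d → Euc d) : Prop where
  posdef : ∀ x, (a x).PosDef
  aLip : ∀ R > 0, ∃ C > 0, ∀ x y : Euc d, ‖x‖ ≤ R → ‖y‖ ≤ R →
    frob (a x - a y) ≤ C * ‖x - y‖
  bMeas : Measurable b
  bLocBdd : ∀ R > 0, ∃ C, ∀ x : Euc d, ‖x‖ ≤ R → ‖b x‖ ≤ C
  nondeg : ∀ R > 0, ∃ C > 0, ∀ x : Euc d, ‖x‖ ≤ R → ∀ ξ : Euc d,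
    C⁻¹ * ‖ξ‖ ^ 2 ≤ quadForm (a x) ξ
  growth : ∃ C₀ > 0, ∀ x : Euc d,
    max (∑ i, b x i * x i) 0 + frob (a x) ≤ C₀ * (1 + ‖x‖ ^ 2)

/-- Standing assumptions (A1)–(A3) with `b` locally Hölder continuous. -/
structure StandingH {d : ℕ} (a : Euc d → Matrix (Fin d) (Fin d) ℝ) (b : Euc d → Euc d) : Prop where
  posdef : ∀ x, (a x).PosDef
  aLip : ∀ R > 0, ∃ C > 0, ∀ x y : Euc d, ‖x‖ ≤ R → ‖y‖ ≤ R →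
    frob (a x - a y) ≤ C * ‖x - y‖
  bHolder : LocallyHolder b
  nondeg : ∀ R > 0, ∃ C > 0, ∀ x : Euc d, ‖x‖ ≤ R → ∀ ξ : Euc d,
    C⁻¹ * ‖ξ‖ ^ 2 ≤ quadForm (a x) ξ
  growth : ∃ C₀ > 0, ∀ x : Euc d,
    max (∑ i, b x i * x i) 0 + frob (a x) ≤ C₀ * (1 + ‖x‖ ^ 2)

open scoped Topology

/-- Contraction of a matrix with a bilinear form in the standard basis. -/
def trc {d : ℕ} (m : Matrix (Fin d) (Fin d) ℝ) (H : Euc d →L[ℝ] Euc d →L[ℝ] ℝ) : ℝ :=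
  ∑ i, ∑ j, m i j * H (EuclideanSpace.single i 1) (EuclideanSpace.single j 1)

/-- `u` has first derivative `p` and second derivative `H` at `x`. -/
def HasJet {d : ℕ} (u : Euc d → ℝ) (x : Euc d) (p : Euc d →L[ℝ] ℝ)
    (H : Euc d →L[ℝ] Euc d →L[ℝ] ℝ) : Prop :=
  ∃ u' : Euc d → (Euc d →L[ℝ] ℝ), (∀ᶠ y in 𝓝 x, HasFDerivAt u (u' y) y) ∧ u' x = p ∧
    HasFDerivAt u' H x

section jets

variable {d : ℕ} {u v : Euc d → ℝ} {x : Euc d} {p q : Euc d →L[ℝ] ℝ}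
  {H G : Euc d →L[ℝ] Euc d →L[ℝ] ℝ} {m : Matrix (Fin d) (Fin d) ℝ}

theorem trc_add : trc m (H + G) = trc m H + trc m G := by
  simp [trc, mul_add, Finset.sum_add_distrib]

theorem trc_smul (c : ℝ) : trc m (c • H) = c * trc m H := by
  simp [trc, Finset.mul_sum, mul_left_comm]

theorem trc_sub : trc m (H - G) = trc m H - trc m G := by
  simp [trc, mul_sub, Finset.sum_sub_distrib]

theorem trc_smulRight (p q : Euc d →L[ℝ] ℝ) : trc m (p.smulRight q) =
    ∑ i, ∑ j, m i j * (p (EuclideanSpace.single i 1) * q (EuclideanSpace.single j 1)) := by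
  simp [trc]

theorem clm_eq_sum (p : Euc d →L[ℝ] ℝ) (s : Euc d) :
    p s = ∑ i, s i * p (EuclideanSpace.single i 1) := by
  conv_lhs => rw [← (EuclideanSpace.basisFun (Fin d) ℝ).sum_repr s]
  simp

theorem HasJet.hasFDerivAt (h : HasJet u x p H) : HasFDerivAt u p x := by
  obtain ⟨u', h1, h2, -⟩ := h
  exact h2 ▸ h1.self_of_nhds

theorem HasJet.Lop_eq (h : HasJet u x p H) (a : Euc d → Matrix (Fin d) (Fin d) ℝ)
    (b : Euc d → Euc d) : Lop a b u x = trc (a x) H + p (b x) := by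
  have hp := h.hasFDerivAt.fderiv
  obtain ⟨u', h1, h2, h3⟩ := h
  have e : ∀ j, (fun y => pd u j y) =ᶠ[𝓝 x] fun y => u' y (EuclideanSpace.single j 1) := by
    intro j
    filter_upwards [h1] with y hy
    rw [pd, hy.fderiv]
  have e2 : ∀ i j, pd2 u i j x = H (EuclideanSpace.single i 1) (EuclideanSpace.single j 1) := by
    intro i j
    rw [pd2, (e j).fderiv_eq, (h3.clm_apply (hasFDerivAt_const _ x)).fderiv]
    simp
  rw [Lop, trc, clm_eq_sum p (b x)]
  simp only [e2, pd, hp]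

theorem ContDiffAt.hasJet (h : ContDiffAt ℝ 2 u x) :
    HasJet u x (fderiv ℝ u x) (fderiv ℝ (fderiv ℝ u) x) := by
  refine ⟨fderiv ℝ u, ?_, rfl, ?_⟩
  · filter_upwards [h.eventually (by simp)] with y hy
    exact (hy.differentiableAt (by simp)).hasFDerivAt
  · exact ((h.fderiv_right (m := 1) (by norm_num)).differentiableAt (by simp)).hasFDerivAt

theorem HasJet.add (h : HasJet u x p H) (k : HasJet v x q G) :
    HasJet (fun y => u y + v y) x (p + q) (H + G) := by
  obtain ⟨u', h1, h2, h3⟩ := h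
  obtain ⟨v', k1, k2, k3⟩ := k
  refine ⟨fun y => u' y + v' y, ?_, by simp [h2, k2], h3.add k3⟩
  filter_upwards [h1, k1] with y hy ky
  exact hy.add ky

theorem HasJet.const_mul (h : HasJet u x p H) (c : ℝ) :
    HasJet (fun y => c * u y) x (c • p) (c • H) := by
  obtain ⟨u', h1, h2, h3⟩ := h
  refine ⟨fun y => c • u' y, ?_, by simp [h2], h3.const_smul c⟩
  filter_upwards [h1] with y hy
  exact hy.const_mul c

theorem HasJet.sub (h : HasJet u x p H) (k : HasJet v x q G) :
    HasJet (fun y => u y - v y) x (p - q) (H - G) := by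
  obtain ⟨u', h1, h2, h3⟩ := h
  obtain ⟨v', k1, k2, k3⟩ := k
  refine ⟨fun y => u' y - v' y, ?_, by simp [h2, k2], h3.sub k3⟩
  filter_upwards [h1, k1] with y hy ky
  exact hy.sub ky

theorem hasJet_const (c : ℝ) : HasJet (fun _ : Euc d => c) x 0 0 :=
  ⟨fun _ => 0, Eventually.of_forall fun y => hasFDerivAt_const c y, rfl, hasFDerivAt_const _ x⟩

theorem HasJet.mul (h : HasJet u x p H) (k : HasJet v x q G) :
    HasJet (fun y => u y * v y) x (u x • q + v x • p)
      (u x • G + v x • H + (p.smulRight q + q.smulRight p)) := by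
  have hp := h.hasFDerivAt
  have hq := k.hasFDerivAt
  obtain ⟨u', h1, h2, h3⟩ := h
  obtain ⟨v', k1, k2, k3⟩ := k
  refine ⟨fun y => u y • v' y + v y • u' y, ?_, by simp [h2, k2], ?_⟩
  · filter_upwards [h1, k1] with y hy ky
    exact hy.mul ky
  · have := (hp.smul k3).add (hq.smul h3)
    refine this.congr_fderiv ?_
    rw [h2, k2]
    abel

theorem HasJet.comp {f f' : ℝ → ℝ} {f'' : ℝ} (h : HasJet u x p H)
    (hf : ∀ᶠ t in 𝓝 (u x), HasDerivAt f (f' t) t) (hf' : HasDerivAt f' f'' (u x)) :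
    HasJet (fun y => f (u y)) x (f' (u x) • p) (f' (u x) • H + f'' • p.smulRight p) := by
  have hp := h.hasFDerivAt
  obtain ⟨u', h1, h2, h3⟩ := h
  refine ⟨fun y => f' (u y) • u' y, ?_, by simp [h2], ?_⟩
  · filter_upwards [h1, hp.continuousAt.eventually hf] with y hy ky
    exact ky.comp_hasFDerivAt y hy
  · have := (hf'.comp_hasFDerivAt x hp).smul h3
    refine this.congr_fderiv ?_
    ext s t
    simp [h2, mul_assoc]

theorem HasJet.compAffine {y₀ : Euc d} (h : HasJet u x p H) (A : Euc d →L[ℝ] Euc d) :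
    HasJet (fun y => u (x + A (y - y₀))) y₀ (p.comp A)
      ((ContinuousLinearMap.compL ℝ (Euc d) (Euc d) ℝ).flip A |>.comp (H.comp A)) := by
  obtain ⟨u', h1, h2, h3⟩ := h
  have haff : ∀ y, HasFDerivAt (fun y => x + A (y - y₀)) A y := fun y => by
    have := (A.hasFDerivAt (x := y - y₀)).comp y ((hasFDerivAt_id y).sub_const y₀)
    simpa using this.const_add x
  have e0 : x + A (y₀ - y₀) = x := by simp
  refine ⟨fun y => (u' (x + A (y - y₀))).comp A, ?_, by simp [h2], ?_⟩
  · have hc : Tendsto (fun y => x + A (y - y₀)) (𝓝 y₀) (𝓝 x) := by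
      have := (haff y₀).continuousAt
      rwa [ContinuousAt, e0] at this
    filter_upwards [hc.eventually h1] with y hy
    exact hy.comp y (haff y)
  · have h3' : HasFDerivAt u' H (x + A (y₀ - y₀)) := by rwa [e0]
    have := h3'.comp y₀ (haff y₀)
    exact (((ContinuousLinearMap.compL ℝ (Euc d) (Euc d) ℝ).flip A).hasFDerivAt).comp y₀ this

end jets

section lop

variable {d : ℕ} {u v : Euc d → ℝ} {x : Euc d}
  {a : Euc d → Matrix (Fin d) (Fin d) ℝ} {b : Euc d → Euc d}

theorem Lop_congr (h : u =ᶠ[𝓝 x] v) : Lop a b u x = Lop a b v x := by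
  have e : ∀ j, (fun y => pd u j y) =ᶠ[𝓝 x] fun y => pd v j y := by
    intro j
    filter_upwards [h.fderiv (𝕜 := ℝ)] with y hy
    rw [pd, hy, pd]
  simp only [Lop, pd2, (e _).fderiv_eq, (e _).self_of_nhds]

theorem Lop_add (hu : ContDiffAt ℝ 2 u x) (hv : ContDiffAt ℝ 2 v x) :
    Lop a b (fun y => u y + v y) x = Lop a b u x + Lop a b v x := by
  rw [(hu.hasJet.add hv.hasJet).Lop_eq, hu.hasJet.Lop_eq, hv.hasJet.Lop_eq, trc_add]
  simp; ring

theorem Lop_sub (hu : ContDiffAt ℝ 2 u x) (hv : ContDiffAt ℝ 2 v x) :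
    Lop a b (fun y => u y - v y) x = Lop a b u x - Lop a b v x := by
  rw [(hu.hasJet.sub hv.hasJet).Lop_eq, hu.hasJet.Lop_eq, hv.hasJet.Lop_eq, trc_sub]
  simp; ring

theorem Lop_const_mul (hu : ContDiffAt ℝ 2 u x) (c : ℝ) :
    Lop a b (fun y => c * u y) x = c * Lop a b u x := by
  rw [(hu.hasJet.const_mul c).Lop_eq, hu.hasJet.Lop_eq, trc_smul]
  simp; ring

theorem Lop_const (c : ℝ) : Lop a b (fun _ => c) x = 0 := by
  rw [(hasJet_const c).Lop_eq]
  simp [trc]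

/-- Contraction of the coefficient matrix with the square of the gradient. -/
def gradSq (a : Euc d → Matrix (Fin d) (Fin d) ℝ) (u : Euc d → ℝ) (x : Euc d) : ℝ :=
  trc (a x) ((fderiv ℝ u x).smulRight (fderiv ℝ u x))

theorem Lop_comp {f f' : ℝ → ℝ} {f'' : ℝ} (hu : ContDiffAt ℝ 2 u x)
    (hf : ∀ᶠ t in 𝓝 (u x), HasDerivAt f (f' t) t) (hf' : HasDerivAt f' f'' (u x)) :
    Lop a b (fun y => f (u y)) x = f' (u x) * Lop a b u x + f'' * gradSq a u x := by
  rw [(hu.hasJet.comp hf hf').Lop_eq, hu.hasJet.Lop_eq, trc_add, trc_smul, trc_smul, gradSq]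
  simp; ring

theorem Lop_mul_comp_div {f f' : ℝ → ℝ} {f'' : ℝ} {g s : Euc d → ℝ} (hg : ContDiffAt ℝ 2 g x)
    (hs : ContDiffAt ℝ 2 s x) (h0 : 0 < g x)
    (hf : ∀ᶠ t in 𝓝 (s x / g x), HasDerivAt f (f' t) t) (hf' : HasDerivAt f' f'' (s x / g x)) :
    Lop a b (fun y => g y * f (s y / g y)) x =
      f' (s x / g x) * Lop a b s x + (f (s x / g x) - s x / g x * f' (s x / g x)) * Lop a b g x +
        g x * f'' * gradSq a (fun y => s y / g y) x := by
  have hr : ContDiffAt ℝ 2 (fun y => s y / g y) x := hs.div hg h0.ne'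
  have es : s =ᶠ[𝓝 x] fun y => g y * (s y / g y) := by
    filter_upwards [hg.continuousAt.eventually (lt_mem_nhds h0)] with y hy
    field_simp
  have Ls := (hg.hasJet.mul hr.hasJet).Lop_eq a b
  rw [← Lop_congr es] at Ls
  rw [(hg.hasJet.mul (hr.hasJet.comp hf hf')).Lop_eq, Ls, hg.hasJet.Lop_eq, gradSq]
  simp only [trc_add, trc_smul, trc_smulRight, add_apply,
    smul_apply, smul_eq_mul]
  have e1 : ∀ c : ℝ, ∀ p q : Euc d →L[ℝ] ℝ, ∑ i, ∑ j, a x i j * (c * p (EuclideanSpace.single i 1) *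
      q (EuclideanSpace.single j 1)) =
      c * ∑ i, ∑ j, a x i j * (p (EuclideanSpace.single i 1) *
      q (EuclideanSpace.single j 1)) := fun c p q => by
    simp only [Finset.mul_sum]
    exact Finset.sum_congr rfl fun i _ => Finset.sum_congr rfl fun j _ => by ring
  have e2 : ∀ c : ℝ, ∀ p q : Euc d →L[ℝ] ℝ, ∑ i, ∑ j, a x i j * (p (EuclideanSpace.single i 1) *
      (c * q (EuclideanSpace.single j 1))) =
      c * ∑ i, ∑ j, a x i j * (p (EuclideanSpace.single i 1) *
      q (EuclideanSpace.single j 1)) := fun c p q => by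
    simp only [Finset.mul_sum]
    exact Finset.sum_congr rfl fun i _ => Finset.sum_congr rfl fun j _ => by ring
  rw [e1, e2]
  ring

end lop

section pos

variable {d : ℕ} {u v : Euc d → ℝ} {x : Euc d} {m : Matrix (Fin d) (Fin d) ℝ}
  {a : Euc d → Matrix (Fin d) (Fin d) ℝ} {b : Euc d → Euc d}

theorem trc_nonneg (hm : m.PosSemidef) {H : Euc d →L[ℝ] Euc d →L[ℝ] ℝ} (hH : ∀ s, 0 ≤ H s s) :
    0 ≤ trc m H := by
  obtain ⟨B, rfl⟩ : ∃ B : Matrix (Fin d) (Fin d) ℝ, m = B.conjTranspose * B := by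
    open scoped MatrixOrder in
    exact (CStarAlgebra.nonneg_iff_eq_star_mul_self (a := m)).1 hm.nonneg
  have key : trc (B.conjTranspose * B) H = ∑ k, H (WithLp.toLp 2 (B k)) (WithLp.toLp 2 (B k)) := by
    have e : ∀ s t : Euc d, H s t = ∑ i, ∑ j, s i * t j *
        H (EuclideanSpace.single i 1) (EuclideanSpace.single j 1) := by
      intro s t
      rw [clm_eq_sum (H s) t, Finset.sum_comm]
      refine Finset.sum_congr rfl fun j _ => ?_
      have := clm_eq_sum (H.flip (EuclideanSpace.single j 1)) s
      simp only [ContinuousLinearMap.flip_apply] at this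
      rw [this, Finset.mul_sum]
      exact Finset.sum_congr rfl fun i _ => by ring
    rw [Finset.sum_congr rfl fun k _ => e (WithLp.toLp 2 (B k)) (WithLp.toLp 2 (B k))]
    simp only [trc, Matrix.mul_apply, Matrix.conjTranspose_apply, star_trivial, Finset.sum_mul]
    rw [Finset.sum_comm (γ := Fin d)]
    refine Eq.trans (Finset.sum_congr rfl fun j _ => Finset.sum_comm) ?_
    rw [Finset.sum_comm]
    exact Finset.sum_congr rfl fun k _ => Finset.sum_comm
  rw [key]
  exact Finset.sum_nonneg fun k _ => hH _

theorem gradSq_nonneg (hm : (a x).PosSemidef) : 0 ≤ gradSq a u x :=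
  trc_nonneg hm fun s => by
    simp only [ContinuousLinearMap.smulRight_apply, smul_apply, smul_eq_mul]
    exact mul_self_nonneg _

theorem HasJet.line {p : Euc d →L[ℝ] ℝ} {H : Euc d →L[ℝ] Euc d →L[ℝ] ℝ} (h : HasJet u x p H)
    (s : Euc d) : ∃ f' : ℝ → ℝ, (∀ᶠ t in 𝓝 (0 : ℝ), HasDerivAt (fun t => u (x + t • s)) (f' t) t) ∧
      f' 0 = p s ∧ HasDerivAt f' (H s s) 0 := by
  obtain ⟨u', h1, h2, h3⟩ := h
  have hl : ∀ t : ℝ, HasDerivAt (fun t : ℝ => x + t • s) s t := fun t => by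
    simpa using ((hasDerivAt_id t).smul_const s).const_add x
  have e0 : x + (0 : ℝ) • s = x := by simp
  refine ⟨fun t => u' (x + t • s) s, ?_, by simp [h2], ?_⟩
  · have hc : Tendsto (fun t : ℝ => x + t • s) (𝓝 0) (𝓝 x) := by
      have := (hl 0).continuousAt
      rwa [ContinuousAt, e0] at this
    filter_upwards [hc.eventually h1] with t ht
    exact ht.comp_hasDerivAt t (hl t)
  · have h3' : HasFDerivAt u' H (x + (0 : ℝ) • s) := by rwa [e0]
    have := h3'.comp_hasDerivAt (0 : ℝ) (hl 0)
    simpa using this.clm_apply (hasDerivAt_const (0 : ℝ) s)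

/-- Necessary second-order condition at a local minimum on the line. -/
theorem second_deriv_nonneg {f f' : ℝ → ℝ} {c : ℝ} (hf : ∀ᶠ t in 𝓝 (0 : ℝ), HasDerivAt f (f' t) t)
    (hf' : HasDerivAt f' c 0) (hmin : IsLocalMin f 0) : 0 ≤ c := by
  by_contra hc
  push Not at hc
  have e : deriv f =ᶠ[𝓝 0] f' := by filter_upwards [hf] with t ht using ht.deriv
  have hd0 : deriv f 0 = 0 := hmin.deriv_eq_zero
  have hdd : deriv (deriv f) 0 = c := by rw [e.deriv_eq, hf'.deriv]
  have f0 : f' 0 = 0 := by rw [← e.self_of_nhds, hd0]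
  have hlmax := isLocalMax_of_deriv_deriv_neg (f := f) (by rw [hdd]; exact hc) hd0
    hf.self_of_nhds.continuousAt
  have hconst : f =ᶠ[𝓝 0] fun _ => f 0 := by
    filter_upwards [hmin, hlmax] with t h1 h2 using le_antisymm h2 h1
  have : deriv f =ᶠ[𝓝 0] fun _ => 0 := by
    filter_upwards [hconst.eventuallyEq_nhds] with t ht
    rw [ht.deriv_eq]; simp
  rw [this.deriv_eq] at hdd
  simp at hdd
  linarith

theorem HasJet.hess_nonneg {p : Euc d →L[ℝ] ℝ} {H : Euc d →L[ℝ] Euc d →L[ℝ] ℝ} (h : HasJet u x p H)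
    (hmin : IsLocalMin u x) (s : Euc d) : 0 ≤ H s s := by
  obtain ⟨f', h1, -, h3⟩ := h.line s
  refine second_deriv_nonneg h1 h3 ?_
  have hc : Tendsto (fun t : ℝ => x + t • s) (𝓝 0) (𝓝 x) := by
    have : Continuous (fun t : ℝ => x + t • s) := by fun_prop
    simpa using this.tendsto 0
  have := hc.eventually hmin
  filter_upwards [this] with t ht
  simpa using ht

theorem Lop_nonneg_of_isLocalMin (ha : (a x).PosSemidef) (hu : ContDiffAt ℝ 2 u x)
    (hmin : IsLocalMin u x) : 0 ≤ Lop a b u x := by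
  rw [hu.hasJet.Lop_eq, hmin.fderiv_eq_zero]
  simpa using trc_nonneg ha (hu.hasJet.hess_nonneg hmin)

end pos

/-- The cube of the positive part. -/
def cube (t : ℝ) : ℝ := max t 0 ^ 3

theorem hasDerivAt_max_pow (n : ℕ) (t : ℝ) :
    HasDerivAt (fun t : ℝ => max t 0 ^ (n + 2)) ((n + 2 : ℝ) * max t 0 ^ (n + 1)) t := by
  rcases lt_trichotomy t 0 with h | h | h
  · have e : (fun t : ℝ => max t 0 ^ (n + 2)) =ᶠ[𝓝 t] fun _ => 0 := by
      filter_upwards [gt_mem_nhds h] with y hy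
      rw [max_eq_right hy.le]; simp
    rw [max_eq_right h.le]
    simpa using (hasDerivAt_const t (0 : ℝ)).congr_of_eventuallyEq e
  · subst h
    have hO : (fun t : ℝ => max t 0 ^ (n + 2)) =O[𝓝 0] fun t : ℝ => ‖t - 0‖ ^ (n + 2) := by
      refine Asymptotics.IsBigO.of_bound 1 (Eventually.of_forall fun t => ?_)
      simp only [norm_pow, sub_zero, one_mul, norm_norm]
      gcongr
      rw [Real.norm_eq_abs, Real.norm_eq_abs, abs_of_nonneg (le_max_right t 0)]
      exact max_le (le_abs_self t) (abs_nonneg t)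
    have := (hO.hasFDerivAt (by omega)).hasDerivAt
    simpa using this
  · have e : (fun t : ℝ => max t 0 ^ (n + 2)) =ᶠ[𝓝 t] fun t => t ^ (n + 2) := by
      filter_upwards [lt_mem_nhds h] with y hy
      rw [max_eq_left hy.le]
    rw [max_eq_left h.le]
    have := (hasDerivAt_pow (n + 2) t).congr_of_eventuallyEq e
    simpa using this

theorem hasDerivAt_cube (t : ℝ) : HasDerivAt cube (3 * max t 0 ^ 2) t := by
  have := hasDerivAt_max_pow 1 t
  norm_num at this
  exact this

theorem hasDerivAt_cube_deriv (t : ℝ) :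
    HasDerivAt (fun t : ℝ => 3 * max t 0 ^ 2) (6 * max t 0) t := by
  have := (hasDerivAt_max_pow 0 t).const_mul 3
  norm_num at this
  refine this.congr_deriv ?_
  ring

theorem contDiff_cube : ContDiff ℝ 2 cube := by
  have e1 : deriv cube = fun t => 3 * max t 0 ^ 2 := funext fun t => (hasDerivAt_cube t).deriv
  have e2 : deriv (fun t : ℝ => 3 * max t 0 ^ 2) = fun t => 6 * max t 0 :=
    funext fun t => (hasDerivAt_cube_deriv t).deriv
  rw [show (2 : WithTop ℕ∞) = 1 + 1 by norm_num, contDiff_succ_iff_deriv]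
  refine ⟨fun t => (hasDerivAt_cube t).differentiableAt, by simp, ?_⟩
  rw [e1, contDiff_one_iff_deriv, e2]
  exact ⟨fun t => (hasDerivAt_cube_deriv t).differentiableAt, by fun_prop⟩

theorem cube_nonneg (t : ℝ) : 0 ≤ cube t := pow_nonneg (le_max_right _ _) 3

/-- A convex `C²` regularization of the positive part. -/
def spos (t : ℝ) : ℝ := 1 / 6 * (cube (t + 1) - 2 * cube t + cube (t - 1))

/-- Derivative of `spos`. -/
def sposD (t : ℝ) : ℝ :=
  1 / 6 * (3 * max (t + 1) 0 ^ 2 - 2 * (3 * max t 0 ^ 2) + 3 * max (t - 1) 0 ^ 2)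

/-- Second derivative of `spos`. -/
def sposDD (t : ℝ) : ℝ := 1 / 6 * (6 * max (t + 1) 0 - 2 * (6 * max t 0) + 6 * max (t - 1) 0)

theorem hasDerivAt_spos (t : ℝ) : HasDerivAt spos (sposD t) t := by
  have h1 : HasDerivAt (fun t => cube (t + 1)) (3 * max (t + 1) 0 ^ 2) t :=
    (hasDerivAt_cube (t + 1)).comp_add_const t 1
  have h2 : HasDerivAt (fun t => cube (t - 1)) (3 * max (t - 1) 0 ^ 2) t :=
    (hasDerivAt_cube (t - 1)).comp_sub_const t 1
  exact (((h1.sub ((hasDerivAt_cube t).const_mul 2)).add h2).const_mul (1 / 6))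

theorem hasDerivAt_sposD (t : ℝ) : HasDerivAt sposD (sposDD t) t := by
  have h1 : HasDerivAt (fun t : ℝ => 3 * max (t + 1) 0 ^ 2) (6 * max (t + 1) 0) t :=
    (hasDerivAt_cube_deriv (t + 1)).comp_add_const t 1
  have h2 : HasDerivAt (fun t : ℝ => 3 * max (t - 1) 0 ^ 2) (6 * max (t - 1) 0) t :=
    (hasDerivAt_cube_deriv (t - 1)).comp_sub_const t 1
  exact (((h1.sub ((hasDerivAt_cube_deriv t).const_mul 2)).add h2).const_mul (1 / 6))

theorem contDiff_spos : ContDiff ℝ 2 spos := by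
  have h := contDiff_cube
  have h1 : ContDiff ℝ 2 fun t => cube (t + 1) := h.comp (contDiff_id.add contDiff_const)
  have h2 : ContDiff ℝ 2 fun t => cube (t - 1) := h.comp (contDiff_id.sub contDiff_const)
  exact contDiff_const.mul ((h1.sub (contDiff_const.mul h)).add h2)

theorem spos_cases (t : ℝ) :
    (t ≤ -1 ∧ spos t = 0 ∧ sposD t = 0 ∧ sposDD t = 0) ∨
    (-1 ≤ t ∧ t ≤ 0 ∧ spos t = (t + 1) ^ 3 / 6 ∧ sposD t = (t + 1) ^ 2 / 2 ∧ sposDD t = t + 1) ∨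
    (0 ≤ t ∧ t ≤ 1 ∧ spos t = t + (1 - t) ^ 3 / 6 ∧ sposD t = 1 - (1 - t) ^ 2 / 2 ∧
      sposDD t = 1 - t) ∨
    (1 ≤ t ∧ spos t = t ∧ sposD t = 1 ∧ sposDD t = 0) := by
  unfold spos sposD sposDD cube
  rcases le_total t (-1) with h | h
  · left
    rw [max_eq_right (by linarith : t + 1 ≤ 0), max_eq_right (by linarith : t ≤ 0),
      max_eq_right (by linarith : t - 1 ≤ 0)]
    norm_num [h]
  right
  rcases le_total t 0 with h0 | h0
  · left
    rw [max_eq_left (by linarith : 0 ≤ t + 1), max_eq_right (by linarith : t ≤ 0),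
      max_eq_right (by linarith : t - 1 ≤ 0)]
    exact ⟨h, h0, by ring, by ring, by ring⟩
  right
  rcases le_total t 1 with h1 | h1
  · left
    rw [max_eq_left (by linarith : 0 ≤ t + 1), max_eq_left (by linarith : 0 ≤ t),
      max_eq_right (by linarith : t - 1 ≤ 0)]
    exact ⟨h0, h1, by ring, by ring, by ring⟩
  · right
    rw [max_eq_left (by linarith : 0 ≤ t + 1), max_eq_left (by linarith : 0 ≤ t),
      max_eq_left (by linarith : 0 ≤ t - 1)]
    exact ⟨h1, by ring, by ring, by ring⟩

theorem sposDD_nonneg (t : ℝ) : 0 ≤ sposDD t := by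
  rcases spos_cases t with h | h | h | h <;> simp only [h] <;> linarith

theorem sposD_nonneg (t : ℝ) : 0 ≤ sposD t := by
  rcases spos_cases t with h | h | h | h <;> simp only [h]
  · rfl
  · positivity
  · nlinarith
  · norm_num

theorem sposD_le_one (t : ℝ) : sposD t ≤ 1 := by
  rcases spos_cases t with h | h | h | h <;> simp only [h] <;> nlinarith

theorem le_spos (t : ℝ) : t ≤ spos t := by
  rcases spos_cases t with h | h | h | h <;> simp only [h]
  · linarith
  · have : 0 ≤ (t + 1) ^ 3 := pow_nonneg (by linarith) 3
    linarith
  · have : 0 ≤ (1 - t) ^ 3 := pow_nonneg (by linarith) 3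
    linarith
  · rfl

theorem spos_nonneg (t : ℝ) : 0 ≤ spos t := by
  rcases spos_cases t with h | h | h | h <;> simp only [h]
  · rfl
  · have : 0 ≤ (t + 1) ^ 3 := pow_nonneg (by linarith) 3
    linarith
  · have : 0 ≤ (1 - t) ^ 3 := pow_nonneg (by linarith) 3
    linarith
  · linarith

theorem spos_le (t : ℝ) : spos t ≤ max t 0 + 1 := by
  have h1 := le_max_left t 0
  have h2 := le_max_right t 0
  rcases spos_cases t with h | h | h | h <;> simp only [h]
  · linarith
  · have : (t + 1) ^ 3 ≤ 1 := pow_le_one₀ (by linarith) (by linarith)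
    linarith
  · have : (1 - t) ^ 3 ≤ 1 := pow_le_one₀ (by linarith) (by linarith)
    linarith
  · linarith

theorem spos_sub_nonneg (t : ℝ) : 0 ≤ spos t - t * sposD t := by
  rcases spos_cases t with h | h | h | h <;> simp only [h]
  · simp
  · have : 0 ≤ (t + 1) ^ 3 := pow_nonneg (by linarith) 3
    have : 0 ≤ (-t) * (t + 1) ^ 2 := mul_nonneg (by linarith) (by positivity)
    linarith
  · have : 0 ≤ (1 - t) ^ 3 := pow_nonneg (by linarith) 3
    have : 0 ≤ t * (1 - t) ^ 2 := mul_nonneg (by linarith) (by positivity)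
    linarith
  · simp

theorem spos_eq_zero {t : ℝ} (ht : t ≤ -1) : spos t = 0 := by
  rcases spos_cases t with h | h | h | h
  · exact h.2.1
  · have : t = -1 := le_antisymm ht h.1
    rw [h.2.2.1, this]; norm_num
  · linarith
  · linarith

theorem sposD_eq_zero {t : ℝ} (ht : t ≤ -1) : sposD t = 0 := by
  rcases spos_cases t with h | h | h | h
  · exact h.2.2.1
  · have : t = -1 := le_antisymm ht h.1
    rw [h.2.2.2.1, this]; norm_num
  · linarith
  · linarith

theorem spos_eq_self {t : ℝ} (ht : 1 ≤ t) : spos t = t := by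
  rcases spos_cases t with h | h | h | h
  · linarith
  · linarith
  · have : t = 1 := le_antisymm h.2.1 ht
    rw [h.2.2.1, this]; norm_num
  · exact h.2.1

section operators

variable {d : ℕ} {x : Euc d}
  {a : Euc d → Matrix (Fin d) (Fin d) ℝ} {b : Euc d → Euc d} {W : Euc d → ℝ}

/-- The operator `𝓛u + Wu`. -/
def Pop (a : Euc d → Matrix (Fin d) (Fin d) ℝ) (b : Euc d → Euc d) (W u : Euc d → ℝ)
    (x : Euc d) : ℝ := Lop a b u x + W x * u x

theorem Pop_add {u v : Euc d → ℝ} (hu : ContDiffAt ℝ 2 u x) (hv : ContDiffAt ℝ 2 v x) :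
    Pop a b W (fun y => u y + v y) x = Pop a b W u x + Pop a b W v x := by
  simp only [Pop, Lop_add hu hv]; ring

theorem Pop_sub {u v : Euc d → ℝ} (hu : ContDiffAt ℝ 2 u x) (hv : ContDiffAt ℝ 2 v x) :
    Pop a b W (fun y => u y - v y) x = Pop a b W u x - Pop a b W v x := by
  simp only [Pop, Lop_sub hu hv]; ring

theorem Pop_const_mul {u : Euc d → ℝ} (hu : ContDiffAt ℝ 2 u x) (c : ℝ) :
    Pop a b W (fun y => c * u y) x = c * Pop a b W u x := by
  simp only [Pop, Lop_const_mul hu]; ring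

theorem Pop_congr {u v : Euc d → ℝ} (h : u =ᶠ[𝓝 x] v) : Pop a b W u x = Pop a b W v x := by
  rw [Pop, Pop, Lop_congr h, h.self_of_nhds]

theorem contDiffAt_mul_spos {g s : Euc d → ℝ} (hg : ContDiffAt ℝ 2 g x) (hs : ContDiffAt ℝ 2 s x)
    (h0 : 0 < g x) : ContDiffAt ℝ 2 (fun y => g y * spos (s y / g y)) x :=
  hg.mul (contDiff_spos.contDiffAt.comp x (hs.div hg h0.ne'))

theorem Pop_mul_spos (ha : (a x).PosSemidef) {g s : Euc d → ℝ} (hg : ContDiffAt ℝ 2 g x)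
    (hs : ContDiffAt ℝ 2 s x) (h0 : 0 < g x) :
    sposD (s x / g x) * Pop a b W s x +
      (spos (s x / g x) - s x / g x * sposD (s x / g x)) * Pop a b W g x ≤
    Pop a b W (fun y => g y * spos (s y / g y)) x := by
  have key := Lop_mul_comp_div (a := a) (b := b) hg hs h0
    (Eventually.of_forall hasDerivAt_spos) (hasDerivAt_sposD _)
  have hq : 0 ≤ g x * sposDD (s x / g x) * gradSq a (fun y => s y / g y) x :=
    mul_nonneg (mul_nonneg h0.le (sposDD_nonneg _)) (gradSq_nonneg ha)
  have e : s x = g x * (s x / g x) := by field_simp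
  simp only [Pop, key]
  generalize s x / g x = r at *
  rw [e]
  linarith

/-- Smooth maximum of `s₁` and `s₂` with width `g`. -/
def smax (g s₁ s₂ : Euc d → ℝ) (y : Euc d) : ℝ := s₂ y + g y * spos ((s₁ y - s₂ y) / g y)

variable {g s₁ s₂ : Euc d → ℝ}

theorem contDiffAt_smax (hg : ContDiffAt ℝ 2 g x) (h1 : ContDiffAt ℝ 2 s₁ x)
    (h2 : ContDiffAt ℝ 2 s₂ x) (h0 : 0 < g x) : ContDiffAt ℝ 2 (smax g s₁ s₂) x :=
  h2.add (contDiffAt_mul_spos hg (h1.sub h2) h0)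

theorem Pop_smax_nonneg (ha : (a x).PosSemidef) (hg : ContDiffAt ℝ 2 g x)
    (h1 : ContDiffAt ℝ 2 s₁ x) (h2 : ContDiffAt ℝ 2 s₂ x) (h0 : 0 < g x)
    (p1 : 0 ≤ Pop a b W s₁ x) (p2 : 0 ≤ Pop a b W s₂ x) (pg : 0 ≤ Pop a b W g x) :
    0 ≤ Pop a b W (smax g s₁ s₂) x := by
  have hs : ContDiffAt ℝ 2 (fun y => s₁ y - s₂ y) x := h1.sub h2
  have e : Pop a b W (smax g s₁ s₂) x = Pop a b W s₂ x +
      Pop a b W (fun y => g y * spos ((s₁ y - s₂ y) / g y)) x :=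
    Pop_add h2 (contDiffAt_mul_spos hg hs h0)
  have key := Pop_mul_spos (b := b) (W := W) ha hg hs h0
  rw [Pop_sub h1 h2] at key
  have k1 := mul_nonneg (sposD_nonneg ((s₁ x - s₂ x) / g x)) p1
  have k2 := mul_nonneg (sub_nonneg.2 (sposD_le_one ((s₁ x - s₂ x) / g x))) p2
  have k3 := mul_nonneg (spos_sub_nonneg ((s₁ x - s₂ x) / g x)) pg
  rw [e]
  nlinarith

theorem le_smax_left (h0 : 0 < g x) : s₁ x ≤ smax g s₁ s₂ x := by
  have := mul_le_mul_of_nonneg_left (le_spos ((s₁ x - s₂ x) / g x)) h0.le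
  rw [mul_div_cancel₀ _ h0.ne'] at this
  unfold smax; linarith

theorem le_smax_right (h0 : 0 < g x) : s₂ x ≤ smax g s₁ s₂ x := by
  have := mul_nonneg h0.le (spos_nonneg ((s₁ x - s₂ x) / g x))
  unfold smax; linarith

theorem mul_spos_le {g s : ℝ} (h0 : 0 < g) : g * spos (s / g) ≤ max s 0 + g := by
  have := mul_le_mul_of_nonneg_left (spos_le (s / g)) h0.le
  have e : g * max (s / g) 0 = max s 0 := by
    rw [mul_max_of_nonneg _ _ h0.le, mul_div_cancel₀ _ h0.ne', mul_zero]
  linarith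

theorem smax_le (h0 : 0 < g x) : smax g s₁ s₂ x ≤ max (s₁ x) (s₂ x) + g x := by
  have := mul_spos_le (s := s₁ x - s₂ x) h0
  have e : max (s₁ x - s₂ x) 0 + s₂ x = max (s₁ x) (s₂ x) := by
    rw [← max_add_add_right]; simp
  unfold smax; linarith

theorem smax_eq_left (h0 : 0 < g x) (h : s₂ x + g x ≤ s₁ x) : smax g s₁ s₂ x = s₁ x := by
  have : 1 ≤ (s₁ x - s₂ x) / g x := by rw [le_div_iff₀ h0]; linarith
  rw [smax, spos_eq_self this]
  field_simp
  ring

theorem smax_eq_right (h0 : 0 < g x) (h : s₁ x ≤ s₂ x - g x) : smax g s₁ s₂ x = s₂ x := by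
  have : (s₁ x - s₂ x) / g x ≤ -1 := by rw [div_le_iff₀ h0]; linarith
  rw [smax, spos_eq_zero this]
  simp

end operators

/-- Continuous coefficients with positive definite principal part. -/
structure Elliptic {d : ℕ} (a : Euc d → Matrix (Fin d) (Fin d) ℝ) (b : Euc d → Euc d) : Prop where
  cont_a : Continuous a
  cont_b : Continuous b
  posDef : ∀ x, (a x).PosDef

section barrier

variable {d : ℕ} {a : Euc d → Matrix (Fin d) (Fin d) ℝ} {b : Euc d → Euc d} {W : Euc d → ℝ}

theorem Elliptic.posSemidef (h : Elliptic a b) (x : Euc d) : (a x).PosSemidef :=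
  (h.posDef x).posSemidef

theorem continuousAt_trc {X : Type*} [TopologicalSpace X] {x : X}
    {A : X → Matrix (Fin d) (Fin d) ℝ} {H : X → Euc d →L[ℝ] Euc d →L[ℝ] ℝ}
    (hA : ContinuousAt A x) (hH : ContinuousAt H x) :
    ContinuousAt (fun y => trc (A y) (H y)) x := by
  unfold trc
  refine tendsto_finsetSum _ fun i _ => tendsto_finsetSum _ fun j _ => ?_
  refine Tendsto.mul ?_ ?_
  · exact ((continuous_apply j).tendsto _).comp (((continuous_apply i).tendsto _).comp hA)
  · exact (hH.clm_apply continuousAt_const).clm_apply continuousAt_const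

theorem continuousAt_Lop (h : Elliptic a b) {u : Euc d → ℝ} {x : Euc d}
    (hu : ContDiffAt ℝ 2 u x) : ContinuousAt (Lop a b u) x := by
  have e : Lop a b u =ᶠ[𝓝 x] fun y => trc (a y) (fderiv ℝ (fderiv ℝ u) y) + fderiv ℝ u y (b y) := by
    filter_upwards [hu.eventually (by simp)] with y hy
    exact hy.hasJet.Lop_eq a b
  have h1 : ContDiffAt ℝ 1 (fderiv ℝ u) x := hu.fderiv_right (m := 1) (by norm_num)
  have h2 : ContDiffAt ℝ 0 (fderiv ℝ (fderiv ℝ u)) x := h1.fderiv_right (m := 0) (by norm_num)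
  refine ContinuousAt.congr ?_ e.symm
  exact (continuousAt_trc h.cont_a.continuousAt h2.continuousAt).add
    (h1.continuousAt.clm_apply h.cont_b.continuousAt)

theorem continuous_Lop (h : Elliptic a b) {u : Euc d → ℝ} (hu : ContDiff ℝ 2 u) :
    Continuous (Lop a b u) :=
  continuous_iff_continuousAt.2 fun _ => continuousAt_Lop h hu.contDiffAt

theorem hasJet_normSq (z x : Euc d) :
    HasJet (fun y => ‖y - z‖ ^ 2) x (2 • innerSL ℝ (x - z)) (2 • innerSL ℝ) := by
  refine ⟨fun y => 2 • innerSL ℝ (y - z), Eventually.of_forall fun y => ?_, rfl, ?_⟩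
  · have := ((hasFDerivAt_id y).sub_const z).norm_sq
    simpa using this
  · have := ((innerSL ℝ (E := Euc d)).hasFDerivAt (x := x - z)).comp x
      ((hasFDerivAt_id x).sub_const z)
    exact (this.const_smul 2).congr_fderiv (by ext; simp)

theorem contDiff_normSq (z : Euc d) : ContDiff ℝ 2 (fun y : Euc d => ‖y - z‖ ^ 2) :=
  (contDiff_id.sub contDiff_const).norm_sq ℝ

theorem trc_smulRight_pos {m : Matrix (Fin d) (Fin d) ℝ} (hm : m.PosDef) {v : Euc d} (hv : v ≠ 0) :
    0 < trc m ((innerSL ℝ v).smulRight (innerSL ℝ v)) := by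
  have := hm.dotProduct_mulVec_pos (x := v.ofLp) (by simpa using hv)
  rw [trc_smulRight]
  refine lt_of_lt_of_eq this (Eq.symm ?_)
  simp only [dotProduct, Matrix.mulVec, Finset.mul_sum]
  refine Finset.sum_congr rfl fun i _ => Finset.sum_congr rfl fun j _ => ?_
  simp [EuclideanSpace.inner_single_right]
  ring

theorem gradSq_normSq_pos (h : Elliptic a b) {x z : Euc d} (hx : x ≠ z) :
    0 < gradSq a (fun y => ‖y - z‖ ^ 2) x := by
  have e := (hasJet_normSq z x).hasFDerivAt.fderiv
  have e2 : gradSq a (fun y => ‖y - z‖ ^ 2) x =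
      4 * trc (a x) ((innerSL ℝ (x - z)).smulRight (innerSL ℝ (x - z))) := by
    rw [gradSq, e, ← trc_smul]
    congr 1
    ext s t
    simp
    ring
  rw [e2]
  exact mul_pos four_pos (trc_smulRight_pos (h.posDef x) (sub_ne_zero.2 hx))

theorem continuous_gradSq (h : Elliptic a b) {u : Euc d → ℝ} (hu : ContDiff ℝ 2 u) :
    Continuous (gradSq a u) := by
  have h1 : Continuous (fderiv ℝ u) := hu.continuous_fderiv (by simp)
  refine continuous_iff_continuousAt.2 fun x => continuousAt_trc h.cont_a.continuousAt ?_
  have : Continuous fun y => (fderiv ℝ u y).smulRight (fderiv ℝ u y) := by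
    have : ∀ p q : Euc d →L[ℝ] ℝ, p.smulRight q = ContinuousLinearMap.smulRightL ℝ (Euc d) _ p q :=
      fun p q => rfl
    simp only [this]
    fun_prop
  exact this.continuousAt

/-- Closed annulus. -/
def ann (z : Euc d) (s R : ℝ) : Set (Euc d) := {x | s ≤ ‖x - z‖ ∧ ‖x - z‖ ≤ R}

theorem isCompact_ann (z : Euc d) (s R : ℝ) : IsCompact (ann z s R) := by
  have : ann z s R = closedBall z R ∩ {x | s ≤ ‖x - z‖} := by
    ext x; simp [ann, dist_eq_norm, and_comm]
  rw [this]
  exact (isCompact_closedBall z R).inter_right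
    (isClosed_le continuous_const (by fun_prop))

theorem exists_bound {K : Set (Euc d)} (hK : IsCompact K) {f : Euc d → ℝ} (hf : ContinuousOn f K) :
    ∃ C > 0, ∀ x ∈ K, |f x| ≤ C := by
  obtain ⟨C, hC⟩ := hK.exists_bound_of_continuousOn hf
  exact ⟨max C 1, by positivity, fun x hx => (hC x hx).trans (le_max_left _ _)⟩

theorem exists_pos_lower_bound {K : Set (Euc d)} (hK : IsCompact K) {f : Euc d → ℝ}
    (hf : ContinuousOn f K) (h0 : ∀ x ∈ K, 0 < f x) : ∃ c > 0, ∀ x ∈ K, c ≤ f x := by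
  rcases K.eq_empty_or_nonempty with rfl | hne
  · exact ⟨1, one_pos, by simp⟩
  · obtain ⟨x, hx, hmin⟩ := hK.exists_isMinOn hne hf
    exact ⟨f x, h0 x hx, fun y hy => hmin hy⟩

/-- Gaussian centered at `z`. -/
def gauss (α : ℝ) (z y : Euc d) : ℝ := Real.exp (-α * ‖y - z‖ ^ 2)

theorem contDiff_gauss (α : ℝ) (z : Euc d) : ContDiff ℝ 2 (gauss α z) :=
  Real.contDiff_exp.comp (contDiff_const.mul (contDiff_normSq z))

theorem gauss_pos (α : ℝ) (z y : Euc d) : 0 < gauss α z y := Real.exp_pos _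

theorem gauss_le_one {α : ℝ} (hα : 0 ≤ α) (z y : Euc d) : gauss α z y ≤ 1 := by
  rw [gauss, Real.exp_le_one_iff]
  nlinarith [sq_nonneg ‖y - z‖]

theorem le_gauss {α R : ℝ} (hα : 0 ≤ α) {z y : Euc d} (h : ‖y - z‖ ≤ R) :
    Real.exp (-α * R ^ 2) ≤ gauss α z y := by
  rw [gauss, Real.exp_le_exp]
  have := pow_le_pow_left₀ (norm_nonneg _) h 2
  nlinarith

theorem gauss_le {α R : ℝ} (hα : 0 ≤ α) (hR : 0 ≤ R) {z y : Euc d} (h : R ≤ ‖y - z‖) :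
    gauss α z y ≤ Real.exp (-α * R ^ 2) := by
  rw [gauss, Real.exp_le_exp]
  have := pow_le_pow_left₀ hR h 2
  nlinarith

theorem exists_barrier (h : Elliptic a b) (z : Euc d) {s : ℝ} (hs : 0 < s) (R : ℝ) {c : ℝ}
    (hc : 0 ≤ c) : ∃ α > 0, ∃ m > 0, ∀ x ∈ ann z s R,
      m ≤ Lop a b (gauss α z) x - c * gauss α z x := by
  have hK := isCompact_ann z s R
  have hu := contDiff_normSq z
  obtain ⟨B, hB0, hB⟩ := exists_bound hK (continuous_Lop h hu).continuousOn
  obtain ⟨l, hl0, hl⟩ := exists_pos_lower_bound hK (continuous_gradSq h hu).continuousOn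
    (fun x hx => gradSq_normSq_pos h (by
      rintro rfl
      have := hx.1
      simp at this
      linarith))
  set α := max 1 ((B + c + 1) / l) with hα
  have hα1 : 1 ≤ α := le_max_left _ _
  have hα2 : B + c + 1 ≤ α * l := by
    have := le_max_right 1 ((B + c + 1) / l)
    rwa [div_le_iff₀ hl0] at this
  refine ⟨α, by linarith, Real.exp (-α * R ^ 2), Real.exp_pos _, fun x hx => ?_⟩
  have d1 : ∀ t, HasDerivAt (fun t => Real.exp (-α * t)) (-α * Real.exp (-α * t)) t := fun t => by
    have := ((hasDerivAt_id t).const_mul (-α)).exp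
    simpa [mul_comm] using this
  have d2 : ∀ t, HasDerivAt (fun t => -α * Real.exp (-α * t)) (-α * (-α * Real.exp (-α * t))) t :=
    fun t => (d1 t).const_mul (-α)
  have key : Lop a b (gauss α z) x = _ :=
    Lop_comp (a := a) (b := b) (u := fun y => ‖y - z‖ ^ 2) (f := fun t => Real.exp (-α * t))
      (hu.contDiffAt (x := x)) (Eventually.of_forall d1) (d2 _)
  have e : Real.exp (-α * ‖x - z‖ ^ 2) = gauss α z x := rfl
  rw [key, e]
  have g0 := gauss_pos α z x
  have g1 : Real.exp (-α * R ^ 2) ≤ gauss α z x := le_gauss (by linarith) hx.2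
  have h1 := hB x hx
  have h2 := hl x hx
  have h3 := (abs_le.1 h1).2
  have h4 : 1 ≤ α * (α * gradSq a (fun y => ‖y - z‖ ^ 2) x -
      Lop a b (fun y => ‖y - z‖ ^ 2) x) - c := by
    have : c + 1 ≤ α * gradSq a (fun y => ‖y - z‖ ^ 2) x - Lop a b (fun y => ‖y - z‖ ^ 2) x := by
      nlinarith
    nlinarith
  nlinarith [mul_le_mul_of_nonneg_left h4 g0.le]

theorem propagation (h : Elliptic a b) (z : Euc d) {s R' R : ℝ} (hs : 0 < s) (hR' : R' < R)
    {c : ℝ} (hc : 0 ≤ c) (hsR : s ≤ R') : ∃ θ > 0, ∃ m > 0, ∀ (w : Euc d → ℝ) (η e : ℝ),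
      (∀ x ∈ ann z s R, ContDiffAt ℝ 2 w x) → (∀ x ∈ ann z s R, 0 ≤ w x) →
      (∀ x ∈ ann z s R, Lop a b w x - c * w x ≤ e) → 0 < η → (∀ x, ‖x - z‖ = s → η ≤ w x) →
      e ≤ η * m → ∀ x ∈ ann z s R', η * θ ≤ w x := by
  obtain ⟨α, hα, m, hm, hbar⟩ := exists_barrier h z hs R hc
  have hmono : Real.exp (-α * R ^ 2) < Real.exp (-α * R' ^ 2) := by
    rw [Real.exp_lt_exp]
    nlinarith [pow_lt_pow_left₀ hR' (hs.le.trans hsR) two_ne_zero]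
  refine ⟨Real.exp (-α * R' ^ 2) - Real.exp (-α * R ^ 2), by linarith, m / 2, by linarith, ?_⟩
  intro w η e hw hw0 hLw hη hin he x hx
  set κ := Real.exp (-α * R ^ 2) with hκ
  have κ0 : 0 < κ := Real.exp_pos _
  set v : Euc d → ℝ := fun y => w y - η * (gauss α z y - κ) with hv
  have hvc : ∀ y ∈ ann z s R, ContDiffAt ℝ 2 v y := fun y hy =>
    (hw y hy).sub (contDiffAt_const.mul ((contDiff_gauss α z).contDiffAt.sub contDiffAt_const))
  have hxR : x ∈ ann z s R := ⟨hx.1, hx.2.trans hR'.le⟩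
  obtain ⟨y, hy, hmin⟩ := (isCompact_ann z s R).exists_isMinOn ⟨x, hxR⟩
    (fun y hy => (hvc y hy).continuousAt.continuousWithinAt)
  have hv0 : 0 ≤ v y := by
    by_contra hneg
    push Not at hneg
    have y1 : s < ‖y - z‖ := by
      refine lt_of_le_of_ne hy.1 fun heq => ?_
      have := hin y heq.symm
      have := gauss_le_one hα.le z y
      simp only [hv] at hneg
      nlinarith
    have y2 : ‖y - z‖ < R := by
      refine lt_of_le_of_ne hy.2 fun heq => ?_
      have h1 := hw0 y hy
      have h2 := gauss_le hα.le (by linarith : (0 : ℝ) ≤ R) heq.ge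
      simp only [hv] at hneg
      nlinarith
    have hnhds : ann z s R ∈ 𝓝 y := by
      have : IsOpen {y : Euc d | s < ‖y - z‖ ∧ ‖y - z‖ < R} :=
        have hc : Continuous fun y : Euc d => ‖y - z‖ := by fun_prop
        (isOpen_lt continuous_const hc).and (isOpen_lt hc continuous_const)
      exact mem_of_superset (this.mem_nhds ⟨y1, y2⟩) fun t ht => ⟨ht.1.le, ht.2.le⟩
    have hloc : IsLocalMin v y := hmin.isLocalMin hnhds
    have hL := Lop_nonneg_of_isLocalMin (b := b) (h.posSemidef y) (hvc y hy) hloc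
    have hg : ContDiffAt ℝ 2 (gauss α z) y := (contDiff_gauss α z).contDiffAt
    have e1 : Lop a b v y = Lop a b w y - η * Lop a b (gauss α z) y := by
      have : Lop a b v y = Lop a b w y - Lop a b (fun y => η * (gauss α z y - κ)) y :=
        Lop_sub (hw y hy) (contDiffAt_const.mul (hg.sub contDiffAt_const))
      rw [this, Lop_const_mul (hg.sub contDiffAt_const), Lop_sub hg contDiffAt_const, Lop_const]
      ring
    have h1 := hLw y hy
    have h2 := mul_le_mul_of_nonneg_left (hbar y hy) hη.le
    have h3 : 0 ≤ -(c * v y) := by nlinarith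
    have h4 : 0 ≤ η * c * κ := by positivity
    have h5 : 0 < η * m := by positivity
    simp only [hv] at h3
    nlinarith
  have := hv0.trans (hmin hxR)
  have h2 := le_gauss hα.le hx.2
  simp only [hv] at this
  nlinarith

/-- Weights on which `𝓛 + W` is uniformly positive. -/
theorem exists_weight (h : Elliptic a b) (hW : Continuous W) {r : ℝ} (hr : 0 < r) (R : ℝ) :
    ∃ g : Euc d → ℝ, ContDiff ℝ 2 g ∧ (∀ x, 0 < g x) ∧ (∀ x, g x ≤ 1) ∧
      ∃ m > 0, ∀ x, r ≤ ‖x‖ → ‖x‖ ≤ R → m ≤ Pop a b W g x := by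
  obtain ⟨c, hc, hcW⟩ := exists_bound (isCompact_ann (0 : Euc d) r R) hW.continuousOn
  obtain ⟨α, hα, m, hm, hb⟩ := exists_barrier h 0 hr R hc.le
  refine ⟨gauss α 0, contDiff_gauss α 0, gauss_pos α 0, gauss_le_one hα.le 0, m, hm,
    fun x h1 h2 => ?_⟩
  have hx : x ∈ ann (0 : Euc d) r R := by simpa [ann] using And.intro h1 h2
  have := hb x hx
  have h3 := (abs_le.1 (hcW x hx)).1
  have := gauss_pos α 0 x
  unfold Pop
  nlinarith

/-- Compactly supported `C²` subsolutions away from the origin. -/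
theorem exists_bump (h : Elliptic a b) (hW : Continuous W) {r : ℝ} (hr : 0 < r) {ρ R : ℝ}
    (hρ0 : 0 ≤ ρ) (hρR : ρ < R) :
    ∃ f : Euc d → ℝ, ContDiff ℝ 2 f ∧ (∀ x, 0 ≤ f x) ∧ (∀ x, f x ≤ 1) ∧
      (∀ x, r ≤ ‖x‖ → 0 ≤ Pop a b W f x) ∧ (∀ x, R ≤ ‖x‖ → f x = 0) ∧
      ∃ v > 0, ∀ x, ‖x‖ = ρ → f x = v := by
  obtain ⟨c, hc, hcW⟩ := exists_bound (isCompact_ann (0 : Euc d) r R) hW.continuousOn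
  obtain ⟨α, hα, m, hm, hb⟩ := exists_barrier h 0 hr R hc.le
  have hg := contDiff_gauss α (0 : Euc d)
  set κ := Real.exp (-α * R ^ 2) with hκ
  have κ0 : 0 < κ := Real.exp_pos _
  have hmono : κ < Real.exp (-α * ρ ^ 2) := by
    rw [hκ, Real.exp_lt_exp]
    nlinarith [pow_lt_pow_left₀ hρR hρ0 two_ne_zero]
  have hz : ∀ x : Euc d, R ≤ ‖x‖ → gauss α 0 x - κ ≤ 0 := fun x hx => by
    have := gauss_le hα.le (by linarith : (0 : ℝ) ≤ R) (z := (0 : Euc d)) (y := x) (by simpa)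
    linarith
  refine ⟨fun x => cube (gauss α 0 x - κ), contDiff_cube.comp (hg.sub contDiff_const),
    fun x => cube_nonneg _, fun x => ?_, fun x hx => ?_, fun x hx => ?_,
    cube (Real.exp (-α * ρ ^ 2) - κ), ?_, fun x hx => ?_⟩
  · refine pow_le_one₀ (le_max_right _ _) (max_le ?_ zero_le_one)
    linarith [gauss_le_one hα.le 0 x]
  · have key := Lop_comp (a := a) (b := b) (x := x) (hg.sub contDiff_const).contDiffAt
      (Eventually.of_forall hasDerivAt_cube) (hasDerivAt_cube_deriv (gauss α 0 x - κ))
    simp only [Pop]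
    rw [key, Lop_sub hg.contDiffAt contDiffAt_const, Lop_const, sub_zero, cube]
    have hq : 0 ≤ gradSq a (fun y => gauss α 0 y - κ) x := gradSq_nonneg (h.posSemidef x)
    rcases le_total R ‖x‖ with hR | hR
    · rw [max_eq_right (hz x hR)]
      simp
    · have hx' : x ∈ ann (0 : Euc d) r R := by simpa [ann] using And.intro hx hR
      have h1 := hb x hx'
      have h3 := (abs_le.1 (hcW x hx')).1
      have g0 := gauss_pos α 0 x
      have gκ : κ ≤ gauss α 0 x := le_gauss hα.le (by simpa using hR)
      rw [max_eq_left (by linarith)]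
      set t := gauss α 0 x - κ with ht
      have t0 : 0 ≤ t := by linarith
      have k1 : 3 * t ^ 2 * (c * t) ≤ 3 * t ^ 2 * Lop a b (gauss α 0) x := by
        refine mul_le_mul_of_nonneg_left ?_ (by positivity)
        nlinarith
      have k2 : -c * t ^ 3 ≤ W x * t ^ 3 := mul_le_mul_of_nonneg_right h3 (by positivity)
      have k3 : 0 ≤ 6 * t * gradSq a (fun y => gauss α 0 y - κ) x := by positivity
      have k4 : 0 ≤ c * t ^ 3 := by positivity
      nlinarith
  · simp only [cube]
    rw [max_eq_right (hz x hx)]; simp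
  · simp only [cube]
    rw [max_eq_left (by linarith)]
    have : 0 < Real.exp (-α * ρ ^ 2) - κ := by linarith
    positivity
  · simp [gauss, hx]

end barrier

/-- An operator `𝓛 + W₂` with a positive function `Φ` that is a supersolution near infinity for the
potential `max W₁ W₂`, and a function `Ψ₁` of minimal growth at infinity for `𝓛 + W₁`. -/
structure Comparison {d : ℕ} (a : Euc d → Matrix (Fin d) (Fin d) ℝ) (b : Euc d → Euc d)
    (W₁ W₂ Φ Ψ₁ : Euc d → ℝ) (r₀ : ℝ) : Prop where
  ell : Elliptic a b
  contW₂ : Continuous W₂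
  r₀_pos : 0 < r₀
  Φ_pos : ∀ x, 0 < Φ x
  Φ_C2 : ContDiff ℝ 2 Φ
  Φ_super : ∀ x, r₀ ≤ ‖x‖ → Lop a b Φ x + max (W₁ x) (W₂ x) * Φ x ≤ 0
  Ψ₁_pos : ∀ x, 0 < Ψ₁ x
  minGrowth : ∀ r, r₀ ≤ r → ∀ v : Euc d → ℝ, (∀ x, r < ‖x‖ → ContDiffAt ℝ 2 v x) →
    (∀ x, r < ‖x‖ → 0 < v x) → (∀ x, r < ‖x‖ → Pop a b W₁ v x ≤ 0) →
    ∃ R, ∃ κ > 0, ∀ x, R ≤ ‖x‖ → κ * Ψ₁ x ≤ v x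

section liouville

variable {d : ℕ} {a : Euc d → Matrix (Fin d) (Fin d) ℝ} {b : Euc d → Euc d}
  {W₁ W₂ Φ Ψ₁ : Euc d → ℝ} {r₀ : ℝ}

theorem Comparison.Pop_W₂_nonpos (h : Comparison a b W₁ W₂ Φ Ψ₁ r₀) {x : Euc d} (hx : r₀ ≤ ‖x‖) :
    Pop a b W₂ Φ x ≤ 0 := by
  have := h.Φ_super x hx
  have := mul_le_mul_of_nonneg_right (le_max_right (W₁ x) (W₂ x)) (h.Φ_pos x).le
  unfold Pop; linarith

theorem Comparison.Pop_W₁_nonpos (h : Comparison a b W₁ W₂ Φ Ψ₁ r₀) {x : Euc d} (hx : r₀ ≤ ‖x‖) :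
    Pop a b W₁ Φ x ≤ 0 := by
  have := h.Φ_super x hx
  have := mul_le_mul_of_nonneg_right (le_max_left (W₁ x) (W₂ x)) (h.Φ_pos x).le
  unfold Pop; linarith

theorem mem_ann_zero {s R : ℝ} {x : Euc d} : x ∈ ann (0 : Euc d) s R ↔ s ≤ ‖x‖ ∧ ‖x‖ ≤ R := by
  simp [ann]

/-- Upper bounds off a ball extend across the compact annulus. -/
theorem exists_upper_bound {f : Euc d → ℝ} {r₁ R B : ℝ}
    (hf : ∀ x, r₁ ≤ ‖x‖ → ContinuousAt f x) (hR : ∀ x, R ≤ ‖x‖ → r₁ ≤ ‖x‖ → f x ≤ B) :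
    ∃ T, ∀ x, r₁ ≤ ‖x‖ → f x ≤ T := by
  obtain ⟨A, hA0, hA⟩ := exists_bound (isCompact_ann (0 : Euc d) r₁ R) (f := f)
    (fun x hx => (hf x (mem_ann_zero.1 hx).1).continuousWithinAt)
  refine ⟨max A B, fun x hx => ?_⟩
  rcases le_total R ‖x‖ with h | h
  · exact (hR x h hx).trans (le_max_right _ _)
  · exact ((le_abs_self _).trans (hA x (mem_ann_zero.2 ⟨hx, h⟩))).trans (le_max_left _ _)

/-- A nonnegative supersolution off a ball, positive on a sphere, is positive outside the sphere. -/
theorem pos_of_pos_sphere (h : Elliptic a b) (hW : Continuous W₂) {r₁ : ℝ} (hr₁ : 0 < r₁)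
    {w : Euc d → ℝ} (hw : ∀ x, r₁ ≤ ‖x‖ → ContDiffAt ℝ 2 w x) (hw0 : ∀ x, r₁ ≤ ‖x‖ → 0 ≤ w x)
    (hP : ∀ x, r₁ ≤ ‖x‖ → Pop a b W₂ w x ≤ 0) (hs : ∀ x, ‖x‖ = r₁ → 0 < w x) {x : Euc d}
    (hx : r₁ ≤ ‖x‖) : 0 < w x := by
  obtain ⟨c, hc, hcW⟩ := exists_bound (isCompact_ann (0 : Euc d) r₁ (‖x‖ + 1)) hW.continuousOn
  obtain ⟨θ, hθ, m, hm, key⟩ := propagation h 0 hr₁ (lt_add_one ‖x‖) hc.le hx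
  obtain ⟨η, hη, hηw⟩ := exists_pos_lower_bound (isCompact_sphere (0 : Euc d) r₁) (f := w)
    (fun y hy => (hw y (by simp at hy; exact hy.ge)).continuousAt.continuousWithinAt)
    (fun y hy => hs y (by simpa using hy))
  have := key w η 0 (fun y hy => hw y (mem_ann_zero.1 hy).1)
    (fun y hy => hw0 y (mem_ann_zero.1 hy).1) (fun y hy => ?_) hη
    (fun y hy => hηw y (by simpa using hy)) (by positivity) x (mem_ann_zero.2 ⟨hx, le_rfl⟩)
  · exact lt_of_lt_of_le (by positivity) this
  · have h1 := hP y (mem_ann_zero.1 hy).1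
    have h2 := hw0 y (mem_ann_zero.1 hy).1
    have h3 := (abs_le.1 (hcW y hy)).1
    unfold Pop at h1
    nlinarith

/-- A bounded subsolution for `W₂` yields a positive supersolution for `W₁`. -/
theorem Comparison.cube_super (h : Comparison a b W₁ W₂ Φ Ψ₁ r₀) {r : ℝ} (hr : r₀ ≤ r)
    {s : Euc d → ℝ} (hs : ∀ x, r < ‖x‖ → ContDiffAt ℝ 2 s x)
    (hP : ∀ x, r < ‖x‖ → 0 ≤ Pop a b W₂ s x) (hlt : ∀ x, r < ‖x‖ → s x < Φ x) :
    (∀ x, r < ‖x‖ → ContDiffAt ℝ 2 (fun y => Φ y * (1 - cube (s y / Φ y))) x) ∧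
    (∀ x, r < ‖x‖ → 0 < Φ x * (1 - cube (s x / Φ x))) ∧
    (∀ x, r < ‖x‖ → Pop a b W₁ (fun y => Φ y * (1 - cube (s y / Φ y))) x ≤ 0) := by
  have hG0 : ∀ x, r < ‖x‖ → 0 < Φ x * (1 - cube (s x / Φ x)) := fun x hx => by
    refine mul_pos (h.Φ_pos x) (sub_pos.2 ?_)
    have : s x / Φ x < 1 := (div_lt_one (h.Φ_pos x)).2 (hlt x hx)
    exact pow_lt_one₀ (le_max_right _ _) (max_lt this one_pos) three_ne_zero
  refine ⟨fun x hx => ?_, hG0, fun x hx => ?_⟩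
  · exact h.Φ_C2.contDiffAt.mul (contDiffAt_const.sub
      (contDiff_cube.contDiffAt.comp x ((hs x hx).div h.Φ_C2.contDiffAt (h.Φ_pos x).ne')))
  · have key := Lop_mul_comp_div (a := a) (b := b) (f := fun t => 1 - cube t)
      h.Φ_C2.contDiffAt (hs x hx) (h.Φ_pos x)
      (Eventually.of_forall fun t => (hasDerivAt_cube t).const_sub 1)
      (hasDerivAt_cube_deriv (s x / Φ x)).neg
    have hq : 0 ≤ gradSq a (fun y => s y / Φ y) x := gradSq_nonneg (h.ell.posSemidef x)
    have hΦ := h.Φ_super x (hr.trans hx.le)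
    have hs' := hP x hx
    have h0 := h.Φ_pos x
    have hG := hG0 x hx
    have e : s x = Φ x * (s x / Φ x) := by field_simp
    unfold Pop at hs' ⊢
    rw [key]
    beta_reduce
    have hM1 := le_max_left (W₁ x) (W₂ x)
    have hM2 := le_max_right (W₁ x) (W₂ x)
    generalize max (W₁ x) (W₂ x) = M at *
    generalize s x / Φ x = ρ at *
    generalize gradSq a (fun y => s y / Φ y) x = Q at *
    rcases le_total ρ 0 with hρ | hρ
    · simp only [cube, max_eq_right hρ]
      norm_num
      nlinarith
    · simp only [cube, max_eq_left hρ] at hG ⊢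
      have k1 : -(3 * ρ ^ 2) * Lop a b s x ≤ 3 * ρ ^ 2 * (M * (Φ x * ρ)) := by
        have : -Lop a b s x ≤ M * (Φ x * ρ) := by
          rw [e] at hs'
          have : 0 ≤ (M - W₂ x) * (Φ x * ρ) := mul_nonneg (by linarith) (by positivity)
          linarith
        have := mul_le_mul_of_nonneg_left this (by positivity : 0 ≤ 3 * ρ ^ 2)
        linarith
      have k2 : (1 + 2 * ρ ^ 3) * Lop a b Φ x ≤ (1 + 2 * ρ ^ 3) * (-(M * Φ x)) :=
        mul_le_mul_of_nonneg_left (by linarith) (by positivity)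
      have k3 : 0 ≤ Φ x * (6 * ρ) * Q := by positivity
      have k4 : 0 ≤ (M - W₁ x) * (Φ x * (1 - ρ ^ 3)) := mul_nonneg (by linarith) hG.le
      linarith

/-- Liouville principle: a subsolution near infinity dominated by `Ψ₁` and nonpositive on an
annulus is nonpositive. -/
theorem Comparison.liouville (h : Comparison a b W₁ W₂ Φ Ψ₁ r₀) {r r₁ C : ℝ} (hr : r₀ ≤ r)
    (hr₁ : r < r₁) (hC : 0 ≤ C) {s : Euc d → ℝ} (hs : ∀ x, r < ‖x‖ → ContDiffAt ℝ 2 s x)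
    (hP : ∀ x, r < ‖x‖ → 0 ≤ Pop a b W₂ s x) (hin : ∀ x, r < ‖x‖ → ‖x‖ ≤ r₁ → s x ≤ 0)
    (hle : ∀ x, r < ‖x‖ → s x ≤ C * Ψ₁ x) : ∀ x, r < ‖x‖ → s x ≤ 0 := by
  intro x₀ hx₀
  by_contra hpos
  push Not at hpos
  have hx₁ : r₁ < ‖x₀‖ := by
    by_contra hcon
    push Not at hcon
    exact absurd (hin x₀ hx₀ hcon) (not_le.2 hpos)
  have hr0 := h.r₀_pos
  have hcont : ∀ x, r₁ ≤ ‖x‖ → ContinuousAt (fun y => s y / Φ y) x := fun x hx =>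
    (hs x (hr₁.trans_le hx)).continuousAt.div h.Φ_C2.continuous.continuousAt (h.Φ_pos x).ne'
  obtain ⟨R₂, κ, hκ, hΨΦ⟩ := h.minGrowth r hr Φ (fun x _ => h.Φ_C2.contDiffAt)
    (fun x _ => h.Φ_pos x) (fun x hx => h.Pop_W₁_nonpos (hr.trans hx.le))
  obtain ⟨T, hT⟩ := exists_upper_bound (R := R₂) (B := C / κ) hcont (fun x hx hx' => by
    rw [div_le_div_iff₀ (h.Φ_pos x) hκ]
    have h1 := hle x (hr₁.trans_le hx')
    have h2 := hΨΦ x hx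
    nlinarith [mul_le_mul_of_nonneg_left h2 hC, mul_le_mul_of_nonneg_right h1 hκ.le])
  set S : Set ℝ := (fun y => s y / Φ y) '' {x | r₁ ≤ ‖x‖} with hS
  have hbdd : BddAbove S := ⟨T, by rintro _ ⟨x, hx, rfl⟩; exact hT x hx⟩
  set t := sSup S with ht
  have ht_ge : ∀ x, r₁ ≤ ‖x‖ → s x / Φ x ≤ t := fun x hx => le_csSup hbdd ⟨x, hx, rfl⟩
  have ht0 : 0 < t := lt_of_lt_of_le (div_pos hpos (h.Φ_pos x₀)) (ht_ge x₀ hx₁.le)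
  have hle_t : ∀ x, r < ‖x‖ → s x ≤ t * Φ x := fun x hx => by
    rcases le_total ‖x‖ r₁ with h1 | h1
    · exact (hin x hx h1).trans (mul_pos ht0 (h.Φ_pos x)).le
    · exact (div_le_iff₀ (h.Φ_pos x)).1 (ht_ge x h1)
  have hlt_t : ∀ x, r < ‖x‖ → s x < t * Φ x := fun x hx => by
    rcases le_total ‖x‖ r₁ with h1 | h1
    · exact lt_of_le_of_lt (hin x hx h1) (mul_pos ht0 (h.Φ_pos x))
    · have hr' : ∀ y : Euc d, r₁ ≤ ‖y‖ → r < ‖y‖ := fun y hy => hr₁.trans_le hy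
      have hΦt : ContDiff ℝ 2 fun y => t * Φ y := contDiff_const.mul h.Φ_C2
      have := pos_of_pos_sphere h.ell h.contW₂ (r₁ := r₁) (by linarith)
        (w := fun y => t * Φ y - s y) (fun y hy => hΦt.contDiffAt.sub (hs y (hr' y hy)))
        (fun y hy => sub_nonneg.2 (hle_t y (hr' y hy)))
        (fun y hy => by
          rw [Pop_sub hΦt.contDiffAt (hs y (hr' y hy)), Pop_const_mul h.Φ_C2.contDiffAt]
          have h1 := h.Pop_W₂_nonpos (hr.trans (hr' y hy).le)
          have h2 := hP y (hr' y hy)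
          nlinarith)
        (fun y hy => by
          have h1 := hin y (hr' y hy.ge) hy.le
          have h2 := mul_pos ht0 (h.Φ_pos y)
          linarith) h1
      linarith
  set σ : Euc d → ℝ := fun y => t⁻¹ * s y with hσ
  have hσlt : ∀ x, r < ‖x‖ → σ x < Φ x := fun x hx => by
    have := hlt_t x hx
    rw [hσ]; simp only
    rwa [inv_mul_lt_iff₀ ht0]
  obtain ⟨g1, g2, g3⟩ := h.cube_super hr (s := σ) (fun x hx => contDiffAt_const.mul (hs x hx))
    (fun x hx => by
      rw [hσ, Pop_const_mul (hs x hx)]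
      exact mul_nonneg (inv_pos.2 ht0).le (hP x hx)) hσlt
  obtain ⟨R₃, κ', hκ', hG⟩ := h.minGrowth r hr _ g1 g2 g3
  obtain ⟨δ, hδ, hδ'⟩ := exists_pos_lower_bound (isCompact_ann (0 : Euc d) r₁ R₃)
    (f := fun y => t - s y / Φ y)
    (fun x hx => (continuousAt_const.sub (hcont x (mem_ann_zero.1 hx).1)).continuousWithinAt)
    (fun x hx => by
      have := hlt_t x (hr₁.trans_le (mem_ann_zero.1 hx).1)
      rwa [sub_pos, div_lt_iff₀ (h.Φ_pos x)])
  set D := 3 * (C / (t * κ')) with hD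
  have hD0 : 0 ≤ D := by positivity
  have hfar : ∀ x, r₁ ≤ ‖x‖ → R₃ ≤ ‖x‖ → s x / Φ x ≤ t * (D / (1 + D)) := fun x hx hx3 => by
    have hxr : r < ‖x‖ := hr₁.trans_le hx
    have h1 := hG x hx3
    have h2 := hle x hxr
    have h0 := h.Φ_pos x
    set ρ := σ x / Φ x with hρ
    have e1 : s x / Φ x = t * ρ := by rw [hρ, hσ]; field_simp
    have hρ1 : ρ < 1 := (div_lt_one h0).2 (hσlt x hxr)
    rw [e1]
    refine mul_le_mul_of_nonneg_left ?_ ht0.le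
    rcases le_total ρ 0 with hn | hn
    · exact hn.trans (by positivity)
    · rw [le_div_iff₀ (by positivity)]
      simp only [cube, max_eq_left hn] at h1
      have e2 : s x = t * ρ * Φ x := by rw [← e1]; field_simp
      have h3 : κ' * (t * ρ * Φ x) ≤ C * (Φ x * (1 - ρ ^ 3)) := by
        rw [e2] at h2
        calc κ' * (t * ρ * Φ x) ≤ κ' * (C * Ψ₁ x) := mul_le_mul_of_nonneg_left h2 hκ'.le
          _ = C * (κ' * Ψ₁ x) := by ring
          _ ≤ _ := mul_le_mul_of_nonneg_left h1 hC
      have h4 : κ' * t * ρ ≤ C * (1 - ρ ^ 3) := by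
        have : κ' * t * ρ * Φ x ≤ C * (1 - ρ ^ 3) * Φ x := by linarith
        exact le_of_mul_le_mul_right this h0
      have h5 : 1 - ρ ^ 3 ≤ 3 * (1 - ρ) := by
        nlinarith [mul_nonneg (sub_nonneg.2 hρ1.le) (by nlinarith : (0:ℝ) ≤ 2 - ρ - ρ ^ 2)]
      have h6 : ρ ≤ D * (1 - ρ) := by
        have h7 := h4.trans (mul_le_mul_of_nonneg_left h5 hC)
        have e3 : D * (1 - ρ) = (C * (3 * (1 - ρ))) / (κ' * t) := by rw [hD]; field_simp
        rw [e3, le_div_iff₀ (by positivity)]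
        linarith
      linarith
  have hfin : t ≤ max (t - δ) (t * (D / (1 + D))) := by
    refine csSup_le ⟨_, x₀, hx₁.le, rfl⟩ ?_
    rintro _ ⟨x, hx, rfl⟩
    rcases le_total R₃ ‖x‖ with h1 | h1
    · exact (hfar x hx h1).trans (le_max_right _ _)
    · have := hδ' x (mem_ann_zero.2 ⟨hx, h1⟩)
      refine le_trans ?_ (le_max_left _ _)
      simp only at this ⊢; linarith
  rcases le_max_iff.1 hfin with h1 | h1
  · linarith
  · have : D / (1 + D) < 1 := (div_lt_one (by positivity)).2 (by linarith)
    nlinarith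

end liouville

/-- Data for Perron's method in shells `r < ‖x‖ < R` with obstacle `Θ`. -/
structure PerronData {d : ℕ} (a : Euc d → Matrix (Fin d) (Fin d) ℝ) (b : Euc d → Euc d)
    (W Θ : Euc d → ℝ) (r : ℝ) : Prop where
  ell : Elliptic a b
  contW : Continuous W
  r_pos : 0 < r
  Θ_pos : ∀ x, 0 < Θ x
  Θ_lip : LocallyLipschitz Θ

/-- `C²` subsolutions of `𝓛 + W` below `Θ` in the shell `r < ‖x‖ < R`. -/
def subs {d : ℕ} (a : Euc d → Matrix (Fin d) (Fin d) ℝ) (b : Euc d → Euc d)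
    (W Θ : Euc d → ℝ) (r R : ℝ) : Set (Euc d → ℝ) :=
  {σ | ∀ x, r < ‖x‖ → ‖x‖ < R → ContDiffAt ℝ 2 σ x ∧ 0 ≤ Pop a b W σ x ∧ σ x ≤ Θ x}

/-- The upper envelope of `subs`. -/
def perron {d : ℕ} (a : Euc d → Matrix (Fin d) (Fin d) ℝ) (b : Euc d → Euc d)
    (W Θ : Euc d → ℝ) (r R : ℝ) (x : Euc d) : ℝ :=
  sSup ((fun σ : Euc d → ℝ => σ x) '' subs a b W Θ r R)

section perron

variable {d : ℕ} {a : Euc d → Matrix (Fin d) (Fin d) ℝ} {b : Euc d → Euc d}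
  {W Θ : Euc d → ℝ} {r R R' : ℝ} {x : Euc d}

theorem Pop_zero : Pop a b W (fun _ => 0) x = 0 := by simp [Pop, Lop_const]

theorem subs_mono (h : R ≤ R') : subs a b W Θ r R' ⊆ subs a b W Θ r R :=
  fun _ hσ x h1 h2 => hσ x h1 (h2.trans_le h)

namespace PerronData

theorem zero_mem (h : PerronData a b W Θ r) : (fun _ => 0) ∈ subs a b W Θ r R := fun x _ _ =>
  ⟨contDiffAt_const, Pop_zero.ge, (h.Θ_pos x).le⟩

theorem le_perron (_h : PerronData a b W Θ r) {σ : Euc d → ℝ}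
    (hσ : σ ∈ subs a b W Θ r R) (h1 : r < ‖x‖) (h2 : ‖x‖ < R) :
    σ x ≤ perron a b W Θ r R x :=
  le_csSup ⟨Θ x, by rintro _ ⟨τ, hτ, rfl⟩; exact (hτ x h1 h2).2.2⟩ ⟨σ, hσ, rfl⟩

theorem perron_le (h : PerronData a b W Θ r) (h1 : r < ‖x‖) (h2 : ‖x‖ < R) :
    perron a b W Θ r R x ≤ Θ x :=
  csSup_le ⟨_, _, h.zero_mem, rfl⟩ (by rintro _ ⟨τ, hτ, rfl⟩; exact (hτ x h1 h2).2.2)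

theorem perron_nonneg (h : PerronData a b W Θ r) (h1 : r < ‖x‖) (h2 : ‖x‖ < R) :
    0 ≤ perron a b W Θ r R x :=
  h.le_perron h.zero_mem h1 h2

theorem exists_subs_gt (h : PerronData a b W Θ r) {c : ℝ} (hc : c < perron a b W Θ r R x) :
    ∃ σ ∈ subs a b W Θ r R, c < σ x := by
  obtain ⟨_, ⟨σ, hσ, rfl⟩, hlt⟩ := exists_lt_of_lt_csSup
    (Set.Nonempty.image _ ⟨_, h.zero_mem⟩) hc
  exact ⟨σ, hσ, hlt⟩

theorem perron_anti (h : PerronData a b W Θ r) (h1 : r < ‖x‖) (h2 : ‖x‖ < R) (hR : R ≤ R') :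
    perron a b W Θ r R' x ≤ perron a b W Θ r R x :=
  csSup_le ⟨_, _, h.zero_mem, rfl⟩ (by
    rintro _ ⟨τ, hτ, rfl⟩; exact h.le_perron (subs_mono hR hτ) h1 h2)

theorem contΘ (h : PerronData a b W Θ r) : Continuous Θ := h.Θ_lip.continuous

/-- Subsolutions slightly above the obstacle can be scaled below it. -/
theorem exists_subs_of_le_add (h : PerronData a b W Θ r) (R : ℝ) :
    ∃ C > 0, ∀ ν > 0, ∀ m : Euc d → ℝ,
    (∀ x, r < ‖x‖ → ‖x‖ < R → ContDiffAt ℝ 2 m x ∧ 0 ≤ Pop a b W m x ∧ m x ≤ Θ x + ν) →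
    ∃ σ ∈ subs a b W Θ r R, ∀ x, r < ‖x‖ → ‖x‖ < R → m x - C * ν ≤ σ x := by
  obtain ⟨B, hB, hΘB⟩ := exists_bound (isCompact_ann (0 : Euc d) r R) h.contΘ.continuousOn
  obtain ⟨θ, hθ, hΘθ⟩ := exists_pos_lower_bound (isCompact_ann (0 : Euc d) r R)
    h.contΘ.continuousOn (fun x _ => h.Θ_pos x)
  refine ⟨B / θ + 1, by positivity, fun ν hν m hm => ?_⟩
  have hκ : 0 < θ / (θ + ν) := by positivity
  refine ⟨fun x => θ / (θ + ν) * m x, fun x h1 h2 => ?_, fun x h1 h2 => ?_⟩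
  · obtain ⟨m1, m2, m3⟩ := hm x h1 h2
    have hx : x ∈ ann (0 : Euc d) r R := mem_ann_zero.2 ⟨h1.le, h2.le⟩
    refine ⟨contDiffAt_const.mul m1, ?_, ?_⟩
    · rw [Pop_const_mul m1]; positivity
    · beta_reduce
      rw [div_mul_eq_mul_div, div_le_iff₀ (by positivity)]
      have := hΘθ x hx
      nlinarith
  · obtain ⟨m1, m2, m3⟩ := hm x h1 h2
    have hx : x ∈ ann (0 : Euc d) r R := mem_ann_zero.2 ⟨h1.le, h2.le⟩
    have hb := (abs_le.1 (hΘB x hx)).2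
    have e : θ / (θ + ν) * m x = m x - ν / (θ + ν) * m x := by field_simp; ring
    have k1 : ν / (θ + ν) * m x ≤ ν / (θ + ν) * (B + ν) :=
      mul_le_mul_of_nonneg_left (by linarith) (by positivity)
    have k2 : ν / (θ + ν) * (B + ν) ≤ (B / θ + 1) * ν := by
      rw [div_mul_eq_mul_div, div_le_iff₀ (by positivity)]
      have : (B / θ + 1) * ν * (θ + ν) - ν * (B + ν) = ν * (θ + B / θ * ν) := by
        field_simp; ring
      have : 0 ≤ ν * (θ + B / θ * ν) := by positivity
      linarith
    beta_reduce; rw [e]; linarith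

theorem exists_subs_sup (h : PerronData a b W Θ r) {σ₁ σ₂ : Euc d → ℝ} (h₁ : σ₁ ∈ subs a b W Θ r R)
    (h₂ : σ₂ ∈ subs a b W Θ r R) {μ : ℝ} (hμ : 0 < μ) : ∃ σ ∈ subs a b W Θ r R,
      ∀ x, r < ‖x‖ → ‖x‖ < R → σ₁ x - μ ≤ σ x ∧ σ₂ x - μ ≤ σ x := by
  obtain ⟨C, hC, hS⟩ := h.exists_subs_of_le_add R
  obtain ⟨g, gC, g0, g1, m, hm, hg⟩ := exists_weight h.ell h.contW h.r_pos R
  have hν : 0 < μ / C := by positivity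
  set G : Euc d → ℝ := fun y => μ / C * g y with hG
  have hG0 : ∀ x, 0 < G x := fun x => mul_pos hν (g0 x)
  have hGC : ContDiff ℝ 2 G := contDiff_const.mul gC
  obtain ⟨σ, hσ, hle⟩ := hS (μ / C) hν (smax G σ₁ σ₂) (fun x k1 k2 => by
    obtain ⟨s1, s2, s3⟩ := h₁ x k1 k2
    obtain ⟨t1, t2, t3⟩ := h₂ x k1 k2
    refine ⟨contDiffAt_smax hGC.contDiffAt s1 t1 (hG0 x),
      Pop_smax_nonneg (h.ell.posSemidef x) hGC.contDiffAt s1 t1 (hG0 x) s2 t2 ?_, ?_⟩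
    · rw [hG, Pop_const_mul gC.contDiffAt]
      exact mul_nonneg hν.le (hm.le.trans (hg x k1.le k2.le))
    · refine (smax_le (hG0 x)).trans (add_le_add (max_le s3 t3) ?_)
      exact mul_le_of_le_one_right hν.le (g1 x))
  refine ⟨σ, hσ, fun x k1 k2 => ?_⟩
  have := hle x k1 k2
  rw [mul_div_cancel₀ _ hC.ne'] at this
  exact ⟨(sub_le_sub_right (le_smax_left (hG0 x)) μ).trans this,
    (sub_le_sub_right (le_smax_right (hG0 x)) μ).trans this⟩

theorem exists_subs_gt_on (h : PerronData a b W Θ r) {S : Set (Euc d)} (hS : IsCompact S)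
    (hsub : ∀ x ∈ S, r < ‖x‖ ∧ ‖x‖ < R) {ψ : Euc d → ℝ} (hψ : ContinuousOn ψ S)
    (hlt : ∀ x ∈ S, ψ x < perron a b W Θ r R x) :
    ∃ σ ∈ subs a b W Θ r R, ∃ μ > 0, ∀ x ∈ S, ψ x + μ ≤ σ x := by
  have key : ∃ σ ∈ subs a b W Θ r R, ∃ μ > 0, ∀ x ∈ S, x ∈ S → ψ x + μ ≤ σ x := by
    refine hS.induction_on (p := fun s => ∃ σ ∈ subs a b W Θ r R, ∃ μ > 0, ∀ x ∈ s, x ∈ S →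
      ψ x + μ ≤ σ x) ⟨_, h.zero_mem, 1, one_pos, by simp⟩ ?_ ?_ ?_
    · rintro s t hst ⟨σ, hσ, μ, hμ, hh⟩
      exact ⟨σ, hσ, μ, hμ, fun x hx => hh x (hst hx)⟩
    · rintro s t ⟨σ₁, hσ₁, μ₁, hμ₁, hh₁⟩ ⟨σ₂, hσ₂, μ₂, hμ₂, hh₂⟩
      have hμ : 0 < min μ₁ μ₂ := lt_min hμ₁ hμ₂
      obtain ⟨σ, hσ, hh⟩ := h.exists_subs_sup hσ₁ hσ₂ (half_pos hμ)
      refine ⟨σ, hσ, min μ₁ μ₂ / 2, half_pos hμ, fun x hx hxS => ?_⟩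
      have k := hh x (hsub x hxS).1 (hsub x hxS).2
      have m1 := min_le_left μ₁ μ₂
      have m2 := min_le_right μ₁ μ₂
      rcases hx with hx | hx
      · linarith [hh₁ x hx hxS]
      · linarith [hh₂ x hx hxS]
    · intro x hx
      obtain ⟨σ, hσ, hlt'⟩ := h.exists_subs_gt (hlt x hx)
      have hc : ContinuousWithinAt (fun y => σ y - ψ y) S x :=
        (hσ x (hsub x hx).1 (hsub x hx).2).1.continuousAt.continuousWithinAt.sub (hψ x hx)
      have hp : (σ x - ψ x) / 2 < σ x - ψ x := by linarith
      refine ⟨_, hc.eventually (lt_mem_nhds hp), σ, hσ, (σ x - ψ x) / 2, by linarith,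
        fun y hy _ => ?_⟩
      simp only [mem_ofPred_eq] at hy
      linarith
  obtain ⟨σ, hσ, μ, hμ, hh⟩ := key
  exact ⟨σ, hσ, μ, hμ, fun x hx => hh x hx hx⟩

/-- The envelope is a viscosity supersolution where it stays below the obstacle. -/
theorem Pop_nonpos_of_touching (h : PerronData a b W Θ r) {T : Euc d → ℝ} {y₀ : Euc d}
    (h1 : r < ‖y₀‖) (h2 : ‖y₀‖ < R)
    (hT : ContDiffAt ℝ 2 T y₀) (hle : ∀ᶠ y in 𝓝 y₀, T y ≤ perron a b W Θ r R y)
    (heq : T y₀ = perron a b W Θ r R y₀) (hlt : perron a b W Θ r R y₀ < Θ y₀) :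
    Pop a b W T y₀ ≤ 0 := by
  by_contra hpos
  push Not at hpos
  have hN := contDiff_normSq (d := d) y₀
  -- subtract a small paraboloid
  obtain ⟨μ, hμ, hμP⟩ : ∃ μ > 0, 0 < Pop a b W T y₀ - μ * Pop a b W (fun y => ‖y - y₀‖ ^ 2) y₀ := by
    set Q := Pop a b W (fun y => ‖y - y₀‖ ^ 2) y₀
    refine ⟨Pop a b W T y₀ / (2 * (|Q| + 1)), by positivity, ?_⟩
    have : Pop a b W T y₀ / (2 * (|Q| + 1)) * Q ≤ Pop a b W T y₀ / 2 := by
      rw [div_mul_eq_mul_div, div_le_div_iff₀ (by positivity) (by positivity)]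
      nlinarith [le_abs_self Q]
    linarith
  set T₁ : Euc d → ℝ := fun y => T y - μ * ‖y - y₀‖ ^ 2 with hT₁
  have hT₁C : ∀ y, ContDiffAt ℝ 2 T y → ContDiffAt ℝ 2 T₁ y := fun y hy =>
    hy.sub (contDiffAt_const.mul hN.contDiffAt)
  have hT₁P : 0 < Pop a b W T₁ y₀ := by
    rw [hT₁, Pop_sub hT (contDiffAt_const.mul hN.contDiffAt), Pop_const_mul hN.contDiffAt]
    exact hμP
  have hT₁y : T₁ y₀ = T y₀ := by simp [hT₁]
  have hPc : ContinuousAt (Pop a b W T₁) y₀ :=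
    (continuousAt_Lop h.ell (hT₁C _ hT)).add (h.contW.continuousAt.mul (hT₁C _ hT).continuousAt)
  have ev : ∀ᶠ y in 𝓝 y₀, ContDiffAt ℝ 2 T y ∧ T y ≤ perron a b W Θ r R y ∧ r < ‖y‖ ∧ ‖y‖ < R ∧
      Pop a b W T₁ y₀ / 2 < Pop a b W T₁ y ∧ W y₀ - 1 < W y ∧
      T₁ y < Θ y - (Θ y₀ - T y₀) / 2 := by
    refine (hT.eventually (by simp)).and (hle.and (((continuous_norm.continuousAt.eventually
      (lt_mem_nhds h1))).and ((continuous_norm.continuousAt.eventually (gt_mem_nhds h2)).and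
      ((hPc.eventually (lt_mem_nhds (by linarith))).and ((h.contW.continuousAt.eventually
      (lt_mem_nhds (by linarith))).and ?_)))))
    have : ContinuousAt (fun y => Θ y - (Θ y₀ - T y₀) / 2 - T₁ y) y₀ :=
      (h.contΘ.continuousAt.sub continuousAt_const).sub (hT₁C _ hT).continuousAt
    filter_upwards [this.eventually (lt_mem_nhds (a := 0) (by beta_reduce; rw [hT₁y]; linarith))]
      with y hy
    linarith
  obtain ⟨s₀, hs₀, hball⟩ := Metric.eventually_nhds_iff.1 ev
  set s := s₀ / 2 with hs
  have hs0 : 0 < s := by positivity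
  have hb : ∀ y, ‖y - y₀‖ ≤ s → _ := fun y hy => hball (y := y) (by rw [dist_eq_norm]; linarith)
  set δ := μ * s ^ 2 / 16 with hδ
  have hδ0 : 0 < δ := by positivity
  obtain ⟨σ₁, hσ₁, μ', hμ', hσ₁T⟩ := h.exists_subs_gt_on (isCompact_ann y₀ (s / 2) s) (R := R)
    (ψ := fun y => T₁ y + 2 * δ) (fun y hy => ⟨(hb y hy.2).2.2.1, (hb y hy.2).2.2.2.1⟩)
    (fun y hy => ((hT₁C y (hb y hy.2).1).continuousAt.add
      continuousAt_const).continuousWithinAt)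
    (fun y hy => by
      refine lt_of_lt_of_le ?_ (hb y hy.2).2.1
      have : (s / 2) ^ 2 ≤ ‖y - y₀‖ ^ 2 := pow_le_pow_left₀ (by positivity) hy.1 2
      have : μ * (s / 2) ^ 2 ≤ μ * ‖y - y₀‖ ^ 2 := mul_le_mul_of_nonneg_left this hμ.le
      simp only [hT₁, hδ]
      nlinarith)
  set P₀ := Pop a b W T₁ y₀ with hP₀
  set γ := Θ y₀ - T y₀ with hγ
  have hγ0 : 0 < γ := by rw [hγ, heq]; linarith
  obtain ⟨ν, hν, hνδ, hνγ, hνP⟩ : ∃ ν > 0, ν ≤ δ ∧ ν ≤ γ / 2 ∧ ν * (|W y₀| + 1) ≤ P₀ / 2 := by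
    refine ⟨min δ (min (γ / 2) (P₀ / 2 / (|W y₀| + 1))), lt_min hδ0 (lt_min (by positivity)
      (by positivity)), min_le_left _ _, (min_le_right _ _).trans (min_le_left _ _), ?_⟩
    rw [← le_div_iff₀ (by positivity)]
    exact (min_le_right _ _).trans (min_le_right _ _)
  obtain ⟨C, hC, hS⟩ := h.exists_subs_of_le_add R
  obtain ⟨g, gC, g0, g1, m, hm, hg⟩ := exists_weight h.ell h.contW h.r_pos R
  obtain ⟨ν', hν', hν'δ, hν'C⟩ : ∃ ν' > 0, ν' ≤ δ ∧ C * ν' < ν := by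
    refine ⟨min δ (ν / (2 * C)), lt_min hδ0 (by positivity), min_le_left _ _, ?_⟩
    have : min δ (ν / (2 * C)) ≤ ν / (2 * C) := min_le_right _ _
    rw [le_div_iff₀ (by positivity)] at this
    linarith
  set G : Euc d → ℝ := fun y => ν' * g y with hG
  have hG0 : ∀ x, 0 < G x := fun x => mul_pos hν' (g0 x)
  have hGC : ContDiff ℝ 2 G := contDiff_const.mul gC
  have hGle : ∀ x, G x ≤ ν' := fun x => mul_le_of_le_one_right hν'.le (g1 x)
  set T₂ : Euc d → ℝ := fun y => T₁ y + ν with hT₂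
  set M : Euc d → ℝ := fun y => if ‖y - y₀‖ < s then smax G σ₁ T₂ y else σ₁ y with hM
  have hcn : Continuous fun y : Euc d => ‖y - y₀‖ := by fun_prop
  have hM1 : ∀ y, ‖y - y₀‖ < s → M =ᶠ[𝓝 y] smax G σ₁ T₂ := fun y hy => by
    filter_upwards [hcn.continuousAt.eventually (gt_mem_nhds hy)] with z hz
    simp only [hM]; rw [if_pos hz]
  have hM2 : ∀ y, s / 2 < ‖y - y₀‖ → M =ᶠ[𝓝 y] σ₁ := fun y hy => by
    filter_upwards [hcn.continuousAt.eventually (lt_mem_nhds hy)] with z hz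
    simp only [hM]
    split_ifs with hzs
    · refine smax_eq_left (hG0 z) ?_
      have k1 := hσ₁T z ⟨le_of_lt hz, hzs.le⟩
      have k2 := hGle z
      simp only [hT₂]
      linarith
    · rfl
  have hMle : ∀ x, r < ‖x‖ → ‖x‖ < R → ContDiffAt ℝ 2 M x ∧ 0 ≤ Pop a b W M x ∧
      M x ≤ Θ x + ν' := by
    intro x k1 k2
    obtain ⟨s1, s2, s3⟩ := hσ₁ x k1 k2
    rcases lt_or_ge ‖x - y₀‖ s with hx | hx
    · obtain ⟨t1, t2, t3, t4, t5, t6, t7⟩ := hb x hx.le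
      have T₂C : ContDiffAt ℝ 2 T₂ x := (hT₁C x t1).add contDiffAt_const
      have T₂P : 0 ≤ Pop a b W T₂ x := by
        rw [hT₂, Pop_add (hT₁C x t1) contDiffAt_const]
        have : Pop a b W (fun _ => ν) x = W x * ν := by simp [Pop, Lop_const]
        rw [this]
        have : -(|W y₀| + 1) ≤ W x := by linarith [neg_abs_le (W y₀)]
        nlinarith
      rw [Pop_congr (hM1 x hx), (hM1 x hx).eq_of_nhds]
      refine ⟨(contDiffAt_smax hGC.contDiffAt s1 T₂C (hG0 x)).congr_of_eventuallyEq (hM1 x hx),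
        Pop_smax_nonneg (h.ell.posSemidef x) hGC.contDiffAt s1 T₂C (hG0 x) s2 T₂P ?_, ?_⟩
      · rw [hG, Pop_const_mul gC.contDiffAt]
        exact mul_nonneg hν'.le (hm.le.trans (hg x k1.le k2.le))
      · refine (smax_le (hG0 x)).trans (add_le_add (max_le s3 ?_) (hGle x))
        simp only [hT₂]
        linarith
    · have hx' : s / 2 < ‖x - y₀‖ := by linarith
      rw [Pop_congr (hM2 x hx'), (hM2 x hx').eq_of_nhds]
      exact ⟨s1.congr_of_eventuallyEq (hM2 x hx'), s2, by linarith⟩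
  obtain ⟨σ, hσ, hσM⟩ := hS ν' hν' M hMle
  have k1 := hσM y₀ h1 h2
  have k2 := h.le_perron hσ h1 h2
  have k3 : T₂ y₀ ≤ M y₀ := by
    simp only [hM]
    rw [if_pos (by simpa using hs0)]
    exact le_smax_right (hG0 y₀)
  have k4 : T₂ y₀ = perron a b W Θ r R y₀ + ν := by rw [← heq, ← hT₁y]
  linarith

end PerronData

end perron

section quadratic

variable {d : ℕ} {a : Euc d → Matrix (Fin d) (Fin d) ℝ} {b : Euc d → Euc d}
  {m : Matrix (Fin d) (Fin d) ℝ}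

theorem quadForm_eq_dotProduct (v : Euc d) : quadForm m v = v.ofLp ⬝ᵥ m.mulVec v.ofLp := by
  simp only [quadForm, dotProduct, Matrix.mulVec, Finset.mul_sum]
  exact Finset.sum_congr rfl fun i _ => Finset.sum_congr rfl fun j _ => by ring

theorem trc_innerSL_smulRight (v : Euc d) :
    trc m ((innerSL ℝ v).smulRight (innerSL ℝ v)) = quadForm m v := by
  rw [trc_smulRight, quadForm]
  refine Finset.sum_congr rfl fun i _ => Finset.sum_congr rfl fun j _ => ?_
  simp [EuclideanSpace.inner_single_right]
  ring

theorem quadForm_smul (c : ℝ) (v : Euc d) : quadForm m (c • v) = c ^ 2 * quadForm m v := by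
  simp only [quadForm, Finset.mul_sum, PiLp.smul_apply, smul_eq_mul]
  exact Finset.sum_congr rfl fun i _ => Finset.sum_congr rfl fun j _ => by ring

theorem quadForm_sub (m n : Matrix (Fin d) (Fin d) ℝ) (v : Euc d) :
    quadForm (m - n) v = quadForm m v - quadForm n v := by
  simp only [quadForm, ← Finset.sum_sub_distrib, Matrix.sub_apply]
  exact Finset.sum_congr rfl fun i _ => Finset.sum_congr rfl fun j _ => by ring

theorem abs_quadForm_le (v : Euc d) : |quadForm m v| ≤ (∑ i, ∑ j, |m i j|) * ‖v‖ ^ 2 := by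
  rw [quadForm, Finset.sum_mul]
  refine (Finset.abs_sum_le_sum_abs _ _).trans (Finset.sum_le_sum fun i _ => ?_)
  rw [Finset.sum_mul]
  refine (Finset.abs_sum_le_sum_abs _ _).trans (Finset.sum_le_sum fun j _ => ?_)
  rw [abs_mul, abs_mul, mul_assoc, sq]
  exact mul_le_mul_of_nonneg_left (mul_le_mul (by simpa using PiLp.norm_apply_le v i)
    (by simpa using PiLp.norm_apply_le v j) (abs_nonneg _) (norm_nonneg _)) (abs_nonneg _)

theorem posSemidef_of_quadForm (hm : m.IsHermitian) (h : ∀ v, 0 ≤ quadForm m v) :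
    m.PosSemidef := by
  refine Matrix.posSemidef_iff_dotProduct_mulVec.2 ⟨hm, fun x => ?_⟩
  have := h (WithLp.toLp 2 x)
  rw [quadForm_eq_dotProduct] at this
  simpa using this

theorem exists_quadForm_ge (hm : m.PosDef) : ∃ l > 0, ∀ v, l * ‖v‖ ^ 2 ≤ quadForm m v := by
  obtain ⟨l, hl, h⟩ := exists_pos_lower_bound (isCompact_sphere (0 : Euc d) 1) (f := quadForm m)
    (by unfold quadForm; fun_prop) (fun v hv => by
      rw [← trc_innerSL_smulRight]
      exact trc_smulRight_pos hm (by rintro rfl; simp at hv))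
  refine ⟨l, hl, fun v => ?_⟩
  by_cases hv : v = 0
  · simp [hv, quadForm]
  · have hn : 0 < ‖v‖ := norm_pos_iff.2 hv
    have := h (‖v‖⁻¹ • v) (by simp [norm_smul, hn.ne'])
    rw [quadForm_smul, inv_pow, inv_mul_eq_div, le_div_iff₀ (by positivity)] at this
    exact this

/-- Uniform ellipticity and almost-monotonicity of the coefficients near a point. -/
theorem Elliptic.exists_local (h : Elliptic a b) (z : Euc d) : ∃ l > 0, ∀ δ : ℝ, 0 < δ → δ ≤ 1 →
    ∀ᶠ x in 𝓝 z, (∀ v, l * ‖v‖ ^ 2 ≤ quadForm (a x) v) ∧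
      ((1 + δ / 4) • a x - a z).PosSemidef ∧ ((1 + δ / 4) • a z - a x).PosSemidef := by
  obtain ⟨l, hl, hlz⟩ := exists_quadForm_ge (h.posDef z)
  refine ⟨l / 2, by positivity, fun δ hδ hδ1 => ?_⟩
  have hc : ContinuousAt (fun x => ∑ i, ∑ j, |(a x - a z) i j|) z := by
    have := h.cont_a
    refine Continuous.continuousAt ?_
    refine continuous_finsetSum _ fun i _ => continuous_finsetSum _ fun j _ => ?_
    simp only [Matrix.sub_apply]
    exact ((this.matrix_elem i j).sub continuous_const).abs
  have hε : 0 < δ * l / 10 := by positivity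
  filter_upwards [hc.eventually (gt_mem_nhds (show _ < δ * l / 10 by simpa using hε))] with x hx
  have key : ∀ v, |quadForm (a x) v - quadForm (a z) v| ≤ δ * l / 10 * ‖v‖ ^ 2 := fun v => by
    rw [← quadForm_sub]
    exact (abs_quadForm_le v).trans (mul_le_mul_of_nonneg_right hx.le (by positivity))
  have hs : ∀ (c : ℝ) (m : Matrix (Fin d) (Fin d) ℝ) (v : Euc d),
      quadForm (c • m) v = c * quadForm m v := fun c m v => by
    simp only [quadForm, Finset.mul_sum, Matrix.smul_apply, smul_eq_mul]
    exact Finset.sum_congr rfl fun i _ => Finset.sum_congr rfl fun j _ => by ring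
  have hsa : ∀ (c : ℝ) (y : Euc d), IsSelfAdjoint (c • a y) := fun c y =>
    (IsSelfAdjoint.all c).smul (h.posDef y).1
  have hlv : ∀ v : Euc d, 0 ≤ l * ‖v‖ ^ 2 := fun v => by positivity
  refine ⟨fun v => ?_, posSemidef_of_quadForm ((hsa _ x).sub (h.posDef z).1) fun v => ?_,
    posSemidef_of_quadForm ((hsa _ z).sub (h.posDef x).1) fun v => ?_⟩
  · have := (abs_le.1 (key v)).1
    have := hlz v
    nlinarith [hlv v]
  · have := (abs_le.1 (key v)).1
    have := hlz v
    rw [quadForm_sub, hs]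
    nlinarith [hlv v, mul_nonneg hδ.le (hlv v), mul_nonneg (sub_nonneg.2 hδ1)
      (mul_nonneg hδ.le (hlv v))]
  · have := (abs_le.1 (key v)).2
    have := hlz v
    rw [quadForm_sub, hs]
    nlinarith [hlv v, mul_nonneg hδ.le (hlv v)]

/-- An oblique reflection leaving the matrix `m` invariant. -/
theorem exists_reflection (hm : m.PosDef) {e : Euc d} (he : ‖e‖ = 1) : ∃ p : Euc d,
    inner ℝ p e = 1 ∧ ∀ H : Euc d →L[ℝ] Euc d →L[ℝ] ℝ,
      trc m ((ContinuousLinearMap.compL ℝ (Euc d) (Euc d) ℝ).flip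
        (ContinuousLinearMap.id ℝ (Euc d) - (2 : ℝ) • (innerSL ℝ p).smulRight e) |>.comp
          (H.comp (ContinuousLinearMap.id ℝ (Euc d) - (2 : ℝ) • (innerSL ℝ p).smulRight e))) =
        trc m H := by
  obtain ⟨q, hq⟩ : ∃ q : Fin d → ℝ, m.mulVec q = e.ofLp :=
    ⟨m⁻¹.mulVec e.ofLp, by
      rw [Matrix.mulVec_mulVec,
        Matrix.mul_nonsing_inv _ ((Matrix.isUnit_iff_isUnit_det _).1 hm.isUnit),
        Matrix.one_mulVec]⟩
  have hq0 : q ≠ 0 := by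
    rintro rfl
    have : e = 0 := by
      ext i; rw [← hq]; simp
    simp [this] at he
  have hκ : 0 < q ⬝ᵥ e.ofLp := by
    have := hm.dotProduct_mulVec_pos hq0
    rwa [hq, star_trivial] at this
  set κ := q ⬝ᵥ e.ofLp with hκd
  set p : Euc d := WithLp.toLp 2 (κ⁻¹ • q) with hp
  have hpe : inner ℝ p e = 1 := by
    rw [EuclideanSpace.inner_eq_star_dotProduct]
    simp only [star_trivial, hp, dotProduct_smul, smul_eq_mul]
    rw [dotProduct_comm, ← hκd, inv_mul_cancel₀ hκ.ne']
  refine ⟨p, hpe, fun H => ?_⟩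
  have hsym : ∀ i j, m i j = m j i := fun i j => by
    have := hm.1.apply i j
    simpa using this.symm
  have hmp : ∀ i, ∑ j, m i j * p j = κ⁻¹ * e i := fun i => by
    have := congrFun hq i
    simp only [Matrix.mulVec, dotProduct] at this
    rw [← this, Finset.mul_sum]
    exact Finset.sum_congr rfl fun j _ => by simp [hp]; ring
  have hmp' : ∀ j, ∑ i, m i j * p i = κ⁻¹ * e j := fun j => by
    rw [← hmp j]; exact Finset.sum_congr rfl fun i _ => by rw [hsym]
  set s : Fin d → Euc d := fun i => EuclideanSpace.single i 1 with hs
  have e1 : ∑ i, ∑ j, m i j * (p i * H e (s j)) = κ⁻¹ * H e e := by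
    rw [Finset.sum_comm, clm_eq_sum (H e) e, Finset.mul_sum]
    refine Finset.sum_congr rfl fun j _ => ?_
    rw [← mul_assoc, ← hmp' j, Finset.sum_mul]
    exact Finset.sum_congr rfl fun i _ => by ring
  have e2 : ∑ i, ∑ j, m i j * (p j * H (s i) e) = κ⁻¹ * H e e := by
    have := clm_eq_sum (H.flip e) e
    simp only [ContinuousLinearMap.flip_apply] at this
    rw [this, Finset.mul_sum]
    refine Finset.sum_congr rfl fun i _ => ?_
    rw [← mul_assoc, ← hmp i, Finset.sum_mul]
    exact Finset.sum_congr rfl fun i _ => by ring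
  have e3 : ∑ i, ∑ j, m i j * (p i * p j) = κ⁻¹ := by
    have : ∀ i, ∑ j, m i j * (p i * p j) = κ⁻¹ * (p i * e i) := fun i => by
      rw [mul_left_comm, ← hmp i, Finset.mul_sum]
      exact Finset.sum_congr rfl fun j _ => by ring
    rw [Finset.sum_congr rfl fun i _ => this i, ← Finset.mul_sum]
    have h1 : inner ℝ p e = ∑ i, p i * e i := by
      rw [PiLp.inner_apply]; exact Finset.sum_congr rfl fun i _ => by simp [mul_comm]
    rw [← h1, hpe, mul_one]
  have hA : ∀ i, (ContinuousLinearMap.id ℝ (Euc d) - (2 : ℝ) • (innerSL ℝ p).smulRight e) (s i) =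
      s i - (2 * p i) • e := fun i => by
    simp [hs, EuclideanSpace.inner_single_right, smul_smul]
  have expand : ∀ i j, m i j * ((ContinuousLinearMap.compL ℝ (Euc d) (Euc d) ℝ).flip
        (ContinuousLinearMap.id ℝ (Euc d) - (2 : ℝ) • (innerSL ℝ p).smulRight e) |>.comp
          (H.comp (ContinuousLinearMap.id ℝ (Euc d) - (2 : ℝ) • (innerSL ℝ p).smulRight e)))
          (s i) (s j) =
      m i j * H (s i) (s j) - 2 * (m i j * (p i * H e (s j))) - 2 * (m i j * (p j * H (s i) e)) +
        4 * (m i j * (p i * p j)) * H e e := fun i j => by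
    rw [ContinuousLinearMap.comp_apply, ContinuousLinearMap.flip_apply,
      ContinuousLinearMap.compL_apply, ContinuousLinearMap.comp_apply,
      ContinuousLinearMap.comp_apply, hA, hA]
    simp only [map_sub, map_smul, sub_apply, smul_apply, smul_eq_mul]
    ring
  rw [trc, Finset.sum_congr rfl fun i _ => Finset.sum_congr rfl fun j _ => expand i j]
  simp only [Finset.sum_add_distrib, Finset.sum_sub_distrib, ← Finset.mul_sum, ← Finset.sum_mul]
  rw [e1, e2, e3, trc]
  ring

end quadratic

section doubling

variable {d : ℕ} {a : Euc d → Matrix (Fin d) (Fin d) ℝ} {b : Euc d → Euc d}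
  {σ : Euc d → ℝ} {x₀ y₀ z e p : Euc d} {N K τ : ℝ} {q : Euc d →L[ℝ] ℝ}
  {H : Euc d →L[ℝ] Euc d →L[ℝ] ℝ}

theorem trc_matrix_smul (c : ℝ) (m : Matrix (Fin d) (Fin d) ℝ) : trc (c • m) H = c * trc m H := by
  simp only [trc, Finset.mul_sum, Matrix.smul_apply, smul_eq_mul]
  exact Finset.sum_congr rfl fun i _ => Finset.sum_congr rfl fun j _ => by ring

theorem trc_matrix_sub (m n : Matrix (Fin d) (Fin d) ℝ) :
    trc (m - n) H = trc m H - trc n H := by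
  simp only [trc, ← Finset.sum_sub_distrib, Matrix.sub_apply]
  exact Finset.sum_congr rfl fun i _ => Finset.sum_congr rfl fun j _ => by ring

theorem HasJet.eq_zero_of_isLocalMin {u : Euc d → ℝ} (h : HasJet u x₀ q H)
    (hmin : IsLocalMin u x₀) : q = 0 := hmin.hasFDerivAt_eq_zero h.hasFDerivAt

/-- First and second order conditions at a maximum of `σ - N |· - z|² - K √|· - y₀|`. -/
theorem HasJet.of_doubling_max (hτ : 0 < τ) (hK : 0 ≤ K) (ht : ‖x₀ - y₀‖ = τ ^ 2)
    (hσ : HasJet σ x₀ q H)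
    (hmax : ∀ᶠ x in 𝓝 x₀, σ x - N * ‖x - z‖ ^ 2 - K * √‖x - y₀‖ ≤
      σ x₀ - N * ‖x₀ - z‖ ^ 2 - K * τ) :
    q = (K / (2 * τ ^ 3)) • innerSL ℝ (x₀ - y₀) + (2 * N) • innerSL ℝ (x₀ - z) ∧
      ∀ s, H s s ≤ (K / (2 * τ ^ 3) + 2 * N) * ‖s‖ ^ 2 := by
  have jet := (((hasJet_normSq y₀ x₀).const_mul (K / (4 * τ ^ 3))).add
    ((hasJet_normSq z x₀).const_mul N)).sub hσ
  have hmin : IsLocalMin (fun y => K / (4 * τ ^ 3) * ‖y - y₀‖ ^ 2 + N * ‖y - z‖ ^ 2 - σ y) x₀ := by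
    filter_upwards [hmax] with x hx
    set v := √‖x - y₀‖ with hv
    have hv0 : 0 ≤ v := Real.sqrt_nonneg _
    have e1 : ‖x - y₀‖ = v ^ 2 := (Real.sq_sqrt (norm_nonneg _)).symm
    rw [ht, e1]
    have key : K * (v - τ) ≤ K / (4 * τ ^ 3) * ((v ^ 2) ^ 2 - (τ ^ 2) ^ 2) := by
      rw [div_mul_eq_mul_div, le_div_iff₀ (by positivity)]
      have : 0 ≤ (v - τ) ^ 2 * (v ^ 2 + 2 * v * τ + 3 * τ ^ 2) := by positivity
      nlinarith [mul_nonneg hK this]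
    linarith
  constructor
  · have h0 := jet.eq_zero_of_isLocalMin hmin
    ext s
    have := congrArg (fun l : Euc d →L[ℝ] ℝ => l s) h0
    simp only [sub_apply, add_apply, smul_apply, innerSL_apply_apply, smul_eq_mul, zero_apply,
      nsmul_eq_mul] at this ⊢
    have e2 : K / (2 * τ ^ 3) = 2 * (K / (4 * τ ^ 3)) := by field_simp; norm_num
    rw [e2]
    push_cast at this
    linarith
  · intro s
    have := jet.hess_nonneg hmin s
    simp only [sub_apply, add_apply, smul_apply, smul_eq_mul, nsmul_eq_mul] at this
    change 0 ≤ K / (4 * τ ^ 3) * ((2 : ℕ) * inner ℝ s s) + N * ((2 : ℕ) * inner ℝ s s) -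
      H s s at this
    rw [real_inner_self_eq_norm_sq] at this
    have e2 : K / (2 * τ ^ 3) = 2 * (K / (4 * τ ^ 3)) := by field_simp; norm_num
    rw [e2]
    push_cast at this
    linarith

/-- The oblique reflection `s ↦ s - 2 ⟨p, s⟩ e`. -/
def oblique (p e : Euc d) : Euc d →L[ℝ] Euc d :=
  ContinuousLinearMap.id ℝ (Euc d) - (2 : ℝ) • (innerSL ℝ p).smulRight e

theorem oblique_apply (s : Euc d) : oblique p e s = s - (2 * inner ℝ p s) • e := by
  simp [oblique, smul_smul]

/-- The test function obtained by transporting `σ` along an oblique reflection. -/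
def testFun (σ : Euc d → ℝ) (x₀ y₀ z p e : Euc d) (N K τ M : ℝ) (y : Euc d) : ℝ :=
  σ (x₀ + oblique p e (y - y₀)) - N * ‖x₀ + oblique p e (y - y₀) - z‖ ^ 2 -
    K * √(τ ^ 2 - 2 * inner ℝ p (y - y₀)) - M

theorem hasJet_affine : HasJet (fun y => τ ^ 2 - 2 * inner ℝ p (y - y₀)) y₀
    (-((2 : ℝ) • innerSL ℝ p)) 0 := by
  refine ⟨fun _ => -((2 : ℝ) • innerSL ℝ p), Eventually.of_forall fun y => ?_, rfl,
    hasFDerivAt_const _ _⟩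
  have h1 : HasFDerivAt (fun y => innerSL ℝ p (y - y₀)) (innerSL ℝ p) y := by
    have := ((innerSL ℝ p).hasFDerivAt (x := y - y₀)).comp y ((hasFDerivAt_id y).sub_const y₀)
    rwa [ContinuousLinearMap.comp_id] at this
  exact (h1.const_mul 2).const_sub (τ ^ 2)

theorem hasDerivAt_deriv_sqrt (hτ : 0 < τ) :
    HasDerivAt (fun t : ℝ => 1 / (2 * √t)) (-(1 / (4 * τ ^ 3))) (τ ^ 2) := by
  have h1 := ((Real.hasDerivAt_sqrt (x := τ ^ 2) (by positivity)).const_mul 2).inv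
    (by rw [Real.sqrt_sq hτ.le]; positivity)
  rw [Real.sqrt_sq hτ.le] at h1
  refine (h1.congr_deriv ?_).congr_of_eventuallyEq (Eventually.of_forall fun t => ?_)
  · field_simp; norm_num
  · simp

theorem contDiffAt_testFun (hτ : 0 < τ) (hσ : ContDiffAt ℝ 2 σ x₀) {M : ℝ} :
    ContDiffAt ℝ 2 (testFun σ x₀ y₀ z p e N K τ M) y₀ := by
  have haff : ContDiff ℝ 2 fun y => x₀ + oblique p e (y - y₀) :=
    contDiff_const.add ((oblique p e).contDiff.comp (contDiff_id.sub contDiff_const))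
  have h1 : ContDiffAt ℝ 2 (fun y => σ (x₀ + oblique p e (y - y₀))) y₀ := by
    refine ContDiffAt.comp y₀ (g := σ) (f := fun y => x₀ + oblique p e (y - y₀)) ?_ haff.contDiffAt
    simpa using hσ
  have h2 : ContDiffAt ℝ 2 (fun y => ‖x₀ + oblique p e (y - y₀) - z‖ ^ 2) y₀ :=
    ((contDiff_normSq z).comp haff).contDiffAt
  have h3 : ContDiffAt ℝ 2 (fun y => τ ^ 2 - 2 * inner ℝ p (y - y₀)) y₀ := by
    have : ContDiff ℝ 2 fun y => innerSL ℝ p (y - y₀) :=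
      (innerSL ℝ p).contDiff.comp (contDiff_id.sub contDiff_const)
    exact contDiffAt_const.sub (contDiffAt_const.mul this.contDiffAt)
  exact ((h1.sub (contDiffAt_const.mul h2)).sub (contDiffAt_const.mul (h3.sqrt (by
    simp only [sub_self, inner_zero_right, mul_zero, sub_zero]; positivity)))).sub contDiffAt_const

theorem Lop_testFun (hτ : 0 < τ) (hx : x₀ - y₀ = τ ^ 2 • e) (he : ‖e‖ = 1)
    (hinv : ∀ G : Euc d →L[ℝ] Euc d →L[ℝ] ℝ,
      trc (a y₀) ((ContinuousLinearMap.compL ℝ (Euc d) (Euc d) ℝ).flip (oblique p e) |>.comp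
        (G.comp (oblique p e))) = trc (a y₀) G)
    (hσ : HasJet σ x₀ q H)
    (hq : q = (K / (2 * τ ^ 3)) • innerSL ℝ (x₀ - y₀) + (2 * N) • innerSL ℝ (x₀ - z)) {M : ℝ} :
    Lop a b (testFun σ x₀ y₀ z p e N K τ M) y₀ =
      trc (a y₀) H - 2 * N * trc (a y₀) (innerSL ℝ) + K / τ ^ 3 * quadForm (a y₀) p +
        K / (2 * τ ^ 3) * inner ℝ (x₀ - y₀) (b y₀) := by
  have j1 := (hσ.sub ((hasJet_normSq z x₀).const_mul N)).compAffine (y₀ := y₀) (oblique p e)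
  have e0 : τ ^ 2 - 2 * inner ℝ p (y₀ - y₀) = τ ^ 2 := by simp
  have j2 := (hasJet_affine (τ := τ) (p := p) (y₀ := y₀)).comp (f := Real.sqrt)
    (f' := fun t => 1 / (2 * √t)) (f'' := -(1 / (4 * τ ^ 3)))
    (by
      rw [e0]
      filter_upwards [lt_mem_nhds (show 0 < τ ^ 2 by positivity)] with t ht
      exact Real.hasDerivAt_sqrt ht.ne')
    (by rw [e0]; exact hasDerivAt_deriv_sqrt hτ)
  rw [e0, Real.sqrt_sq hτ.le] at j2
  have j := ((j1.sub (j2.const_mul K)).sub (hasJet_const M)).Lop_eq a b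
  have hsm : (-((2 : ℝ) • innerSL ℝ p)).smulRight (-((2 : ℝ) • innerSL ℝ p)) =
      (4 : ℝ) • (innerSL ℝ p).smulRight (innerSL ℝ p) := by
    ext s t; simp; ring
  have hn : (2 • innerSL ℝ : Euc d →L[ℝ] Euc d →L[ℝ] ℝ) = (2 : ℝ) • innerSL ℝ := by
    ext s t; simp
  rw [trc_sub, trc_sub, hinv, trc_sub, hn, hsm] at j
  simp only [trc_smul, trc_add, trc_innerSL_smulRight] at j
  have t0 : trc (a y₀) 0 = 0 := by simp [trc]
  have t2 : trc (a y₀) ((2 : ℝ) • innerSL ℝ) = 2 * trc (a y₀) (innerSL ℝ) := trc_smul ..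
  have hee : inner ℝ e e = (1 : ℝ) := by rw [real_inner_self_eq_norm_sq, he]; norm_num
  refine j.trans ?_
  rw [t0, t2, hq, hx]
  simp only [sub_apply, add_apply, smul_apply, ContinuousLinearMap.comp_apply, oblique_apply,
    innerSL_apply_apply, smul_eq_mul, nsmul_eq_mul, zero_apply, neg_apply, inner_sub_right,
    inner_smul_right, inner_smul_left, hee, RCLike.conj_to_real]
  field_simp
  ring

end doubling

section modulus

variable {d : ℕ} {a : Euc d → Matrix (Fin d) (Fin d) ℝ} {b : Euc d → Euc d}
  {W : Euc d → ℝ} {σ : Euc d → ℝ} {x₀ y₀ z e p : Euc d} {N K τ : ℝ} {q : Euc d →L[ℝ] ℝ}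
  {H : Euc d →L[ℝ] Euc d →L[ℝ] ℝ}

theorem innerSL_self_nonneg (s : Euc d) : 0 ≤ (innerSL ℝ : Euc d →L[ℝ] Euc d →L[ℝ] ℝ) s s :=
  by simp

theorem trc_le_of_posSemidef {m₁ m₀ m₂ : Matrix (Fin d) (Fin d) ℝ} {δ : ℝ} (hδ : 0 < δ)
    (hδ1 : δ ≤ 1) (h₁ : m₁.PosSemidef) (h₁₀ : ((1 + δ / 4) • m₁ - m₀).PosSemidef)
    (h₀₂ : ((1 + δ / 4) • m₀ - m₂).PosSemidef) (hH : ∀ s, 0 ≤ H s s) :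
    trc m₂ H ≤ (1 + δ) * trc m₁ H := by
  have k1 := trc_nonneg h₁₀ hH
  have k2 := trc_nonneg h₀₂ hH
  have k3 := trc_nonneg h₁ hH
  rw [trc_matrix_sub, trc_matrix_smul] at k1 k2
  have k4 : (1 + δ / 4) * trc m₀ H ≤ (1 + δ / 4) * ((1 + δ / 4) * trc m₁ H) :=
    mul_le_mul_of_nonneg_left (by linarith) (by positivity)
  have k5 : (1 + δ / 4) * (1 + δ / 4) * trc m₁ H ≤ (1 + δ) * trc m₁ H :=
    mul_le_mul_of_nonneg_right (by nlinarith) k3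
  linarith

theorem Pop_testFun_pos {l δ tB bB WB B ρ M : ℝ} (hτ : 0 < τ) (hτ1 : τ ≤ 1) (hδ : 0 < δ)
    (hδ1 : δ ≤ 1) (hK : 0 ≤ K) (hN : 0 ≤ N) (hl : 0 < l) (hWB : 0 ≤ WB) (hB : 0 ≤ B) (hρ : 0 ≤ ρ)
    (hx : x₀ - y₀ = τ ^ 2 • e) (he : ‖e‖ = 1)
    (hinv : ∀ G : Euc d →L[ℝ] Euc d →L[ℝ] ℝ,
      trc (a y₀) ((ContinuousLinearMap.compL ℝ (Euc d) (Euc d) ℝ).flip (oblique p e) |>.comp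
        (G.comp (oblique p e))) = trc (a y₀) G)
    (hσ : HasJet σ x₀ q H)
    (hq : q = (K / (2 * τ ^ 3)) • innerSL ℝ (x₀ - y₀) + (2 * N) • innerSL ℝ (x₀ - z))
    (hH : ∀ s, H s s ≤ (K / (2 * τ ^ 3) + 2 * N) * ‖s‖ ^ 2)
    (hP : 0 ≤ Pop a b W σ x₀) (hay : (a y₀).PosSemidef)
    (hcmp : ∀ G : Euc d →L[ℝ] Euc d →L[ℝ] ℝ, (∀ s, 0 ≤ G s s) →
      trc (a y₀) G ≤ (1 + δ) * trc (a x₀) G ∧ trc (a x₀) G ≤ (1 + δ) * trc (a y₀) G)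
    (ht : trc (a x₀) (innerSL ℝ) ≤ tB) (ht' : trc (a y₀) (innerSL ℝ) ≤ tB)
    (hp : l ≤ quadForm (a y₀) p) (hb : ‖b x₀‖ ≤ bB) (hb' : ‖b y₀‖ ≤ bB)
    (hW : |W x₀| ≤ WB) (hW' : |W y₀| ≤ WB) (hσB : |σ x₀| ≤ B) (hxz : ‖x₀ - z‖ ≤ ρ)
    (hT : |testFun σ x₀ y₀ z p e N K τ M y₀| ≤ B)
    (hδl : 2 * δ * tB ≤ l / 2) (hbl : 3 * τ ^ 2 * bB ≤ l / 2)
    (hKl : 4 * N * δ * tB + 2 * (2 * N * ρ * bB + WB * B) + 2 * N * tB + WB * B < K * l / 2) :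
    0 < Pop a b W (testFun σ x₀ y₀ z p e N K τ M) y₀ := by
  set k := K / (2 * τ ^ 3) with hk
  have hkK : K / 2 ≤ k := by
    rw [hk]
    refine div_le_div_of_nonneg_left hK (by positivity) ?_
    have : τ ^ 3 ≤ 1 := pow_le_one₀ hτ.le hτ1
    linarith
  have hk0 : 0 ≤ k := by linarith
  have hI := innerSL_self_nonneg (d := d)
  set I : Euc d →L[ℝ] Euc d →L[ℝ] ℝ := innerSL ℝ with hIdef
  have hG : ∀ s, 0 ≤ ((k + 2 * N) • I - H) s s := fun s => by
    have e1 : I s s = ‖s‖ ^ 2 := real_inner_self_eq_norm_sq s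
    simp only [sub_apply, smul_apply, smul_eq_mul, e1]
    linarith [hH s]
  have c1 := (hcmp _ hG).1
  rw [trc_sub, trc_sub, trc_smul, trc_smul] at c1
  have c2 := (hcmp I hI).2
  rw [Pop, hσ.Lop_eq a b] at hP
  have hbB : 0 ≤ bB := (norm_nonneg _).trans hb
  have nx : ‖x₀ - y₀‖ = τ ^ 2 := by rw [hx, norm_smul, he]; simp
  have i1 : |inner ℝ (x₀ - y₀) (b x₀)| ≤ τ ^ 2 * bB := (abs_real_inner_le_norm _ _).trans
    (by rw [nx]; gcongr)
  have i2 : |inner ℝ (x₀ - y₀) (b y₀)| ≤ τ ^ 2 * bB := (abs_real_inner_le_norm _ _).trans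
    (by rw [nx]; gcongr)
  have i3 : |inner ℝ (x₀ - z) (b x₀)| ≤ ρ * bB := (abs_real_inner_le_norm _ _).trans
    (by gcongr)
  have w1 : W x₀ * σ x₀ ≤ WB * B := (le_abs_self _).trans (by rw [abs_mul]; gcongr)
  have w2 : -(WB * B) ≤ W y₀ * testFun σ x₀ y₀ z p e N K τ M y₀ :=
    neg_le_of_abs_le (by rw [abs_mul]; gcongr)
  have hqb : q (b x₀) ≤ k * (τ ^ 2 * bB) + 2 * N * (ρ * bB) := by
    rw [hq]
    simp only [add_apply, smul_apply, smul_eq_mul]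
    exact add_le_add (mul_le_mul_of_nonneg_left (le_of_abs_le i1) hk0)
      (mul_le_mul_of_nonneg_left (le_of_abs_le i3) (by positivity))
  rw [Pop, Lop_testFun hτ hx he hinv hσ hq]
  have ek : K / τ ^ 3 = 2 * k := by rw [hk]; field_simp
  rw [ek, ← hk, ← hIdef]
  have f1 : -(k * (τ ^ 2 * bB)) ≤ k * inner ℝ (x₀ - y₀) (b y₀) := by
    rw [← mul_neg]; exact mul_le_mul_of_nonneg_left (neg_le_of_abs_le i2) hk0
  have f2 : k * (2 * l) ≤ 2 * k * quadForm (a y₀) p := by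
    rw [mul_comm 2 k, mul_assoc]; exact mul_le_mul_of_nonneg_left (by linarith) hk0
  have t0 : 0 ≤ tB := (trc_nonneg hay hI).trans ht'
  clear i1 i2 i3 hinv hq hH hG hI hT hσ hcmp
  generalize trc (a x₀) I = Tx at *
  generalize trc (a y₀) I = Ty at *
  generalize trc (a x₀) H = Hx at *
  generalize trc (a y₀) H = Hy at *
  have s1 : -(2 * δ * tB) ≤ Ty - (1 + δ) * Tx := by
    have k1 : δ * Tx ≤ δ * tB := mul_le_mul_of_nonneg_left ht hδ.le
    have k2 : δ * Ty ≤ δ * tB := mul_le_mul_of_nonneg_left ht' hδ.le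
    linarith
  have s2 : -((k + 2 * N) * (2 * δ * tB)) ≤ (k + 2 * N) * (Ty - (1 + δ) * Tx) := by
    rw [← mul_neg]; exact mul_le_mul_of_nonneg_left s1 (by positivity)
  obtain ⟨E, hE⟩ : ∃ E, E = k * (τ ^ 2 * bB) + 2 * N * (ρ * bB) + WB * B := ⟨_, rfl⟩
  have hE0 : 0 ≤ E := by rw [hE]; positivity
  have s3 : -(2 * E) ≤ (1 + δ) * Hx := by
    have k1 : 0 ≤ (1 + δ) * (Hx + E) := mul_nonneg (by linarith) (by linarith)
    have k2 : δ * E ≤ 1 * E := mul_le_mul_of_nonneg_right hδ1 hE0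
    linarith
  have s6 : 2 * N * Ty ≤ 2 * N * tB := mul_le_mul_of_nonneg_left ht' (by positivity)
  have s7 : 0 ≤ k * (l - 2 * δ * tB - 3 * τ ^ 2 * bB) := mul_nonneg hk0 (by linarith)
  have s8 : K / 2 * l ≤ k * l := mul_le_mul_of_nonneg_right hkK hl.le
  have s9 : (k + 2 * N) * (Ty - (1 + δ) * Tx) + (1 + δ) * Hx ≤ Hy := by linarith
  linarith

end modulus

namespace PerronData

variable {d : ℕ} {a : Euc d → Matrix (Fin d) (Fin d) ℝ} {b : Euc d → Euc d}
  {W Θ : Euc d → ℝ} {r R : ℝ} {z : Euc d}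

theorem eventually_lt_perron (h : PerronData a b W Θ r) {x : Euc d} (h1 : r < ‖x‖) (h2 : ‖x‖ < R)
    {c : ℝ} (hc : c < perron a b W Θ r R x) : ∀ᶠ y in 𝓝 x, c < perron a b W Θ r R y := by
  obtain ⟨σ, hσ, hlt⟩ := h.exists_subs_gt hc
  filter_upwards [(hσ x h1 h2).1.continuousAt.eventually (lt_mem_nhds hlt),
    continuous_norm.continuousAt.eventually (lt_mem_nhds h1),
    continuous_norm.continuousAt.eventually (gt_mem_nhds h2)] with y k1 k2 k3
  exact k1.trans_le (h.le_perron hσ k2 k3)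

/-- Local bounds for the coefficients and the obstacle. -/
theorem exists_local_bounds (h : PerronData a b W Θ r) (hz : r < ‖z‖) :
    ∃ l δ tB bB WB B K₁ ρ : ℝ, 0 < l ∧ 0 < δ ∧ δ ≤ 1 ∧ 0 < tB ∧ 0 < bB ∧ 0 < WB ∧ 0 < B ∧ 0 ≤ K₁ ∧
      0 < ρ ∧ ρ < 1 ∧ 2 * δ * tB ≤ l / 2 ∧ 3 * ρ * bB ≤ l / 2 ∧
      (∀ x, ‖x - z‖ ≤ ρ → r < ‖x‖ ∧ (∀ v, l * ‖v‖ ^ 2 ≤ quadForm (a x) v) ∧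
        ((1 + δ / 4) • a x - a z).PosSemidef ∧ ((1 + δ / 4) • a z - a x).PosSemidef ∧
        trc (a x) (innerSL ℝ) ≤ tB ∧ ‖b x‖ ≤ bB ∧ |W x| ≤ WB ∧ Θ x ≤ B) ∧
      ∀ x y, ‖x - z‖ ≤ ρ → ‖y - z‖ ≤ ρ → Θ x - Θ y ≤ K₁ * ‖x - y‖ := by
  obtain ⟨l, hl, hloc⟩ := h.ell.exists_local z
  have hI := innerSL_self_nonneg (d := d)
  have htr : Continuous fun x => trc (a x) (innerSL ℝ : Euc d →L[ℝ] Euc d →L[ℝ] ℝ) := by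
    have := h.ell.cont_a
    unfold trc
    fun_prop
  set tB := trc (a z) (innerSL ℝ : Euc d →L[ℝ] Euc d →L[ℝ] ℝ) + 1 with htB
  have htB0 : 0 < tB := by have := trc_nonneg (h.ell.posSemidef z) hI; positivity
  set δ := min 1 (l / (4 * tB)) with hδ
  have hδ0 : 0 < δ := by positivity
  have hδ1 : δ ≤ 1 := min_le_left _ _
  have hδ2 : δ ≤ l / (4 * tB) := min_le_right _ _
  rw [le_div_iff₀ (by positivity)] at hδ2
  obtain ⟨K₁, t, ht, hlip⟩ := h.Θ_lip z
  have ev := (hloc δ hδ0 hδ1).and ((continuous_norm.continuousAt.eventually (lt_mem_nhds hz)).and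
    ((htr.continuousAt.eventually (gt_mem_nhds (lt_add_one _))).and
    ((h.ell.cont_b.norm.continuousAt.eventually (gt_mem_nhds (lt_add_one _))).and
    ((h.contW.abs.continuousAt.eventually (gt_mem_nhds (lt_add_one _))).and
    ((h.contΘ.continuousAt.eventually (gt_mem_nhds (lt_add_one _))).and
    (eventually_mem_set.2 ht))))))
  obtain ⟨ρ₀, hρ₀, hball⟩ := Metric.eventually_nhds_iff.1 ev
  set bB := ‖b z‖ + 1 with hbB
  have hbB0 : 0 < bB := by positivity
  set ρ := min (ρ₀ / 2) (min (1 / 2) (l / (6 * bB))) with hρ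
  have hρ0 : 0 < ρ := by positivity
  have hρ1 : ρ ≤ 1 / 2 := (min_le_right _ _).trans (min_le_left _ _)
  have hρ2 : ρ ≤ l / (6 * bB) := (min_le_right _ _).trans (min_le_right _ _)
  have hρ3 : ρ ≤ ρ₀ / 2 := min_le_left _ _
  rw [le_div_iff₀ (by positivity)] at hρ2
  have hb : ∀ x, ‖x - z‖ ≤ ρ → _ := fun x hx => hball (y := x) (by rw [dist_eq_norm]; linarith)
  refine ⟨l, δ, tB, bB, |W z| + 1, Θ z + 1, K₁, ρ, hl, hδ0, hδ1, htB0, hbB0, by positivity,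
    by linarith [h.Θ_pos z], K₁.2, hρ0, by linarith, by linarith, by linarith, fun x hx => ?_,
    fun x y hx hy => ?_⟩
  · obtain ⟨⟨k1, k2, k3⟩, k4, k5, k6, k7, k8, -⟩ := hb x hx
    exact ⟨k4, k1, k2, k3, k5.le, k6.le, k7.le, k8.le⟩
  · have := hlip.dist_le_mul x (hb x hx).2.2.2.2.2.2 y (hb y hy).2.2.2.2.2.2
    rw [Real.dist_eq, dist_eq_norm] at this
    exact (le_abs_self _).trans this

theorem exists_doubling_min (h : PerronData a b W Θ r) {σ : Euc d → ℝ}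
    (hσ : σ ∈ subs a b W Θ r R) {ρ N K : ℝ} (hρ : 0 ≤ ρ)
    (hin : ∀ x, ‖x - z‖ ≤ ρ → r < ‖x‖ ∧ ‖x‖ < R) :
    ∃ x₀ y₀ : Euc d, ‖x₀ - z‖ ≤ ρ ∧ ‖y₀ - z‖ ≤ ρ ∧ ∀ x y, ‖x - z‖ ≤ ρ → ‖y - z‖ ≤ ρ →
      σ x - perron a b W Θ r R y - K * √‖x - y‖ - N * ‖x - z‖ ^ 2 ≤
        σ x₀ - perron a b W Θ r R y₀ - K * √‖x₀ - y₀‖ - N * ‖x₀ - z‖ ^ 2 := by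
  set S : Set (Euc d × Euc d) := closedBall z ρ ×ˢ closedBall z ρ with hS
  have hmem : ∀ q : Euc d × Euc d, q ∈ S ↔ ‖q.1 - z‖ ≤ ρ ∧ ‖q.2 - z‖ ≤ ρ := fun q => by
    simp [hS, mem_prod, dist_eq_norm]
  have hc : ContinuousOn (fun q : Euc d × Euc d => -σ q.1 + K * √‖q.1 - q.2‖ + N * ‖q.1 - z‖ ^ 2)
      S := by
    have h1 : ContinuousOn (fun q : Euc d × Euc d => σ q.1) S := fun q hq => by
      have hq := hin _ ((hmem q).1 hq).1
      exact ((hσ q.1 hq.1 hq.2).1.continuousAt.comp (f := Prod.fst)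
        continuousAt_fst).continuousWithinAt
    have h2 : Continuous fun q : Euc d × Euc d => K * √‖q.1 - q.2‖ := by fun_prop
    have h3 : Continuous fun q : Euc d × Euc d => N * ‖q.1 - z‖ ^ 2 := by fun_prop
    exact (h1.neg.add h2.continuousOn).add h3.continuousOn
  have hl : LowerSemicontinuousOn (fun q : Euc d × Euc d => perron a b W Θ r R q.2) S := by
    intro q hq c hcq
    have hq := hin _ ((hmem q).1 hq).2
    exact (continuousAt_snd.eventually (h.eventually_lt_perron hq.1 hq.2 hcq)).filter_mono
      nhdsWithin_le_nhds
  obtain ⟨q₀, hq₀, hmin⟩ := (hl.add hc.lowerSemicontinuousOn).exists_isMinOn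
    ⟨(z, z), (hmem _).2 (by simpa using hρ)⟩
    ((isCompact_closedBall z ρ).prod (isCompact_closedBall z ρ))
  have k := (hmem q₀).1 hq₀
  refine ⟨q₀.1, q₀.2, k.1, k.2, fun x y hx hy => ?_⟩
  have := hmin ((hmem (x, y)).2 ⟨hx, hy⟩)
  simp only [mem_ofPred_eq] at this
  linarith

set_option maxHeartbeats 800000 in
/-- The envelopes are equicontinuous, uniformly in the outer radius. -/
theorem exists_modulus (h : PerronData a b W Θ r) (hz : r < ‖z‖) : ∃ K N ρ : ℝ, 0 ≤ K ∧ 0 ≤ N ∧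
    0 < ρ ∧ ρ < 1 ∧ (∀ x, ‖x - z‖ ≤ ρ → r < ‖x‖) ∧ ∀ R, ‖z‖ + 1 ≤ R → ∀ x y, ‖x - z‖ ≤ ρ →
      ‖y - z‖ ≤ ρ → perron a b W Θ r R x - perron a b W Θ r R y ≤
        K * √‖x - y‖ + N * ‖x - z‖ ^ 2 := by
  obtain ⟨l, δ, tB, bB, WB, B, K₁, ρ, hl, hδ, hδ1, htB, hbB, hWB, hB, hK₁, hρ, hρ1, hδl, hbl,
    hloc, hlip⟩ := h.exists_local_bounds hz
  set N := 16 * B / ρ ^ 2 with hN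
  set C := 4 * N * δ * tB + 2 * (2 * N * ρ * bB + WB * B) + 2 * N * tB + WB * B with hC
  have hN0 : 0 < N := by positivity
  have hC0 : 0 < C := by positivity
  set K := K₁ + 2 * B / ρ + 2 * C / l + 1 with hK
  have hK0 : 0 < K := by positivity
  have hKK₁ : K₁ ≤ K := by have : 0 < 2 * B / ρ + 2 * C / l + 1 := by positivity
                           linarith
  have hKB : 2 * B ≤ K * ρ := by
    have : 2 * B / ρ ≤ K := by have : 0 ≤ K₁ + 2 * C / l + 1 := by positivity
                               linarith
    rwa [div_le_iff₀ hρ] at this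
  have hKC : C < K * l / 2 := by
    have : 2 * C / l < K := by have : 0 < K₁ + 2 * B / ρ + 1 := by positivity
                               linarith
    rw [div_lt_iff₀ hl] at this
    linarith
  refine ⟨K, N, ρ, hK0.le, hN0.le, hρ, hρ1, fun x hx => (hloc x hx).1, fun R hR x y hx hy => ?_⟩
  have hin : ∀ x, ‖x - z‖ ≤ ρ → r < ‖x‖ ∧ ‖x‖ < R := fun x hx => ⟨(hloc x hx).1, by
    have : ‖x‖ ≤ ‖x - z‖ + ‖z‖ := by simpa using norm_add_le (x - z) z
    linarith⟩
  suffices key : ∀ σ ∈ subs a b W Θ r R, σ x - perron a b W Θ r R y ≤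
      K * √‖x - y‖ + N * ‖x - z‖ ^ 2 by
    by_contra hcon
    push Not at hcon
    obtain ⟨σ, hσ, hlt⟩ := h.exists_subs_gt (x := x) (R := R)
      (c := perron a b W Θ r R y + (K * √‖x - y‖ + N * ‖x - z‖ ^ 2)) (by linarith)
    linarith [key σ hσ]
  intro σ hσ
  obtain ⟨x₀, y₀, hx₀, hy₀, hmax⟩ := h.exists_doubling_min hσ (N := N) (K := K) hρ.le hin
  by_contra hcon
  push Not at hcon
  set M := σ x₀ - perron a b W Θ r R y₀ - K * √‖x₀ - y₀‖ - N * ‖x₀ - z‖ ^ 2 with hM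
  have hM0 : 0 < M := by linarith [hmax x y hx hy]
  set τ := √‖x₀ - y₀‖ with hτdef
  have hτ2 : ‖x₀ - y₀‖ = τ ^ 2 := (Real.sq_sqrt (norm_nonneg _)).symm
  obtain ⟨hσC, hσP, hσΘ⟩ := hσ x₀ (hin x₀ hx₀).1 (hin x₀ hx₀).2
  obtain ⟨lx1, lx2, lx3, lx4, lx5, lx6, lx7, lx8⟩ := hloc x₀ hx₀
  obtain ⟨ly1, ly2, ly3, ly4, ly5, ly6, ly7, ly8⟩ := hloc y₀ hy₀
  have hL0 := h.perron_nonneg (hin y₀ hy₀).1 (hin y₀ hy₀).2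
  have hLΘ := h.perron_le (hin y₀ hy₀).1 (hin y₀ hy₀).2
  have hKτ0 : 0 ≤ K * τ := by positivity
  have hNx0 : 0 ≤ N * ‖x₀ - z‖ ^ 2 := by positivity
  have hxz : ‖x₀ - z‖ < ρ / 4 := by
    have h1 : N * ‖x₀ - z‖ ^ 2 < B := by linarith
    have h2 : N * (ρ / 4) ^ 2 = B := by rw [hN]; field_simp; norm_num
    rw [← h2] at h1
    exact lt_of_pow_lt_pow_left₀ 2 (by positivity) (lt_of_mul_lt_mul_left h1 hN0.le)
  have hτρ : τ < ρ / 2 := by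
    have : K * τ < B := by linarith
    refine lt_of_mul_lt_mul_left (a := K) ?_ hK0.le
    linarith
  have hτ0 : 0 < τ := by
    rcases (Real.sqrt_nonneg ‖x₀ - y₀‖).lt_or_eq with h0 | h0
    · exact h0
    · exfalso
      have : x₀ = y₀ := by
        rw [← sub_eq_zero, ← norm_eq_zero, hτ2, hτdef, ← h0]; norm_num
      have k := h.le_perron hσ (hin x₀ hx₀).1 (hin x₀ hx₀).2
      rw [← this] at hM
      linarith
  have hτρ' : τ ^ 2 ≤ ρ / 4 := by
    have : τ * τ ≤ ρ / 2 * (1 / 2) :=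
      mul_le_mul hτρ.le (by linarith) hτ0.le (by positivity)
    rw [sq]; linarith
  have hyz : ‖y₀ - z‖ < ρ := by
    have : ‖y₀ - z‖ ≤ ‖x₀ - y₀‖ + ‖x₀ - z‖ := by
      rw [norm_sub_rev x₀ y₀]; simpa using norm_add_le (y₀ - x₀) (x₀ - z)
    rw [hτ2] at this
    linarith
  have hLlt : perron a b W Θ r R y₀ < Θ y₀ := by
    by_contra hge
    push Not at hge
    have k := hlip x₀ y₀ hx₀ hy₀
    rw [hτ2] at k
    have k2 : K₁ * τ ^ 2 ≤ K * τ := by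
      have : τ ^ 2 ≤ τ := by
        rw [sq]; exact mul_le_of_le_one_left hτ0.le (by linarith)
      exact mul_le_mul hKK₁ this (by positivity) hK0.le
    linarith
  set e : Euc d := (τ ^ 2)⁻¹ • (x₀ - y₀) with he
  have hxe : x₀ - y₀ = τ ^ 2 • e := by rw [he, smul_inv_smul₀ (by positivity)]
  have hen : ‖e‖ = 1 := by
    rw [he, norm_smul, hτ2, norm_inv, Real.norm_of_nonneg (by positivity),
      inv_mul_cancel₀ (by positivity)]
  obtain ⟨p, hpe, hinv⟩ := exists_reflection (h.ell.posDef y₀) hen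
  have hpl : l ≤ quadForm (a y₀) p := by
    have : 1 ≤ ‖p‖ := by
      have := real_inner_le_norm p e
      rwa [hpe, hen, mul_one] at this
    have h1 : l * 1 ≤ l * ‖p‖ ^ 2 := mul_le_mul_of_nonneg_left (one_le_pow₀ this) hl.le
    linarith [ly2 p]
  have jet := hσC.hasJet
  have ballx : ∀ᶠ x in 𝓝 x₀, ‖x - z‖ ≤ ρ := by
    have hcn : Continuous fun x : Euc d => ‖x - z‖ := by fun_prop
    exact (hcn.continuousAt.eventually (gt_mem_nhds (show ‖x₀ - z‖ < ρ by linarith))).mono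
      fun _ => le_of_lt
  have bally : ∀ᶠ y in 𝓝 y₀, ‖y - z‖ ≤ ρ := by
    have hcn : Continuous fun x : Euc d => ‖x - z‖ := by fun_prop
    exact (hcn.continuousAt.eventually (gt_mem_nhds hyz)).mono fun _ => le_of_lt
  obtain ⟨hq, hH⟩ := jet.of_doubling_max (z := z) (N := N) (K := K) hτ0 hK0.le hτ2 (by
    filter_upwards [ballx] with x hx
    have := hmax x y₀ hx hy₀
    linarith)
  have hTy : testFun σ x₀ y₀ z p e N K τ M y₀ = perron a b W Θ r R y₀ := by
    simp only [testFun, sub_self, map_zero, add_zero, inner_zero_right, mul_zero, sub_zero,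
      Real.sqrt_sq hτ0.le]
    linarith
  have hTle : ∀ᶠ y in 𝓝 y₀, testFun σ x₀ y₀ z p e N K τ M y ≤ perron a b W Θ r R y := by
    have c1 : Continuous fun y => x₀ + oblique p e (y - y₀) := by fun_prop
    have c2 : Continuous fun y => τ ^ 2 - 2 * inner ℝ p (y - y₀) := by fun_prop
    have t1 : Tendsto (fun y => x₀ + oblique p e (y - y₀)) (𝓝 y₀) (𝓝 x₀) := by
      simpa using c1.tendsto y₀
    have t2 : Tendsto (fun y => τ ^ 2 - 2 * inner ℝ p (y - y₀)) (𝓝 y₀) (𝓝 (τ ^ 2)) := by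
      simpa using c2.tendsto y₀
    filter_upwards [bally, t1.eventually ballx,
      t2.eventually (lt_mem_nhds (show 0 < τ ^ 2 by positivity))] with y k1 k2 k3
    have k := hmax _ y k2 k1
    have e1 : x₀ + oblique p e (y - y₀) - y = (τ ^ 2 - 2 * inner ℝ p (y - y₀)) • e := by
      rw [oblique_apply, sub_smul, ← hxe]; abel
    rw [e1, norm_smul, hen, mul_one, Real.norm_of_nonneg k3.le] at k
    simp only [testFun]
    linarith
  refine absurd (h.Pop_nonpos_of_touching (hin y₀ hy₀).1 (hin y₀ hy₀).2
    (contDiffAt_testFun hτ0 hσC) hTle hTy hLlt) (not_le.2 ?_)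
  refine Pop_testFun_pos (ρ := ρ) (B := B) (WB := WB) (l := l) (δ := δ) (tB := tB) (bB := bB)
    hτ0 (by linarith) hδ hδ1 hK0.le hN0.le hl hWB.le hB.le hρ.le hxe hen
    hinv jet hq hH hσP (h.ell.posSemidef y₀)
    (fun G hG => ⟨trc_le_of_posSemidef hδ hδ1 (h.ell.posSemidef x₀) lx3 ly4 hG,
      trc_le_of_posSemidef hδ hδ1 (h.ell.posSemidef y₀) ly3 lx4 hG⟩)
    lx5 ly5 hpl lx6 ly6 lx7 ly7 (abs_le.2 ⟨by linarith, by linarith⟩) hx₀ ?_ hδl ?_ hKC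
  · rw [hTy, abs_of_nonneg hL0]; linarith
  · refine le_trans ?_ hbl
    have : τ ^ 2 ≤ ρ := by linarith
    gcongr

end PerronData

namespace PerronData

variable {d : ℕ} {a : Euc d → Matrix (Fin d) (Fin d) ℝ} {b : Euc d → Euc d}
  {W Θ : Euc d → ℝ} {r R : ℝ} {z : Euc d}

theorem eventually_abs_perron_sub_le (h : PerronData a b W Θ r) (hz : r < ‖z‖) {ε : ℝ}
    (hε : 0 < ε) : ∀ᶠ x in 𝓝 z, ∀ R, ‖z‖ + 1 ≤ R →
      |perron a b W Θ r R x - perron a b W Θ r R z| ≤ ε := by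
  obtain ⟨K, N, ρ, hK, hN, hρ, -, -, hmod⟩ := h.exists_modulus hz
  have hc : Continuous fun x : Euc d => K * √‖x - z‖ + N * ‖x - z‖ ^ 2 := by fun_prop
  have hcn : Continuous fun x : Euc d => ‖x - z‖ := by fun_prop
  filter_upwards [hc.continuousAt.eventually (gt_mem_nhds
    (show K * √‖z - z‖ + N * ‖z - z‖ ^ 2 < ε by simpa using hε)),
    hcn.continuousAt.eventually (gt_mem_nhds (show ‖z - z‖ < ρ by simpa using hρ))]
    with x h1 h2 R hR
  have k1 := hmod R hR x z h2.le (by simpa using hρ.le)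
  have k2 := hmod R hR z x (by simpa using hρ.le) h2.le
  rw [norm_sub_rev z x] at k2
  simp only [sub_self, norm_zero] at k2
  have : 0 ≤ N * ‖x - z‖ ^ 2 := by positivity
  rw [abs_le]
  constructor <;> linarith

theorem exists_radius_perron_le (h : PerronData a b W Θ r) (hz : r < ‖z‖) {ε : ℝ} (hε : 0 < ε) :
    ∃ n₀, ‖z‖ + 1 ≤ n₀ ∧ ∀ n m, n₀ ≤ n → n₀ ≤ m →
      perron a b W Θ r m z ≤ perron a b W Θ r n z + ε := by
  set A := (fun R => perron a b W Θ r R z) '' Ici (‖z‖ + 1) with hA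
  have hne : A.Nonempty := ⟨_, ‖z‖ + 1, self_mem_Ici, rfl⟩
  have hbd : BddBelow A := ⟨0, by
    rintro _ ⟨R, hR, rfl⟩
    exact h.perron_nonneg hz (by have := mem_Ici.1 hR; linarith)⟩
  obtain ⟨_, ⟨n₀, hn₀, rfl⟩, hlt⟩ := exists_lt_of_csInf_lt hne (lt_add_of_pos_right (sInf A) hε)
  rw [mem_Ici] at hn₀
  refine ⟨n₀, hn₀, fun n m hn hm => ?_⟩
  have k1 := h.perron_anti hz (by linarith : ‖z‖ < n₀) hm
  have k2 : sInf A ≤ perron a b W Θ r n z := csInf_le hbd ⟨n, mem_Ici.2 (hn₀.trans hn), rfl⟩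
  simp only at hlt
  linarith

theorem exists_threshold (h : PerronData a b W Θ r) {S : Set (Euc d)} (hS : IsCompact S)
    (hr : ∀ x ∈ S, r < ‖x‖) {ε : ℝ} (hε : 0 < ε) : ∃ n₀ : ℝ, (∀ x ∈ S, ‖x‖ < n₀) ∧
      ∀ n, n₀ ≤ n → (∃ σ ∈ subs a b W Θ r n, ∀ x ∈ S, perron a b W Θ r n x - ε ≤ σ x) ∧
        ∀ m, n₀ ≤ m → ∀ x ∈ S, perron a b W Θ r m x ≤ perron a b W Θ r n x + ε := by
  obtain ⟨ρ, hρ⟩ := hS.isBounded.exists_norm_le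
  have key : ∃ n₀, ∀ n m, n₀ ≤ n → n₀ ≤ m → ∀ x ∈ S,
      perron a b W Θ r m x ≤ perron a b W Θ r n x + ε := by
    refine hS.induction_on (p := fun s => ∃ n₀, ∀ n m, n₀ ≤ n → n₀ ≤ m → ∀ x ∈ s,
      perron a b W Θ r m x ≤ perron a b W Θ r n x + ε) ⟨0, by simp⟩ ?_ ?_ ?_
    · rintro s t hst ⟨n₀, hh⟩
      exact ⟨n₀, fun n m hn hm x hx => hh n m hn hm x (hst hx)⟩
    · rintro s t ⟨n₁, hh₁⟩ ⟨n₂, hh₂⟩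
      refine ⟨max n₁ n₂, fun n m hn hm x hx => ?_⟩
      rw [max_le_iff] at hn hm
      rcases hx with hx | hx
      · exact hh₁ n m hn.1 hm.1 x hx
      · exact hh₂ n m hn.2 hm.2 x hx
    · intro z hz
      obtain ⟨n₀, h0, hn₀⟩ := h.exists_radius_perron_le (hr z hz) (show 0 < ε / 3 by positivity)
      refine ⟨_, nhdsWithin_le_nhds (h.eventually_abs_perron_sub_le (hr z hz)
        (show 0 < ε / 3 by positivity)), n₀, fun n m hn hm x hx => ?_⟩
      rw [mem_ofPred_eq] at hx
      have k1 := abs_le.1 (hx m (h0.trans hm))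
      have k2 := abs_le.1 (hx n (h0.trans hn))
      linarith [hn₀ n m hn hm]
  obtain ⟨n₁, hn₁⟩ := key
  refine ⟨max n₁ (ρ + 1), fun x hx => ?_, fun n hn => ?_⟩
  · exact lt_of_lt_of_le (by linarith [hρ x hx]) (le_max_right _ _)
  rw [max_le_iff] at hn
  refine ⟨?_, fun m hm x hx => hn₁ n m hn.1 ((le_max_left _ _).trans hm) x hx⟩
  have hc : ContinuousOn (perron a b W Θ r n) S := fun x hx => by
    refine ContinuousAt.continuousWithinAt (Metric.continuousAt_iff'.2 fun η hη => ?_)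
    filter_upwards [h.eventually_abs_perron_sub_le (hr x hx) (half_pos hη)] with y hy
    rw [Real.dist_eq]
    exact (hy n (by linarith [hρ x hx])).trans_lt (half_lt_self hη)
  obtain ⟨σ, hσ, μ, hμ, hle⟩ := h.exists_subs_gt_on hS (R := n)
    (fun x hx => ⟨hr x hx, by linarith [hρ x hx]⟩) (ψ := fun x => perron a b W Θ r n x - ε)
    (hc.sub continuousOn_const) (fun x _ => by linarith)
  exact ⟨σ, hσ, fun x hx => by linarith [hle x hx]⟩

end PerronData

section gluing

variable {d : ℕ} {a : Euc d → Matrix (Fin d) (Fin d) ℝ} {b : Euc d → Euc d}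
  {W Θ : Euc d → ℝ} {r R₀ : ℝ}

/-- The function equal to `m k` in the shell `R₀ + k ≤ ‖x‖ < R₀ + k + 1`. -/
def shellGlue (R₀ : ℝ) (m : ℕ → Euc d → ℝ) (x : Euc d) : ℝ := m ⌊‖x‖ - R₀⌋₊ x

theorem floor_shell {t : ℝ} {k : ℕ} (h1 : k = 0 ∨ R₀ + k ≤ t) (h2 : t < R₀ + k + 1) :
    ⌊t - R₀⌋₊ = k := by
  rcases Nat.eq_zero_or_pos k with rfl | hk
  · rw [Nat.floor_eq_zero]; push_cast at h2; linarith
  · rw [Nat.floor_eq_iff' hk.ne']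
    have := h1.resolve_left hk.ne'
    constructor <;> linarith

theorem shellGlue_eventuallyEq {m : ℕ → Euc d → ℝ} {x : Euc d} {k : ℕ}
    (h1 : k = 0 ∨ R₀ + k < ‖x‖) (h2 : ‖x‖ < R₀ + k + 1) : shellGlue R₀ m =ᶠ[𝓝 x] m k := by
  have h1' : ∀ᶠ y in 𝓝 x, k = 0 ∨ R₀ + k ≤ ‖y‖ := by
    rcases h1 with h | h
    · exact Eventually.of_forall fun _ => Or.inl h
    · filter_upwards [continuous_norm.continuousAt.eventually (lt_mem_nhds h)] with y hy
      exact Or.inr hy.le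
  filter_upwards [h1', continuous_norm.continuousAt.eventually (gt_mem_nhds h2)] with y k1 k2
  rw [shellGlue, floor_shell k1 k2]

theorem shellGlue_eventuallyEq_sphere {m : ℕ → Euc d → ℝ} {f : Euc d → ℝ} {x : Euc d} {k : ℕ}
    (hx : ‖x‖ = R₀ + k + 1) (h1 : m k =ᶠ[𝓝 x] f) (h2 : m (k + 1) =ᶠ[𝓝 x] f) :
    shellGlue R₀ m =ᶠ[𝓝 x] f := by
  filter_upwards [h1, h2,
    continuous_norm.continuousAt.eventually (lt_mem_nhds (show R₀ + k < ‖x‖ by linarith)),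
    continuous_norm.continuousAt.eventually (gt_mem_nhds (show ‖x‖ < R₀ + k + 2 by linarith))]
    with y k1 k2 k3 k4
  rcases lt_or_ge ‖y‖ (R₀ + k + 1) with hy | hy
  · rw [shellGlue, floor_shell (Or.inr k3.le) hy, k1]
  · rw [shellGlue, floor_shell (k := k + 1) (Or.inr (by push_cast; linarith))
      (by push_cast; linarith), k2]

theorem exists_shell (x : Euc d) (R₀ : ℝ) : ∃ k : ℕ, ‖x‖ < R₀ + k + 1 ∧
    ⌊‖x‖ - R₀⌋₊ = k ∧
    ((k = 0 ∨ R₀ + k < ‖x‖) ∨ ∃ j : ℕ, k = j + 1 ∧ ‖x‖ = R₀ + j + 1) := by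
  refine ⟨⌊‖x‖ - R₀⌋₊, by linarith [Nat.lt_floor_add_one (‖x‖ - R₀)], rfl, ?_⟩
  rcases Nat.eq_zero_or_eq_succ_pred ⌊‖x‖ - R₀⌋₊ with h | h
  · exact Or.inl (Or.inl h)
  · rcases lt_or_ge (R₀ + ⌊‖x‖ - R₀⌋₊) ‖x‖ with h' | h'
    · exact Or.inl (Or.inr h')
    · refine Or.inr ⟨_, h, ?_⟩
      have h0 : 0 ≤ ‖x‖ - R₀ := by
        by_contra hn
        rw [Nat.floor_of_nonpos (by linarith)] at h
        exact absurd h (by simp)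
      have h1 := Nat.floor_le h0
      have h2 : (⌊‖x‖ - R₀⌋₊ : ℝ) = (⌊‖x‖ - R₀⌋₊.pred : ℕ) + 1 := by exact_mod_cast h
      linarith

namespace PerronData

theorem exists_layers (h : PerronData a b W Θ r) (hR₀ : r < R₀) {S : Set (Euc d)}
    (hS : IsCompact S) (hr : ∀ x ∈ S, r < ‖x‖) {ω : ℕ → ℝ} (hω : ∀ k, 0 < ω k) :
    ∃ f : ℕ → Euc d → ℝ, ∃ δ : ℕ → ℝ, ∃ n₀ : ℝ, (∀ k, 0 < δ k) ∧
      (∀ (k : ℕ) x, r < ‖x‖ → ‖x‖ < R₀ + k + 2 → ContDiffAt ℝ 2 (f k) x ∧ 0 ≤ Pop a b W (f k) x ∧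
        f k x ≤ Θ x + ω k) ∧
      (∀ (k : ℕ) x, r < ‖x‖ → ‖x‖ < R₀ + k + 2 → f (k + 1) x ≤ Θ x + ω k) ∧
      (∀ (k : ℕ) x, ‖x‖ = R₀ + k + 1 →
        f k x + δ k < f (k + 1) x ∧ f (k + 2) x + δ k < f (k + 1) x) ∧
      (∀ x ∈ S, ‖x‖ < n₀) ∧ ∀ x ∈ S, perron a b W Θ r n₀ x ≤ f 0 x + ω 0 := by
  have r0 := h.r_pos
  have hk0 : ∀ k : ℕ, (0 : ℝ) ≤ k := fun k => Nat.cast_nonneg k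
  choose hb hbC hb0 hb1 hbP hbz v v0 hbv using fun k : ℕ => exists_bump h.ell h.contW h.r_pos
    (ρ := R₀ + k) (R := R₀ + k + 1) (by linarith [hk0 k]) (by linarith)
  let c : ℕ → ℝ := fun k => Nat.rec (ω 0) (fun j cj => min (ω (j + 1)) (min cj (cj * v j / 2))) k
  have hcs : ∀ k, c (k + 1) = min (ω (k + 1)) (min (c k) (c k * v k / 2)) := fun _ => rfl
  have hc0 : ∀ k, 0 < c k := fun k => by
    induction k with
    | zero => exact hω 0
    | succ k ih => rw [hcs]; exact lt_min (hω _) (lt_min ih (by have := v0 k; positivity))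
  have hcω : ∀ k, c k ≤ ω k := fun k => by
    cases k with
    | zero => exact le_rfl
    | succ k => rw [hcs]; exact min_le_left _ _
  have hcc : ∀ k, c (k + 1) ≤ c k := fun k => by
    rw [hcs]; exact (min_le_right _ _).trans (min_le_left _ _)
  have hcv : ∀ k, c (k + 1) ≤ c k * v k / 2 := fun k => by
    rw [hcs]; exact (min_le_right _ _).trans (min_le_right _ _)
  set e : ℕ → ℝ := fun k => min (ω 0) (c k * v k / 16) with he
  have he0 : ∀ k, 0 < e k := fun k => lt_min (hω 0) (by have := v0 k; have := hc0 k; positivity)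
  choose t ht hthr using fun k : ℕ => h.exists_threshold
    (S := sphere 0 (R₀ + k) ∪ S) ((isCompact_sphere _ _).union hS) (by
      rintro x (hx | hx)
      · rw [mem_sphere_zero_iff_norm] at hx; linarith [hk0 k]
      · exact hr x hx) (he0 k)
  set n : ℕ → ℝ := fun k => max (max (t k) (t (k + 1))) (max (t (k - 1)) (R₀ + k + 2)) with hn
  have n1 : ∀ k, t k ≤ n k := fun k => (le_max_left _ _).trans (le_max_left _ _)
  have n2 : ∀ k, t (k + 1) ≤ n k := fun k => (le_max_right _ _).trans (le_max_left _ _)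
  have n3 : ∀ k, t k ≤ n (k + 1) := fun k => (le_max_left _ _).trans (le_max_right _ _)
  have n4 : ∀ k, R₀ + k + 2 ≤ n k := fun k => (le_max_right _ _).trans (le_max_right _ _)
  choose σ hσ hσL using fun k => (hthr k (n k) (n1 k)).1
  have hfle : ∀ (k : ℕ) x, r < ‖x‖ → ‖x‖ < R₀ + k + 2 → σ k x + c k * hb k x ≤ Θ x + c k :=
    fun k x h1 h2 => add_le_add (hσ k x h1 (h2.trans_le (n4 k))).2.2
      (mul_le_of_le_one_right (hc0 k).le (hb1 k x))
  refine ⟨fun k x => σ k x + c k * hb k x, fun k => c (k + 1) * v (k + 1) / 8, n 0,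
    fun k => by have := v0 (k + 1); have := hc0 (k + 1); positivity, fun k x h1 h2 => ?_,
    fun k x h1 h2 => ?_, fun k x hx => ?_, fun x hx => ?_, fun x hx => ?_⟩
  · obtain ⟨s1, s2, s3⟩ := hσ k x h1 (h2.trans_le (n4 k))
    refine ⟨s1.add (contDiffAt_const.mul (hbC k).contDiffAt), ?_, ?_⟩
    · rw [Pop_add s1 (contDiffAt_const.mul (hbC k).contDiffAt), Pop_const_mul (hbC k).contDiffAt]
      exact add_nonneg s2 (mul_nonneg (hc0 k).le (hbP k x h1.le))
    · linarith [hfle k x h1 h2, hcω k]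
  · have := hfle (k + 1) x h1 (by push_cast; linarith)
    linarith [hcc k, hcω k]
  · have hx' : ‖x‖ = R₀ + (k + 1 : ℕ) := by push_cast; linarith
    have hrx : r < ‖x‖ := by linarith [hk0 k]
    have hA : x ∈ sphere (0 : Euc d) (R₀ + (k + 1 : ℕ)) ∪ S :=
      Or.inl (mem_sphere_zero_iff_norm.2 hx')
    have l0 := hσL (k + 1) x hA
    have l1 := (hthr (k + 1) (n (k + 1)) (n1 _)).2 (n k) (n2 k) x hA
    have l2 := (hthr (k + 1) (n (k + 1)) (n1 _)).2 (n (k + 2)) (n3 (k + 1)) x hA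
    have m1 := h.le_perron (hσ k) hrx (by linarith [n4 k])
    have m2 := h.le_perron (hσ (k + 2)) hrx (by have := n4 (k + 2); push_cast at this; linarith)
    have e1 : hb k x = 0 := hbz k x (by linarith)
    have e2 : hb (k + 1) x = v (k + 1) := hbv (k + 1) x hx'
    have e3 : e (k + 1) ≤ c (k + 1) * v (k + 1) / 16 := min_le_right _ _
    have e4 : c (k + 2) * hb (k + 2) x ≤ c (k + 2) :=
      mul_le_of_le_one_right (hc0 (k + 2)).le (hb1 _ x)
    have e5 := hcv (k + 1)
    have e6 : 0 < c (k + 1) * v (k + 1) := mul_pos (hc0 (k + 1)) (v0 (k + 1))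
    beta_reduce
    rw [e1, e2]
    constructor <;> linarith
  · exact (ht 0 x (Or.inr hx)).trans_le (n1 0)
  · have l0 := hσL 0 x (Or.inr hx)
    have e3 : e 0 ≤ ω 0 := min_le_left _ _
    have := mul_nonneg (hc0 0).le (hb0 0 x)
    linarith

theorem exists_glued (h : PerronData a b W Θ r) {S : Set (Euc d)} (hS : IsCompact S)
    (hr : ∀ x ∈ S, r < ‖x‖) {ω : Euc d → ℝ} (hωc : Continuous ω) (hω : ∀ x, 0 < ω x) :
    ∃ n₀ : ℝ, ∃ τ : Euc d → ℝ, (∀ x ∈ S, ‖x‖ < n₀) ∧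
      (∀ x, r < ‖x‖ → ContDiffAt ℝ 2 τ x ∧ 0 ≤ Pop a b W τ x ∧ τ x ≤ Θ x + ω x) ∧
      ∀ x ∈ S, perron a b W Θ r n₀ x ≤ τ x + ω x := by
  obtain ⟨ρ, hρ⟩ := hS.isBounded.exists_norm_le
  set R₀ := max (r + 1) ρ with hR₀
  have hR₀r : r < R₀ := lt_of_lt_of_le (lt_add_one r) (le_max_left _ _)
  have hR₀S : ∀ x ∈ S, ‖x‖ < R₀ + 1 := fun x hx =>
    lt_of_le_of_lt ((hρ x hx).trans (le_max_right _ _)) (lt_add_one _)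
  choose ωs hωs0 hωs using fun k : ℕ => exists_pos_lower_bound
    (isCompact_closedBall (0 : Euc d) (R₀ + k + 1)) hωc.continuousOn (fun x _ => hω x)
  have hωs' : ∀ (k : ℕ) x, ‖x‖ ≤ R₀ + k + 1 → ωs k ≤ ω x := fun k x hx =>
    hωs k x (mem_closedBall_zero_iff.2 hx)
  obtain ⟨f, δ, n₀, hδ, hf, hf', hsph, hSn, hSf⟩ := h.exists_layers hR₀r hS hr
    (ω := fun k => ωs k / 2) (fun k => half_pos (hωs0 k))
  choose g gC g0 g1 μ hμ hg using fun k : ℕ =>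
    exists_weight h.ell h.contW h.r_pos (R₀ + k + 2)
  set η : ℕ → ℝ := fun k => min (min (δ k) (δ (k - 1))) (ωs k / 2) with hη
  have hη0 : ∀ k, 0 < η k := fun k => lt_min (lt_min (hδ _) (hδ _)) (half_pos (hωs0 k))
  have hη1 : ∀ k, η k ≤ δ k := fun k => (min_le_left _ _).trans (min_le_left _ _)
  have hη2 : ∀ k, η (k + 1) ≤ δ k := fun k => (min_le_left _ _).trans (min_le_right _ _)
  have hη3 : ∀ k, η k ≤ ωs k / 2 := fun k => min_le_right _ _
  set G : ℕ → Euc d → ℝ := fun k y => η k * g k y with hG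
  have hG0 : ∀ (k : ℕ) x, 0 < G k x := fun k x => mul_pos (hη0 k) (g0 k x)
  have hGC : ∀ k, ContDiff ℝ 2 (G k) := fun k => contDiff_const.mul (gC k)
  have hGle : ∀ (k : ℕ) x, G k x ≤ η k := fun k x => mul_le_of_le_one_right (hη0 k).le (g1 k x)
  set m : ℕ → Euc d → ℝ := fun k => smax (G k) (f k) (f (k + 1)) with hm
  have hmP : ∀ (k : ℕ) x, r < ‖x‖ → ‖x‖ < R₀ + k + 2 →
      ContDiffAt ℝ 2 (m k) x ∧ 0 ≤ Pop a b W (m k) x := fun k x h1 h2 => by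
    obtain ⟨s1, s2, -⟩ := hf k x h1 h2
    obtain ⟨t1, t2, -⟩ := hf (k + 1) x h1 (by push_cast; linarith)
    refine ⟨contDiffAt_smax (hGC k).contDiffAt s1 t1 (hG0 k x),
      Pop_smax_nonneg (h.ell.posSemidef x) (hGC k).contDiffAt s1 t1 (hG0 k x) s2 t2 ?_⟩
    rw [hG, Pop_const_mul (gC k).contDiffAt]
    exact mul_nonneg (hη0 k).le ((hμ k).le.trans (hg k x h1.le h2.le))
  refine ⟨n₀, shellGlue R₀ m, hSn, fun x hx => ?_, fun x hx => ?_⟩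
  · obtain ⟨k, k1, k2, k3⟩ := exists_shell x R₀
    have hle : shellGlue R₀ m x ≤ Θ x + ω x := by
      rw [shellGlue, k2]
      have e1 := smax_le (s₁ := f k) (s₂ := f (k + 1)) (hG0 k x)
      have e2 := max_le (hf k x hx (by linarith)).2.2 (hf' k x hx (by linarith))
      have e3 := hωs' k x k1.le
      simp only [hm]
      linarith [hGle k x, hη3 k]
    rcases k3 with k3 | ⟨j, rfl, hj⟩
    · have ev := shellGlue_eventuallyEq (m := m) k3 k1
      have := hmP k x hx (by linarith)
      exact ⟨this.1.congr_of_eventuallyEq ev, by rw [Pop_congr ev]; exact this.2, hle⟩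
    · obtain ⟨f0, -, -⟩ := hf j x hx (by linarith)
      obtain ⟨f1, f1P, -⟩ := hf (j + 1) x hx (by push_cast; linarith)
      obtain ⟨f2, -, -⟩ := hf (j + 2) x hx (by push_cast; linarith)
      have g1 : ∀ᶠ y in 𝓝 x, f j y + δ j < f (j + 1) y :=
        (f0.continuousAt.add continuousAt_const).eventually_lt f1.continuousAt (hsph j x hj).1
      have g2 : ∀ᶠ y in 𝓝 x, f (j + 2) y + δ j < f (j + 1) y :=
        (f2.continuousAt.add continuousAt_const).eventually_lt f1.continuousAt (hsph j x hj).2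
      have ev : shellGlue R₀ m =ᶠ[𝓝 x] f (j + 1) := by
        refine shellGlue_eventuallyEq_sphere hj ?_ ?_
        · filter_upwards [g1] with y hy
          exact smax_eq_right (hG0 j y) (by linarith [hGle j y, hη1 j])
        · filter_upwards [g2] with y hy
          exact smax_eq_left (hG0 (j + 1) y) (by linarith [hGle (j + 1) y, hη2 j])
      exact ⟨f1.congr_of_eventuallyEq ev, by rw [Pop_congr ev]; exact f1P, hle⟩
  · have e0 : shellGlue R₀ m x = m 0 x := by
      rw [shellGlue, floor_shell (Or.inl rfl) (by simpa using hR₀S x hx)]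
    have e1 : f 0 x ≤ m 0 x := le_smax_left (hG0 0 x)
    have e2 := hSf x hx
    have e3 := hωs' 0 x (by simpa using (hR₀S x hx).le)
    have := hωs0 0
    rw [e0]
    linarith

end PerronData

end gluing

section approximation

variable {d : ℕ} {a : Euc d → Matrix (Fin d) (Fin d) ℝ} {b : Euc d → Euc d}
  {W₁ W₂ Φ Ψ₁ Ψ : Euc d → ℝ} {r₀ r r₁ C ε : ℝ}

/-- A Lipschitz cutoff vanishing on the ball of radius `r₁` and equal to `1` off the ball of
radius `r₁ + 1`. -/
def radialCutoff {d : ℕ} (r₁ : ℝ) (x : Euc d) : ℝ := min 1 (max 0 (‖x‖ - r₁))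

theorem radialCutoff_nonneg (r₁ : ℝ) (x : Euc d) : 0 ≤ radialCutoff r₁ x :=
  le_min zero_le_one (le_max_left _ _)

theorem radialCutoff_le_one (r₁ : ℝ) (x : Euc d) : radialCutoff r₁ x ≤ 1 := min_le_left _ _

theorem radialCutoff_eq_zero {x : Euc d} (h : ‖x‖ ≤ r₁) : radialCutoff r₁ x = 0 := by
  simp [radialCutoff, max_eq_left (sub_nonpos.2 h)]

theorem radialCutoff_eq_one {x : Euc d} (h : r₁ + 1 ≤ ‖x‖) : radialCutoff r₁ x = 1 :=
  min_eq_left ((by linarith : (1 : ℝ) ≤ ‖x‖ - r₁).trans (le_max_right _ _))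

theorem locallyLipschitz_radialCutoff (r₁ : ℝ) : LocallyLipschitz (radialCutoff (d := d) r₁) := by
  have h1 : LocallyLipschitz fun x : Euc d => ‖x‖ - r₁ := by
    have : LipschitzWith 1 fun x : Euc d => ‖x‖ - r₁ :=
      LipschitzWith.of_dist_le_mul fun x y => by
        simpa [Real.dist_eq, dist_eq_norm] using abs_norm_sub_norm_le x y
    exact this.locallyLipschitz
  exact (LocallyLipschitz.const 1).min ((LocallyLipschitz.const 0).max h1)

theorem Comparison.perronData (h : Comparison a b W₁ W₂ Φ Ψ₁ r₀) (hΨ₁ : ContDiff ℝ 2 Ψ₁)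
    (hr : r₀ ≤ r) (hC : 0 ≤ C) (hε : 0 < ε) (r₁ : ℝ) :
    PerronData a b W₂ (fun x => ε * Φ x + C * Ψ₁ x * radialCutoff r₁ x) r where
  ell := h.ell
  contW := h.contW₂
  r_pos := h.r₀_pos.trans_le hr
  Θ_pos x := add_pos_of_pos_of_nonneg (mul_pos hε (h.Φ_pos x))
    (mul_nonneg (mul_nonneg hC (h.Ψ₁_pos x).le) (radialCutoff_nonneg _ _))
  Θ_lip := by
    have h1 : LocallyLipschitz fun x => (ε * Φ x, C * Ψ₁ x) :=
      ((((contDiff_const.mul h.Φ_C2).prodMk (contDiff_const.mul hΨ₁)).of_le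
        one_le_two).locallyLipschitz)
    have h2 : LocallyLipschitz fun p : (ℝ × ℝ) × ℝ => p.1.1 + p.1.2 * p.2 :=
      ContDiff.locallyLipschitz (𝕂 := ℝ) (by fun_prop)
    exact h2.comp (h1.prodMk (locallyLipschitz_radialCutoff r₁))

/-- Almost supersolutions dominating `Ψ` on a ball almost dominate it on larger balls. -/
theorem Comparison.exists_forall_le_add (h : Comparison a b W₁ W₂ Φ Ψ₁ r₀)
    (hΨ₁ : ContDiff ℝ 2 Ψ₁) (hC : 0 ≤ C) (hΨ : ContDiff ℝ 2 Ψ)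
    (hsub : ∀ x, 0 ≤ Pop a b W₂ Ψ x) (hle : ∀ x, Ψ x ≤ C * Ψ₁ x) (hr : r₀ < r₁) (r₂ : ℝ)
    (hε : 0 < ε) : ∃ δ₀ : ℝ, 0 < δ₀ ∧ ∀ δ : ℝ, 0 ≤ δ → δ ≤ δ₀ → ∀ φ : Euc d → ℝ,
      ContDiff ℝ 2 φ → (∀ x, 0 < φ x) → (∀ x, Pop a b W₂ φ x ≤ δ * φ x) →
      (∀ x, ‖x‖ ≤ r₁ + 1 → Ψ x ≤ φ x) → ∀ x, ‖x‖ ≤ r₂ → Ψ x ≤ φ x + 3 * ε * Φ x := by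
  have hD := h.perronData hΨ₁ le_rfl hC hε r₁
  have hεΦ : ∀ x, 0 < ε * Φ x := fun x => mul_pos hε (h.Φ_pos x)
  have hCΨ : ∀ x, 0 ≤ C * Ψ₁ x := fun x => mul_nonneg hC (h.Ψ₁_pos x).le
  obtain ⟨N, τ, hN, hτ, hperron⟩ := hD.exists_glued (S := ann (0 : Euc d) r₁ r₂)
    (isCompact_ann _ _ _) (fun x hx => hr.trans_le (mem_ann_zero.1 hx).1)
    (ω := fun x => ε * Φ x) (continuous_const.mul h.Φ_C2.continuous) hεΦ
  have hΦ2 : ContDiff ℝ 2 fun x => 2 * ε * Φ x := contDiff_const.mul h.Φ_C2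
  have hτΦ : ∀ x, r₀ < ‖x‖ → τ x - 2 * ε * Φ x ≤ 0 := by
    refine h.liouville le_rfl hr hC (s := fun x => τ x - 2 * ε * Φ x)
      (fun x hx => (hτ x hx).1.sub hΦ2.contDiffAt) (fun x hx => ?_) (fun x hx hx₁ => ?_)
      (fun x hx => ?_)
    · rw [Pop_sub (hτ x hx).1 hΦ2.contDiffAt, Pop_const_mul h.Φ_C2.contDiffAt]
      have := mul_nonpos_of_nonneg_of_nonpos (by positivity : 0 ≤ 2 * ε) (h.Pop_W₂_nonpos hx.le)
      linarith [(hτ x hx).2.1]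
    · have := (hτ x hx).2.2
      rw [radialCutoff_eq_zero hx₁] at this
      linarith
    · have := (hτ x hx).2.2
      have := mul_le_of_le_one_right (hCΨ x) (radialCutoff_le_one r₁ x)
      linarith
  obtain ⟨g, gC, g0, g1, m, hm, hg⟩ := exists_weight h.ell h.contW₂ h.r₀_pos N
  obtain ⟨q, hq, hqΦ⟩ := exists_pos_lower_bound (isCompact_ann (0 : Euc d) r₀ N)
    (f := fun x => ε * Φ x) (continuous_const.mul h.Φ_C2.continuous).continuousOn
    (fun x _ => hεΦ x)
  obtain ⟨B, hB, hΨB⟩ := exists_bound (isCompact_ann (0 : Euc d) r₀ N) hΨ.continuous.continuousOn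
  set G : Euc d → ℝ := fun x => q / 2 * g x with hGdef
  have GC : ContDiff ℝ 2 G := contDiff_const.mul gC
  have G0 : ∀ x, 0 < G x := fun x => mul_pos (half_pos hq) (g0 x)
  have Gq : ∀ x, G x ≤ q / 2 := fun x => mul_le_of_le_one_right (half_pos hq).le (g1 x)
  have hPG : ∀ x, r₀ < ‖x‖ → ‖x‖ < N → q / 2 * m ≤ Pop a b W₂ G x := fun x k1 k2 => by
    rw [hGdef, Pop_const_mul gC.contDiffAt]
    exact mul_le_mul_of_nonneg_left (hg x k1.le k2.le) (half_pos hq).le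
  have hBq : 0 < B + q / 2 := by positivity
  refine ⟨q / 2 * m / (B + q / 2), by positivity, fun δ hδ hδ' φ φC φ0 hφ hΨφ x hx => ?_⟩
  rw [le_div_iff₀ hBq] at hδ'
  rcases le_total ‖x‖ (r₁ + 1) with hx1 | hx1
  · have := hΨφ x hx1
    have := hεΦ x
    linarith
  have hsC : ContDiff ℝ 2 fun y => Ψ y - φ y := hΨ.sub φC
  have hσ : (fun y => G y * spos ((Ψ y - φ y) / G y) + G y) ∈
      subs a b W₂ (fun x => ε * Φ x + C * Ψ₁ x * radialCutoff r₁ x) r₀ N := by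
    intro y k1 k2
    have hy : y ∈ ann (0 : Euc d) r₀ N := mem_ann_zero.2 ⟨k1.le, k2.le⟩
    have c1 := contDiffAt_mul_spos (x := y) GC.contDiffAt hsC.contDiffAt (G0 y)
    refine ⟨c1.add GC.contDiffAt, ?_, ?_⟩
    · rw [Pop_add c1 GC.contDiffAt]
      have e1 := Pop_mul_spos (W := W₂) (b := b) (h.ell.posSemidef y) GC.contDiffAt
        hsC.contDiffAt (G0 y)
      have e2 := hPG y k1 k2
      have e3 : 0 ≤ Pop a b W₂ G y := le_trans (by positivity) e2
      have e4 := mul_nonneg (spos_sub_nonneg ((Ψ y - φ y) / G y)) e3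
      have e5 : -(q / 2 * m) ≤ sposD ((Ψ y - φ y) / G y) * Pop a b W₂ (fun z => Ψ z - φ z) y := by
        rw [Pop_sub hΨ.contDiffAt φC.contDiffAt]
        rcases le_total ((Ψ y - φ y) / G y) (-1) with hρ | hρ
        · rw [sposD_eq_zero hρ, zero_mul]
          have : 0 < q / 2 * m := by positivity
          linarith
        · rw [le_div_iff₀ (G0 y)] at hρ
          have f1 : φ y ≤ B + q / 2 := by
            linarith [Gq y, (abs_le.1 (hΨB y hy)).2]
          have f2 : -(q / 2 * m) ≤ Pop a b W₂ Ψ y - Pop a b W₂ φ y := by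
            have := mul_le_mul_of_nonneg_left f1 hδ
            linarith [hsub y, hφ y]
          have f3 := sposD_nonneg ((Ψ y - φ y) / G y)
          have f4 := sposD_le_one ((Ψ y - φ y) / G y)
          have f5 := mul_le_mul_of_nonneg_left f2 f3
          have f6 := mul_le_mul_of_nonneg_right f4 (by positivity : 0 ≤ q / 2 * m)
          linarith
      linarith
    · have e1 := mul_spos_le (s := Ψ y - φ y) (G0 y)
      have e2 := Gq y
      have e3 := hqΦ y hy
      have e4 : max (Ψ y - φ y) 0 ≤ C * Ψ₁ y * radialCutoff r₁ y := by
        refine max_le ?_ (mul_nonneg (hCΨ y) (radialCutoff_nonneg _ _))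
        rcases le_total ‖y‖ (r₁ + 1) with hy1 | hy1
        · exact (sub_nonpos.2 (hΨφ y hy1)).trans
            (mul_nonneg (hCΨ y) (radialCutoff_nonneg _ _))
        · rw [radialCutoff_eq_one hy1, mul_one]
          linarith [hle y, φ0 y]
      beta_reduce
      linarith
  have hxS : x ∈ ann (0 : Euc d) r₁ r₂ := mem_ann_zero.2 ⟨by linarith, hx⟩
  have hxr : r₀ < ‖x‖ := by linarith
  have e1 := hD.le_perron hσ hxr (hN x hxS)
  have e2 := hperron x hxS
  have e3 := hτΦ x hxr
  have e4 : Ψ x - φ x ≤ G x * spos ((Ψ x - φ x) / G x) := by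
    have := mul_le_mul_of_nonneg_left (le_spos ((Ψ x - φ x) / G x)) (G0 x).le
    rwa [mul_div_cancel₀ _ (G0 x).ne'] at this
  have e5 := G0 x
  beta_reduce at e1
  linarith

end approximation

section rigidity

variable {d : ℕ} {a : Euc d → Matrix (Fin d) (Fin d) ℝ} {b : Euc d → Euc d}
  {W₁ W₂ Φ Ψ₁ Ψ : Euc d → ℝ} {r₀ r r₁ C ε : ℝ}

/-- Quantitative lower bound for nonnegative functions that are strict supersolutions on a ball. -/
theorem exists_lower_bound_of_strict (h : Elliptic a b) (z : Euc d) {ρ c f : ℝ} (hρ : 0 < ρ)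
    (hc : 0 ≤ c) (hf : 0 < f) : ∃ η > 0, ∀ w : Euc d → ℝ, ContDiff ℝ 2 w →
      (∀ x, ‖x - z‖ ≤ ρ → 0 ≤ w x) → (∀ x, ‖x - z‖ ≤ ρ → Lop a b w x - c * w x ≤ -f) →
      ∀ x, ‖x - z‖ ≤ ρ / 2 → η ≤ w x := by
  have hnC : ContDiff ℝ 2 fun y : Euc d => ‖y - z‖ ^ 2 := contDiff_normSq z
  obtain ⟨D, hD, hLD⟩ := exists_bound (isCompact_closedBall z ρ)
    (continuous_Lop h hnC).continuousOn
  set α := f / (2 * (D + c * ρ ^ 2 + 1)) with hα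
  have hden : 0 < D + c * ρ ^ 2 + 1 := by positivity
  have hα0 : 0 < α := by positivity
  have hαf : α * (D + c * ρ ^ 2) < f := by
    have : α * (D + c * ρ ^ 2 + 1) = f / 2 := by rw [hα]; field_simp
    linarith
  refine ⟨α * (3 / 4 * ρ ^ 2), by positivity, fun w wC w0 hw x hx => ?_⟩
  have uC : ContDiff ℝ 2 fun y => w y + α * ‖y - z‖ ^ 2 := wC.add (contDiff_const.mul hnC)
  obtain ⟨y, hy, hmin⟩ := (isCompact_closedBall z ρ).exists_isMinOn
    ⟨z, mem_closedBall_self hρ.le⟩ uC.continuous.continuousOn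
  have hyρ : ‖y - z‖ ≤ ρ := by simpa [dist_eq_norm] using hy
  have hxy := hmin (show x ∈ closedBall z ρ by simp [dist_eq_norm]; linarith)
  simp only [mem_ofPred_eq] at hxy
  have hx2 : ‖x - z‖ ^ 2 ≤ ρ ^ 2 / 4 := by
    have := pow_le_pow_left₀ (norm_nonneg _) hx 2
    linarith
  have hx3 := mul_le_mul_of_nonneg_left hx2 hα0.le
  by_contra hcon
  push Not at hcon
  have hlt : w y + α * ‖y - z‖ ^ 2 < α * ρ ^ 2 := by linarith
  have hy2 : ‖y - z‖ < ρ := by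
    refine lt_of_le_of_ne hyρ fun e => ?_
    rw [e] at hlt
    linarith [w0 y hyρ]
  have hloc : IsLocalMin (fun y => w y + α * ‖y - z‖ ^ 2) y :=
    hmin.isLocalMin (closedBall_mem_nhds_of_mem (by simpa [dist_eq_norm] using hy2))
  have e1 := Lop_nonneg_of_isLocalMin (b := b) (h.posSemidef y) uC.contDiffAt hloc
  rw [Lop_add wC.contDiffAt (contDiff_const.mul hnC).contDiffAt,
    Lop_const_mul hnC.contDiffAt] at e1
  have e2 := mul_le_mul_of_nonneg_left (abs_le.1 (hLD y hy)).2 hα0.le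
  have e3 := hw y hyρ
  have e4 : w y ≤ α * ρ ^ 2 := by
    have : 0 ≤ α * ‖y - z‖ ^ 2 := by positivity
    linarith
  have e5 := mul_le_mul_of_nonneg_left e4 hc
  linarith

/-- If `Ψ` is negative or a strict subsolution at `z`, nonnegative almost supersolutions above
`-Ψ` are bounded below near `z`. -/
theorem exists_lower_bound_near (h : Elliptic a b) (hW : Continuous W₂) (hΨ : ContDiff ℝ 2 Ψ)
    {z : Euc d} (hz : 0 < Pop a b W₂ Ψ z ∨ Ψ z < 0) {c R : ℝ} (hc : 0 ≤ c) (hR : 0 < R) :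
    ∃ s > 0, s ≤ R ∧ ∃ η > 0, ∃ e₀ > 0, ∀ w : Euc d → ℝ, ContDiff ℝ 2 w →
      (∀ x, ‖x - z‖ ≤ R → 0 ≤ w x) → (∀ x, ‖x - z‖ ≤ R → -Ψ x ≤ w x) →
      (∀ x, ‖x - z‖ ≤ R → Lop a b w x - c * w x ≤ e₀ - Pop a b W₂ Ψ x) →
      ∀ x, ‖x - z‖ ≤ s → η ≤ w x := by
  rcases hz with hz | hz
  · have hcont : Continuous (Pop a b W₂ Ψ) :=
      (continuous_Lop h hΨ).add (hW.mul hΨ.continuous)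
    obtain ⟨ρ, hρ, hball⟩ := Metric.nhds_basis_closedBall.mem_iff.1
      (hcont.continuousAt.eventually (lt_mem_nhds (half_lt_self hz)))
    have hm : 0 < min ρ R := lt_min hρ hR
    obtain ⟨η, hη, key⟩ := exists_lower_bound_of_strict h z hm hc
      (by positivity : 0 < Pop a b W₂ Ψ z / 4)
    refine ⟨min ρ R / 2, by positivity, by linarith [min_le_right ρ R], η, hη,
      Pop a b W₂ Ψ z / 4, by positivity, fun w wC w0 _ hw => key w wC
        (fun x hx => w0 x (hx.trans (min_le_right _ _))) fun x hx => ?_⟩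
    have e1 := hw x (hx.trans (min_le_right _ _))
    have e2 : Pop a b W₂ Ψ z / 2 < Pop a b W₂ Ψ x :=
      hball (by simpa [dist_eq_norm] using hx.trans (min_le_left _ _))
    linarith
  · obtain ⟨ρ, hρ, hball⟩ := Metric.nhds_basis_closedBall.mem_iff.1
      (hΨ.continuous.continuousAt.eventually (gt_mem_nhds (show Ψ z < Ψ z / 2 by linarith)))
    refine ⟨min ρ R, lt_min hρ hR, min_le_right _ _, -(Ψ z / 2), by linarith, 1, one_pos,
      fun w _ _ hw _ x hx => ?_⟩
    have e1 := hw x (hx.trans (min_le_right _ _))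
    have e2 : Ψ x < Ψ z / 2 :=
      hball (by simpa [dist_eq_norm] using hx.trans (min_le_left _ _))
    linarith

/-- A subsolution dominated by `Ψ₁` and positive somewhere is a nonnegative solution, provided
there are positive almost supersolutions. -/
theorem Comparison.rigidity (h : Comparison a b W₁ W₂ Φ Ψ₁ r₀)
    (hΨ₁ : ContDiff ℝ 2 Ψ₁) (hC : 0 ≤ C) (hΨ : ContDiff ℝ 2 Ψ)
    (hsub : ∀ x, 0 ≤ Pop a b W₂ Ψ x) (hle : ∀ x, Ψ x ≤ C * Ψ₁ x) {x₀ : Euc d} (hx₀ : 0 < Ψ x₀)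
    (happrox : ∀ δ : ℝ, 0 < δ → ∃ φ : Euc d → ℝ, ContDiff ℝ 2 φ ∧ (∀ x, 0 < φ x) ∧
      ∀ x, Pop a b W₂ φ x ≤ δ * φ x) (z : Euc d) : Pop a b W₂ Ψ z = 0 ∧ 0 ≤ Ψ z := by
  suffices H : ¬ (0 < Pop a b W₂ Ψ z ∨ Ψ z < 0) by
    push Not at H
    exact ⟨le_antisymm H.1 (hsub z), H.2⟩
  intro hz
  have hr₀ := h.r₀_pos
  have nz := norm_nonneg z
  have nx₀ := norm_nonneg x₀
  set r₁ := r₀ + 1 + ‖z‖ + ‖x₀‖ with hr₁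
  set ρ := r₁ + 1 with hρ
  have hρ0 : 0 < ρ := by positivity
  set B := closedBall (0 : Euc d) (4 * ρ) with hB
  have hBc : IsCompact B := isCompact_closedBall _ _
  have memB : ∀ x, ‖x - z‖ ≤ 3 * ρ → x ∈ B := fun x hx => by
    have := norm_le_norm_sub_add x z
    rw [hB, mem_closedBall_zero_iff]
    linarith
  have hPΦ : Continuous (Pop a b W₂ Φ) :=
    (continuous_Lop h.ell h.Φ_C2).add (h.contW₂.mul h.Φ_C2.continuous)
  obtain ⟨BW, hBW, hW⟩ := exists_bound hBc h.contW₂.continuousOn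
  obtain ⟨BP, hBP, hP⟩ := exists_bound hBc hPΦ.continuousOn
  obtain ⟨BΦ, hBΦ, hΦ⟩ := exists_bound hBc h.Φ_C2.continuous.continuousOn
  obtain ⟨BΨ, hBΨ, hΨB⟩ := exists_bound hBc hΨ.continuous.continuousOn
  set c := 1 + BW with hc
  have hc0 : 0 ≤ c := by positivity
  obtain ⟨s, hs, hsR, η, hη, e₀, he₀, near⟩ :=
    exists_lower_bound_near h.ell h.contW₂ hΨ hz hc0 hρ0
  obtain ⟨θ, hθ, m, hm, prop⟩ := propagation h.ell z hs (by linarith : 2 * ρ < 3 * ρ) hc0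
    (by linarith : s ≤ 2 * ρ)
  set e₁ := min e₀ (η * m) with he₁
  have he₁0 : 0 < e₁ := lt_min he₀ (by positivity)
  set κ := min η (η * θ) with hκ
  have hκ0 : 0 < κ := lt_min hη (by positivity)
  set ε := min (e₁ / (6 * BP)) (κ / (6 * BΦ)) with hε
  have hε0 : 0 < ε := lt_min (by positivity) (by positivity)
  have hεP : ε * (6 * BP) ≤ e₁ := (le_div_iff₀ (by positivity)).1 (min_le_left _ _)
  have hεΦ : ε * (6 * BΦ) ≤ κ := (le_div_iff₀ (by positivity)).1 (min_le_right _ _)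
  obtain ⟨δ₀, hδ₀, hcomp⟩ := h.exists_forall_le_add hΨ₁ hC hΨ hsub hle
    (by linarith : r₀ < r₁) (4 * ρ) hε0
  set δ := min (min 1 δ₀) (e₁ / (2 * BΨ)) with hδ
  have hδ0 : 0 < δ := lt_min (lt_min one_pos hδ₀) (by positivity)
  have hδ1 : δ ≤ 1 := (min_le_left _ _).trans (min_le_left _ _)
  have hδδ₀ : δ ≤ δ₀ := (min_le_left _ _).trans (min_le_right _ _)
  have hδΨ : δ * (2 * BΨ) ≤ e₁ := (le_div_iff₀ (by positivity)).1 (min_le_right _ _)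
  obtain ⟨φ, φC, φ0, hφ⟩ := happrox δ hδ0
  obtain ⟨y, hy, hmax⟩ := (isCompact_closedBall (0 : Euc d) ρ).exists_isMaxOn
    (f := fun x => Ψ x / φ x) ⟨0, mem_closedBall_self hρ0.le⟩
    (hΨ.continuous.div φC.continuous fun x => (φ0 x).ne').continuousOn
  rw [mem_closedBall_zero_iff] at hy
  set M := Ψ y / φ y with hM
  have hmax' : ∀ x, ‖x‖ ≤ ρ → Ψ x / φ x ≤ M := fun x hx =>
    hmax (mem_closedBall_zero_iff.2 hx)
  have hM0 : 0 < M := lt_of_lt_of_le (div_pos hx₀ (φ0 x₀)) (hmax' x₀ (by linarith))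
  have hMφC : ContDiff ℝ 2 fun x => M * φ x := contDiff_const.mul φC
  have hMφ : ∀ x, Pop a b W₂ (fun x => M * φ x) x ≤ δ * (M * φ x) := fun x => by
    rw [Pop_const_mul φC.contDiffAt]
    have := mul_le_mul_of_nonneg_left (hφ x) hM0.le
    linarith
  have hΨle := hcomp δ hδ0.le hδδ₀ (fun x => M * φ x) hMφC (fun x => mul_pos hM0 (φ0 x)) hMφ
    (fun x hx => (div_le_iff₀ (φ0 x)).1 (hmax' x hx))
  have hΦ3 : ContDiff ℝ 2 fun x => 3 * ε * Φ x := contDiff_const.mul h.Φ_C2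
  set w : Euc d → ℝ := fun x => M * φ x + 3 * ε * Φ x - Ψ x with hw
  have wC : ContDiff ℝ 2 w := (hMφC.add hΦ3).sub hΨ
  have w0 : ∀ x ∈ B, 0 ≤ w x := fun x hx =>
    sub_nonneg.2 (hΨle x (mem_closedBall_zero_iff.1 hx))
  have wΨ : ∀ x, -Ψ x ≤ w x := fun x => by
    have e1 := mul_pos hM0 (φ0 x)
    have e2 := mul_pos hε0 (h.Φ_pos x)
    rw [hw]; beta_reduce; linarith
  have wL : ∀ x ∈ B, Lop a b w x - c * w x ≤ e₁ - Pop a b W₂ Ψ x := fun x hx => by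
    have k1 : Pop a b W₂ w x = Pop a b W₂ (fun x => M * φ x) x + 3 * ε * Pop a b W₂ Φ x -
        Pop a b W₂ Ψ x := by
      rw [hw, Pop_sub (hMφC.add hΦ3).contDiffAt hΨ.contDiffAt,
        Pop_add hMφC.contDiffAt hΦ3.contDiffAt, Pop_const_mul h.Φ_C2.contDiffAt]
    have k2 : Pop a b W₂ w x = Lop a b w x + W₂ x * w x := rfl
    have k3 := hMφ x
    have k4 : M * φ x ≤ w x + BΨ := by
      have := mul_pos hε0 (h.Φ_pos x)
      have := (abs_le.1 (hΨB x hx)).2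
      rw [hw]; beta_reduce; linarith
    have k5 := mul_le_mul_of_nonneg_left k4 hδ0.le
    have k6 := mul_le_mul_of_nonneg_right hδ1 (w0 x hx)
    have k7 := mul_le_mul_of_nonneg_right (abs_le.1 (hW x hx)).1 (w0 x hx)
    have k8 := mul_le_mul_of_nonneg_left (abs_le.1 (hP x hx)).2 hε0.le
    have k9 : c * w x = w x + BW * w x := by rw [hc]; ring
    linarith
  have hnear := near w wC (fun x hx => w0 x (memB x (by linarith))) (fun x _ => wΨ x)
    (fun x hx => (wL x (memB x (by linarith))).trans
      (sub_le_sub_right (min_le_left _ _) _))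
  have hyz : ‖y - z‖ ≤ 2 * ρ := by linarith [norm_sub_le y z]
  have hwy : κ ≤ w y := by
    rcases le_total ‖y - z‖ s with hys | hys
    · exact (min_le_left _ _).trans (hnear y hys)
    · exact (min_le_right _ _).trans (prop w η e₁ (fun x _ => wC.contDiffAt)
        (fun x hx => w0 x (memB x hx.2))
        (fun x hx => (wL x (memB x hx.2)).trans (sub_le_self _ (hsub x))) hη
        (fun x hx => hnear x hx.le) (min_le_right _ _) y ⟨hys, hyz⟩)
  have e1 : w y = 3 * ε * Φ y := by
    rw [hw]; beta_reduce; rw [hM, div_mul_cancel₀ _ (φ0 y).ne']; ring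
  have e2 := mul_le_mul_of_nonneg_left (abs_le.1 (hΦ y (memB y (by linarith)))).2 hε0.le
  linarith

/-- Strong maximum principle: a nonnegative solution that is positive somewhere is positive. -/
theorem pos_of_nonneg_of_pos (h : Elliptic a b) (hW : Continuous W₂) (hΨ : ContDiff ℝ 2 Ψ)
    (hP : ∀ x, Pop a b W₂ Ψ x ≤ 0) (h0 : ∀ x, 0 ≤ Ψ x) {x₀ : Euc d} (hx₀ : 0 < Ψ x₀) (x : Euc d) :
    0 < Ψ x := by
  obtain ⟨s, hs, hball⟩ := Metric.nhds_basis_closedBall.mem_iff.1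
    (hΨ.continuous.continuousAt.eventually (lt_mem_nhds (half_lt_self hx₀)))
  have hnear : ∀ y, ‖y - x₀‖ ≤ s → Ψ x₀ / 2 < Ψ y := fun y hy =>
    hball (by simpa [dist_eq_norm] using hy)
  rcases le_total ‖x - x₀‖ s with hxs | hxs
  · linarith [hnear x hxs]
  obtain ⟨c, hc, hcW⟩ := exists_bound (isCompact_ann x₀ s (‖x - x₀‖ + 1)) hW.continuousOn
  obtain ⟨θ, hθ, m, hm, key⟩ := propagation h x₀ hs (lt_add_one ‖x - x₀‖) hc.le hxs
  have := key Ψ (Ψ x₀ / 2) 0 (fun _ _ => hΨ.contDiffAt) (fun y _ => h0 y) (fun y hy => by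
    have k1 := hP y
    have k2 := mul_le_mul_of_nonneg_right (abs_le.1 (hcW y hy)).1 (h0 y)
    unfold Pop at k1
    linarith) (half_pos hx₀) (fun y hy => (hnear y hy.le).le) (by positivity) x ⟨hxs, le_rfl⟩
  exact lt_of_lt_of_le (by positivity) this

/-- There is no strict supersolution on the whole space. -/
theorem Comparison.not_strict_super (h : Comparison a b W₁ W₂ Φ Ψ₁ r₀) (hC : 0 ≤ C)
    (hΨ : ContDiff ℝ 2 Ψ) (hsub : ∀ x, 0 ≤ Pop a b W₂ Ψ x) (hle : ∀ x, Ψ x ≤ C * Ψ₁ x)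
    (h0 : ∀ x, 0 < Ψ x) {φ : Euc d → ℝ} (φC : ContDiff ℝ 2 φ) (φ0 : ∀ x, 0 < φ x) :
    ¬ ∀ x, Pop a b W₂ φ x < 0 := by
  intro hφ
  have hr₀ := h.r₀_pos
  obtain ⟨y, hy, hmax⟩ := (isCompact_closedBall (0 : Euc d) (r₀ + 1)).exists_isMaxOn
    (f := fun x => Ψ x / φ x) ⟨0, mem_closedBall_self (by linarith)⟩
    (hΨ.continuous.div φC.continuous fun x => (φ0 x).ne').continuousOn
  set M := Ψ y / φ y with hM
  have hM0 : 0 < M := div_pos (h0 y) (φ0 y)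
  have hin : ∀ x, ‖x‖ ≤ r₀ + 1 → Ψ x - M * φ x ≤ 0 := fun x hx =>
    sub_nonpos.2 ((div_le_iff₀ (φ0 x)).1 (hmax (mem_closedBall_zero_iff.2 hx)))
  have hMφC : ContDiff ℝ 2 fun x => M * φ x := contDiff_const.mul φC
  have hMφ : ∀ x, Pop a b W₂ (fun x => M * φ x) x < 0 := fun x => by
    rw [Pop_const_mul φC.contDiffAt]
    exact mul_neg_of_pos_of_neg hM0 (hφ x)
  have hall : ∀ x, Ψ x - M * φ x ≤ 0 := fun x => by
    rcases le_or_gt ‖x‖ (r₀ + 1) with hx | hx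
    · exact hin x hx
    · refine h.liouville le_rfl (lt_add_one r₀) hC (s := fun x => Ψ x - M * φ x)
        (fun x _ => (hΨ.sub hMφC).contDiffAt) (fun x _ => ?_) (fun x _ => hin x) (fun x _ => ?_)
        x (by linarith)
      · rw [Pop_sub hΨ.contDiffAt hMφC.contDiffAt]
        linarith [hsub x, hMφ x]
      · linarith [hle x, mul_pos hM0 (φ0 x)]
  have hy0 : M * φ y - Ψ y = 0 := by rw [hM, div_mul_cancel₀ _ (φ0 y).ne', sub_self]
  have hmin : IsLocalMin (fun x => M * φ x - Ψ x) y :=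
    Eventually.of_forall fun x => by beta_reduce; linarith [hall x]
  have e1 := Lop_nonneg_of_isLocalMin (b := b) (h.ell.posSemidef y)
    (hMφC.sub hΨ).contDiffAt hmin
  have e2 := Pop_sub (a := a) (b := b) (W := W₂) (x := y) hMφC.contDiffAt hΨ.contDiffAt
  have e3 : Pop a b W₂ (fun x => M * φ x - Ψ x) y = Lop a b (fun x => M * φ x - Ψ x) y := by
    unfold Pop; beta_reduce; rw [hy0, mul_zero, add_zero]
  linarith [hMφ y, hsub y]

/-- Subsolutions dominated by `Ψ₁` have minimal growth at infinity. -/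
theorem Comparison.minGrowth_of_le (h : Comparison a b W₁ W₂ Φ Ψ₁ r₀) (hC : 0 ≤ C)
    (hΨ : ContDiff ℝ 2 Ψ) (hsub : ∀ x, 0 ≤ Pop a b W₂ Ψ x) (hle : ∀ x, Ψ x ≤ C * Ψ₁ x)
    (hr : r₀ ≤ r) {v : Euc d → ℝ} (vC : ∀ x, r < ‖x‖ → ContDiffAt ℝ 2 v x)
    (v0 : ∀ x, r < ‖x‖ → 0 < v x) (hv : ∀ x, r < ‖x‖ → Pop a b W₂ v x ≤ 0) :
    ∃ κ > 0, ∀ x, r + 1 < ‖x‖ → κ * Ψ x ≤ v x := by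
  obtain ⟨M, hM, hMle⟩ := exists_bound (isCompact_ann (0 : Euc d) (r + 1) (r + 2))
    (f := fun x => Ψ x / v x) fun x hx => by
      have hx' : r < ‖x‖ := by linarith [(mem_ann_zero.1 hx).1]
      exact (hΨ.continuous.continuousAt.div (vC x hx').continuousAt
        (v0 x hx').ne').continuousWithinAt
  have hrx : ∀ x : Euc d, r + 1 < ‖x‖ → r < ‖x‖ := fun x hx => by linarith
  refine ⟨M⁻¹, inv_pos.2 hM, fun x hx => (inv_mul_le_iff₀ hM).2 (sub_nonpos.1 ?_)⟩
  refine h.liouville (by linarith : r₀ ≤ r + 1) (by linarith : r + 1 < r + 2) hC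
    (s := fun x => Ψ x - M * v x)
    (fun x hx => hΨ.contDiffAt.sub (contDiffAt_const.mul (vC x (hrx x hx))))
    (fun x hx => ?_) (fun x hx hx' => ?_) (fun x hx => ?_) x hx
  · rw [Pop_sub hΨ.contDiffAt (contDiffAt_const.mul (vC x (hrx x hx))),
      Pop_const_mul (vC x (hrx x hx))]
    have := mul_nonpos_of_nonneg_of_nonpos hM.le (hv x (hrx x hx))
    linarith [hsub x]
  · have := (abs_le.1 (hMle x (mem_ann_zero.2 ⟨hx.le, hx'⟩))).2
    exact sub_nonpos.2 ((div_le_iff₀ (v0 x (hrx x hx))).1 this)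
  · linarith [hle x, mul_pos hM (v0 x (hrx x hx))]

end rigidity

section assembly

variable {d : ℕ} {a : Euc d → Matrix (Fin d) (Fin d) ℝ} {b : Euc d → Euc d}

theorem LocallyHolder.continuous {E F : Type*} [PseudoMetricSpace E] [PseudoMetricSpace F]
    {f : E → F} (h : LocallyHolder f) : Continuous f := by
  refine continuous_iff_continuousAt.2 fun x => ?_
  obtain ⟨C, r, hr, -, ε, hε, hf⟩ := h x (mem_univ x)
  rw [inter_univ] at hf
  exact (hf.continuousOn hr).continuousAt (ball_mem_nhds x hε)

theorem abs_apply_le_frob (m : Matrix (Fin d) (Fin d) ℝ) (i j : Fin d) : |m i j| ≤ frob m := by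
  refine Real.abs_le_sqrt ?_
  calc m i j ^ 2 ≤ ∑ j, m i j ^ 2 :=
        Finset.single_le_sum (f := fun j => m i j ^ 2) (fun _ _ => sq_nonneg _) (Finset.mem_univ j)
    _ ≤ ∑ i, ∑ j, m i j ^ 2 :=
        Finset.single_le_sum (f := fun i => ∑ j, m i j ^ 2)
          (fun _ _ => Finset.sum_nonneg fun _ _ => sq_nonneg _) (Finset.mem_univ i)

theorem StandingH.elliptic (h : StandingH a b) : Elliptic a b where
  cont_a := by
    refine continuous_pi fun i => continuous_pi fun j => continuous_iff_continuousAt.2 fun x => ?_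
    obtain ⟨C, -, hL⟩ := h.aLip (‖x‖ + 1) (by positivity)
    have hmem : ∀ y ∈ ball x 1, ‖y‖ ≤ ‖x‖ + 1 := fun y hy => by
      have h1 := norm_le_norm_sub_add y x
      rw [mem_ball, dist_eq_norm] at hy
      linarith
    have : LipschitzOnWith C.toNNReal (fun y => a y i j) (ball x 1) :=
      LipschitzOnWith.of_dist_le' fun y hy z hz => by
        rw [Real.dist_eq, dist_eq_norm]
        exact (abs_apply_le_frob (a y - a z) i j).trans (hL y z (hmem y hy) (hmem z hz))
    exact this.continuousOn.continuousAt (ball_mem_nhds x one_pos)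
  cont_b := h.bHolder.continuous
  posDef := h.posdef

theorem Lop_eq_of_coeff_eq {a₁ a₂ : Euc d → Matrix (Fin d) (Fin d) ℝ} {b₁ b₂ : Euc d → Euc d}
    {x : Euc d} (h : a₁ x = a₂ x ∧ b₁ x = b₂ x) (u : Euc d → ℝ) :
    Lop a₁ b₁ u x = Lop a₂ b₂ u x := by
  unfold Lop; rw [h.1, h.2]

theorem exists_super_of_lamStar_lt {V : Euc d → ℝ} (hfin : lamStarFinite a b V univ) {μ : ℝ}
    (hμ : lamStar a b V univ < μ) : ∃ lam < μ, ∃ φ : Euc d → ℝ, ContDiff ℝ 2 φ ∧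
      (∀ x, 0 < φ x) ∧ ∀ x, Lop a b φ x + V x * φ x ≤ lam * φ x := by
  obtain ⟨lam, ⟨φ, φ0, φC, hφ⟩, hlt⟩ := exists_lt_of_csInf_lt hfin.1 hμ
  exact ⟨lam, hlt, φ, contDiffOn_univ.1 φC, fun x => φ0 x (mem_univ x), fun x => hφ x (mem_univ x)⟩

theorem Comparison.of_isGroundState {a₁ a₂ : Euc d → Matrix (Fin d) (Fin d) ℝ}
    {b₁ b₂ : Euc d → Euc d} {V₁ V₂ Φ Ψ₁ : Euc d → ℝ} {lam r₀ : ℝ} (hell : Elliptic a₂ b₂)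
    (hV₂ : Continuous V₂) (hr₀ : 0 < r₀) (hΦ0 : ∀ x, 0 < Φ x) (hΦC : ContDiff ℝ 2 Φ)
    (hcoeff : ∀ x, r₀ ≤ ‖x‖ → a₁ x = a₂ x ∧ b₁ x = b₂ x)
    (hΦ : ∀ x, r₀ ≤ ‖x‖ → Lop a₂ b₂ Φ x + max (V₁ x) (V₂ x) * Φ x ≤ lam * Φ x)
    (hgs : IsGroundState a₁ b₁ (fun x => V₁ x - lam) Ψ₁ univ) :
    Comparison a₂ b₂ (fun x => V₁ x - lam) (fun x => V₂ x - lam) Φ Ψ₁ r₀ where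
  ell := hell
  contW₂ := hV₂.sub continuous_const
  r₀_pos := hr₀
  Φ_pos := hΦ0
  Φ_C2 := hΦC
  Φ_super x hx := by
    rw [max_sub_sub_right, sub_mul]
    linarith [hΦ x hx]
  Ψ₁_pos x := hgs.1 x (mem_univ x)
  minGrowth r hr v vC v0 hv := by
    have hout : ∀ x ∈ univ \ closedBall (0 : Euc d) r, r < ‖x‖ := fun x hx => by
      simpa using hx.2
    obtain ⟨K, hK, -, -, κ, hκ, hle⟩ := hgs.2.2.2 (closedBall 0 r) (isCompact_closedBall _ _)
      (subset_univ _) v (fun x hx => (vC x (hout x hx)).contDiffWithinAt)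
      (fun x hx => v0 x (hout x hx)) (fun x hx => by
        rw [Lop_eq_of_coeff_eq (hcoeff x (hr.trans (hout x hx).le))]
        exact hv x (hout x hx))
    obtain ⟨R, hR⟩ := hK.isBounded.subset_ball 0
    exact ⟨R, κ, hκ, fun x hx => hle x ⟨mem_univ x, fun hxK =>
      absurd (mem_ball_zero_iff.1 (hR hxK)) (not_lt.2 hx)⟩⟩

end assembly

/-- Theorem 2.3: Liouville comparison theorem on `ℝ^d` under assumption (2.9). -/
theorem statement3 {d : ℕ} (hd : 1 ≤ d)
    (a₁ a₂ : Euc d → Matrix (Fin d) (Fin d) ℝ) (b₁ b₂ : Euc d → Euc d) (V₁ V₂ : Euc d → ℝ)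
    (hstand₁ : StandingH a₁ b₁) (hstand₂ : StandingH a₂ b₂)
    (hV₁reg : LocallyHolder V₁) (hV₂reg : LocallyHolder V₂)
    (hV₁bdd : ∃ m, ∀ x, m ≤ V₁ x) (hV₂bdd : ∃ m, ∀ x, m ≤ V₂ x)
    (hfin₁ : lamStarFinite a₁ b₁ V₁ Set.univ) (hfin₂ : lamStarFinite a₂ b₂ V₂ Set.univ)
    (hexist : ∃ (Φ : Euc d → ℝ) (K : Set (Euc d)), IsCompact K ∧
      (∀ x, 0 < Φ x) ∧ ContDiff ℝ 2 Φ ∧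
      (∀ x ∉ K, a₁ x = a₂ x ∧ b₁ x = b₂ x) ∧
      (∀ x ∉ K, Lop a₂ b₂ Φ x + max (V₁ x) (V₂ x) * Φ x ≤
        lamStar a₁ b₁ V₁ Set.univ * Φ x))
    (Ψ₁ : Euc d → ℝ)
    (hgs₁ : IsGroundState a₁ b₁ (fun x => V₁ x - lamStar a₁ b₁ V₁ Set.univ) Ψ₁ Set.univ)
    (hlam : lamStar a₂ b₂ V₂ Set.univ ≤ lamStar a₁ b₁ V₁ Set.univ)
    (Ψ : Euc d → ℝ) (hΨC2 : ContDiff ℝ 2 Ψ) (hΨplus : ∃ x, 0 < Ψ x)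
    (hsub : ∀ x, lamStar a₁ b₁ V₁ Set.univ * Ψ x ≤ Lop a₂ b₂ Ψ x + V₂ x * Ψ x)
    (C : ℝ) (hC : 0 < C) (hbound : ∀ x, max (Ψ x) 0 ≤ C * Ψ₁ x) :
    lamStar a₁ b₁ V₁ Set.univ = lamStar a₂ b₂ V₂ Set.univ ∧
    IsGroundState a₂ b₂ (fun x => V₂ x - lamStar a₂ b₂ V₂ Set.univ) Ψ Set.univ := by
  obtain ⟨Φ, K, hK, hΦ0, hΦC, hcoeff, hΦ⟩ := hexist
  obtain ⟨r₀, hr₀, hKr⟩ := hK.isBounded.subset_ball_lt 0 0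
  have hout : ∀ x : Euc d, r₀ ≤ ‖x‖ → x ∉ K := fun x hx hxK =>
    absurd (mem_ball_zero_iff.1 (hKr hxK)) (not_lt.2 hx)
  set lam := lamStar a₁ b₁ V₁ univ with hlam₁
  have h := Comparison.of_isGroundState hstand₂.elliptic hV₂reg.continuous hr₀ hΦ0 hΦC
    (fun x hx => hcoeff x (hout x hx)) (fun x hx => hΦ x (hout x hx)) hgs₁
  have hPop : ∀ u x, Pop a₂ b₂ (fun x => V₂ x - lam) u x =
      Lop a₂ b₂ u x + V₂ x * u x - lam * u x := fun u x => by unfold Pop; ring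
  have hsub' : ∀ x, 0 ≤ Pop a₂ b₂ (fun x => V₂ x - lam) Ψ x := fun x => by
    rw [hPop]; linarith [hsub x]
  have hle : ∀ x, Ψ x ≤ C * Ψ₁ x := fun x => (le_max_left _ _).trans (hbound x)
  obtain ⟨x₀, hx₀⟩ := hΨplus
  have hrigid := h.rigidity (contDiffOn_univ.1 hgs₁.2.1) hC.le hΨC2 hsub' hle hx₀
    fun δ hδ => by
      obtain ⟨μ, hμ, φ, φC, φ0, hφ⟩ := exists_super_of_lamStar_lt hfin₂
        (hlam.trans_lt (lt_add_of_pos_right lam hδ))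
      refine ⟨φ, φC, φ0, fun x => ?_⟩
      rw [hPop]
      have := mul_le_mul_of_nonneg_right hμ.le (φ0 x).le
      linarith [hφ x]
  have hpos := pos_of_nonneg_of_pos h.ell h.contW₂ hΨC2 (fun x => (hrigid x).1.le)
    (fun x => (hrigid x).2) hx₀
  have heq : lam = lamStar a₂ b₂ V₂ univ := by
    refine le_antisymm (le_of_not_gt fun hlt => ?_) hlam
    obtain ⟨μ, hμ, φ, φC, φ0, hφ⟩ := exists_super_of_lamStar_lt hfin₂ hlt
    refine h.not_strict_super hC.le hΨC2 hsub' hle hpos φC φ0 fun x => ?_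
    rw [hPop]
    have := mul_lt_mul_of_pos_right hμ (φ0 x)
    linarith [hφ x]
  rw [← heq]
  refine ⟨rfl, fun x _ => hpos x, hΨC2.contDiffOn, fun x _ => (hrigid x).1,
    fun K' hK' _ v vC v0 hv => ?_⟩
  obtain ⟨r, hr, hKr'⟩ := hK'.isBounded.subset_ball_lt r₀ 0
  have hout' : ∀ x : Euc d, r < ‖x‖ → x ∈ univ \ K' := fun x hx => ⟨mem_univ x, fun hxK =>
    absurd (mem_ball_zero_iff.1 (hKr' hxK)) (not_lt.2 hx.le)⟩
  have hopen : IsOpen (univ \ K') := isOpen_univ.sdiff hK'.isClosed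
  obtain ⟨κ, hκ, hκle⟩ := h.minGrowth_of_le hC.le hΨC2 hsub' hle hr.le
    (fun x hx => (vC x (hout' x hx)).contDiffAt (hopen.mem_nhds (hout' x hx)))
    (fun x hx => v0 x (hout' x hx)) (fun x hx => hv x (hout' x hx))
  refine ⟨closedBall 0 (r + 1), isCompact_closedBall _ _,
    hKr'.trans (ball_subset_closedBall.trans (closedBall_subset_closedBall (by linarith))),
    subset_univ _, κ, hκ, fun x hx => hκle x (by simpa using hx.2)⟩
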